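/- arXiv:1811.06761 — 4 statements merged into one kernel-verified Lean document; each statement's English description precedes it below -/
import Mathlib

section
/- A graph is a pseudoforest if and only if it contains neither the diamond nor the butterfly as a minor; equivalently, the minor-obstruction set of the class of pseudoforests consists, up to isomorphism, exactly of the diamond and the butterfly. -/
open SimpleGraph

/-- `H` is a minor of `G` (branch-set definition): there is a family of connected, nonempty,
pairwise disjoint branch sets in `G`, indexed by the vertices of `H`, such that vertices
adjacent in `H` have an edge of `G` between their branch sets. -/
def IsMinorOf {W V : Type} (H : SimpleGraph W) (G : SimpleGraph V) : Prop :=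
  ∃ f : W → Set V,
    (∀ w, (G.induce (f w)).Connected) ∧
    (∀ ⦃w w' : W⦄, w ≠ w' → Disjoint (f w) (f w')) ∧
    (∀ ⦃w w' : W⦄, H.Adj w w' → ∃ a ∈ f w, ∃ b ∈ f w', G.Adj a b)

/-- A pseudoforest: every connected component contains at most one cycle, i.e. any two
cycles lying in the same connected component have the same edge set. -/
def Pseudoforest {V : Type} (G : SimpleGraph V) : Prop :=
  ∀ ⦃u v : V⦄ (c : G.Walk u u) (c' : G.Walk v v),
    c.IsCycle → c'.IsCycle → G.Reachable u v → ∀ e, e ∈ c.edges ↔ e ∈ c'.edges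

/-- The simple graph on `Fin n` with the given list of (0-indexed) edges. -/
def mkGraph (n : ℕ) (E : List (ℕ × ℕ)) : SimpleGraph (Fin n) :=
  SimpleGraph.fromRel fun a b => ((a : ℕ), (b : ℕ)) ∈ E

/-- The diamond: `K₄` minus one edge. -/
def diamondGraph : SimpleGraph (Fin 4) := mkGraph 4 [(0,1),(0,2),(0,3),(1,2),(1,3)]

/-- The butterfly: two triangles sharing exactly one vertex. -/
def butterflyGraph : SimpleGraph (Fin 5) := mkGraph 5 [(0,1),(0,2),(1,2),(0,3),(0,4),(3,4)]

/-- `G` is a minor-obstruction for the class of pseudoforests. -/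
def ObsPseudoforest {V : Type} (G : SimpleGraph V) : Prop :=
  ¬ Pseudoforest G ∧
    ∀ (W : Type) [Finite W] (H : SimpleGraph W),
      IsMinorOf H G → IsEmpty (H ≃g G) → Pseudoforest H

namespace SimpleGraph

variable {V W U : Type} {G : SimpleGraph V}

/-- Two vertex sets touch if some edge of the graph joins them. -/
def Touches (G : SimpleGraph V) (A B : Set V) : Prop :=
  ∃ a ∈ A, ∃ b ∈ B, G.Adj a b

lemma Touches.symm {A B : Set V} (h : G.Touches A B) : G.Touches B A := by
  obtain ⟨a, ha, b, hb, hab⟩ := h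
  exact ⟨b, hb, a, ha, hab.symm⟩

lemma diamondGraph_adj (a b : Fin 4) : diamondGraph.Adj a b ↔
    a ≠ b ∧ (((a : ℕ), (b : ℕ)) ∈ [(0,1),(0,2),(0,3),(1,2),(1,3)] ∨
      ((b : ℕ), (a : ℕ)) ∈ [(0,1),(0,2),(0,3),(1,2),(1,3)]) := Iff.rfl

lemma butterflyGraph_adj (a b : Fin 5) : butterflyGraph.Adj a b ↔
    a ≠ b ∧ (((a : ℕ), (b : ℕ)) ∈ [(0,1),(0,2),(1,2),(0,3),(0,4),(3,4)] ∨
      ((b : ℕ), (a : ℕ)) ∈ [(0,1),(0,2),(1,2),(0,3),(0,4),(3,4)]) := Iff.rfl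

instance : DecidableRel diamondGraph.Adj := fun a b => decidable_of_iff' _ (diamondGraph_adj a b)

instance : DecidableRel butterflyGraph.Adj :=
  fun a b => decidable_of_iff' _ (butterflyGraph_adj a b)

/-- Branch sets for a minor only need to be checked on pairs `i < j`. -/
lemma isMinorOf_of_lt {n : ℕ} {H : SimpleGraph (Fin n)} (f : Fin n → Set V)
    (hc : ∀ i, (G.induce (f i)).Connected) (hd : ∀ i j, i < j → Disjoint (f i) (f j))
    (ht : ∀ i j, i < j → H.Adj i j → G.Touches (f i) (f j)) : IsMinorOf H G := by
  refine ⟨f, hc, fun i j hij => ?_, fun i j hij => ?_⟩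
  · rcases lt_or_gt_of_ne hij with h | h
    · exact hd i j h
    · exact (hd j i h).symm
  · rcases lt_or_gt_of_ne hij.ne with h | h
    · exact ht i j h hij
    · exact (ht j i h hij.symm).symm

lemma diamond_isMinorOf {A B C D : Set V}
    (hA : (G.induce A).Connected) (hB : (G.induce B).Connected)
    (hC : (G.induce C).Connected) (hD : (G.induce D).Connected)
    (dAB : Disjoint A B) (dAC : Disjoint A C) (dAD : Disjoint A D)
    (dBC : Disjoint B C) (dBD : Disjoint B D) (dCD : Disjoint C D)
    (tAB : G.Touches A B) (tAC : G.Touches A C) (tAD : G.Touches A D)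
    (tBC : G.Touches B C) (tBD : G.Touches B D) : IsMinorOf diamondGraph G := by
  refine isMinorOf_of_lt ![A, B, C, D] ?_ ?_ ?_
  · intro i
    fin_cases i <;> assumption
  · intro i j hij
    fin_cases i <;> fin_cases j <;> first | assumption | exact absurd hij (by decide)
  · intro i j hij h
    fin_cases i <;> fin_cases j <;>
      first | assumption | exact absurd hij (by decide) | exact absurd h (by decide)

lemma butterfly_isMinorOf {A B C D E : Set V}
    (hA : (G.induce A).Connected) (hB : (G.induce B).Connected)
    (hC : (G.induce C).Connected) (hD : (G.induce D).Connected) (hE : (G.induce E).Connected)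
    (dAB : Disjoint A B) (dAC : Disjoint A C) (dAD : Disjoint A D) (dAE : Disjoint A E)
    (dBC : Disjoint B C) (dBD : Disjoint B D) (dBE : Disjoint B E)
    (dCD : Disjoint C D) (dCE : Disjoint C E) (dDE : Disjoint D E)
    (tAB : G.Touches A B) (tAC : G.Touches A C) (tBC : G.Touches B C)
    (tAD : G.Touches A D) (tAE : G.Touches A E) (tDE : G.Touches D E) :
    IsMinorOf butterflyGraph G := by
  refine isMinorOf_of_lt ![A, B, C, D, E] ?_ ?_ ?_
  · intro i
    fin_cases i <;> assumption
  · intro i j hij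
    fin_cases i <;> fin_cases j <;> first | assumption | exact absurd hij (by decide)
  · intro i j hij h
    fin_cases i <;> fin_cases j <;>
      first | assumption | exact absurd hij (by decide) | exact absurd h (by decide)

lemma connected_induce_singleton (G : SimpleGraph V) (x : V) : (G.induce {x}).Connected := by
  simp

/-- A nontrivial path splits into two adjacent connected parts, separating its ends. -/
lemma Walk.IsPath.exists_split {u v : V} {p : G.Walk u v} (hp : p.IsPath) (huv : u ≠ v) :
    ∃ A B : Set V, (G.induce A).Connected ∧ (G.induce B).Connected ∧ Disjoint A B ∧
      u ∈ A ∧ v ∈ B ∧ (∀ z, z ∈ p.support ↔ z ∈ A ∨ z ∈ B) ∧ G.Touches A B := by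
  cases p with
  | nil => exact absurd rfl huv
  | cons h q =>
    rw [cons_isPath_iff] at hp
    refine ⟨{u}, {z | z ∈ q.support}, connected_induce_singleton G u, q.connected_induce_support,
      ?_, rfl, q.end_mem_support, ?_, ⟨u, rfl, _, q.start_mem_support, h⟩⟩
    · simpa using hp.2
    · simp

/-- Removing a vertex from a cycle leaves a nontrivial path between two neighbours of it. -/
lemma Walk.IsCycle.exists_path {w x : V} {c : G.Walk w w} (hc : c.IsCycle) (hx : x ∈ c.support) :
    ∃ (u v : V) (p : G.Walk u v), p.IsPath ∧ u ≠ v ∧ x ∉ p.support ∧ G.Adj x u ∧ G.Adj x v ∧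
      (∀ z, z ∈ c.support ↔ z = x ∨ z ∈ p.support) ∧ s(x, u) ∈ c.edges ∧ s(x, v) ∈ c.edges := by
  classical
  have hr := hc.rotate hx
  have hs : ∀ z, z ∈ c.support ↔ z ∈ (c.rotate x hx).support := fun z =>
    (c.mem_support_rotate_iff x hx).symm
  have he : ∀ e, e ∈ c.edges ↔ e ∈ (c.rotate x hx).edges := fun e =>
    (c.rotate_edges x hx).mem_iff.symm
  simp only [hs, he]
  generalize c.rotate x hx = d at hr
  cases d with
  | nil => simp at hr
  | @cons _ u _ h q =>
    rw [cons_isCycle_iff] at hr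
    obtain ⟨hq, hxu⟩ := hr
    obtain ⟨r, rfl⟩ : ∃ r : G.Walk x u, q = r.reverse := ⟨q.reverse, by simp⟩
    cases r with
    | nil => exact absurd rfl h.ne
    | @cons _ v _ h' p =>
      rw [isPath_reverse_iff, cons_isPath_iff] at hq
      refine ⟨v, u, p, hq.1, ?_, hq.2, h', h, ?_, ?_, ?_⟩
      · rintro rfl
        simp at hxu
      · intro z
        have := p.start_mem_support
        simp only [support_cons, support_reverse, List.mem_cons, List.mem_reverse]
        tauto
      · simp
      · simp

/-- A chord of a cycle gives a diamond minor. -/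
lemma Walk.IsCycle.diamond_of_chord {w x y : V} {c : G.Walk w w} (hc : c.IsCycle)
    (hx : x ∈ c.support) (hy : y ∈ c.support) (hxy : G.Adj x y) (he : s(x, y) ∉ c.edges) :
    IsMinorOf diamondGraph G := by
  obtain ⟨u, v, p, hp, -, hxp, hxu, hxv, hs, heu, hev⟩ := hc.exists_path hx
  have hyp : y ∈ p.support := ((hs y).1 hy).resolve_left hxy.ne'
  have hyu : y ≠ u := by rintro rfl; exact he heu
  have hyv : y ≠ v := by rintro rfl; exact he hev
  obtain ⟨q, r, -, -, rfl⟩ := hp.mem_support_iff_exists_append.1 hyp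
  obtain ⟨q, rfl⟩ : ∃ q' : G.Walk y u, q = q'.reverse := ⟨q.reverse, by simp⟩
  cases q with
  | nil => exact absurd rfl hyu
  | @cons _ a _ ha q =>
    cases r with
    | nil => exact absurd rfl hyv
    | @cons _ b _ hb r =>
      have hd := hp.support_nodup
      rw [support_append, List.nodup_append] at hd
      simp only [support_reverse, support_cons, List.tail_cons, List.reverse_cons,
        List.mem_append, List.mem_reverse, List.mem_singleton] at hd
      have hq := hp.of_append_left
      rw [isPath_reverse_iff, cons_isPath_iff] at hq
      simp only [mem_support_append_iff, support_reverse, List.mem_reverse, support_cons,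
        List.mem_cons, not_or] at hxp
      refine diamond_isMinorOf (connected_induce_singleton G x) (connected_induce_singleton G y)
        q.connected_induce_support r.connected_induce_support ?_ ?_ ?_ ?_ ?_ ?_
        ⟨x, rfl, y, rfl, hxy⟩ ⟨x, rfl, u, q.end_mem_support, hxu⟩
        ⟨x, rfl, v, r.end_mem_support, hxv⟩ ⟨y, rfl, a, q.start_mem_support, ha⟩
        ⟨y, rfl, b, r.start_mem_support, hb⟩
      · simpa using hxy.ne
      · simpa using hxp.1.2
      · simpa using hxp.2.2
      · simpa using hq.2
      · rw [Set.disjoint_singleton_left]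
        exact fun h => hd.2.2 y (Or.inr rfl) y h rfl
      · rw [Set.disjoint_left]
        exact fun z hz hz' => hd.2.2 z (Or.inl hz) z hz' rfl

/-- A walk into a set contains a path meeting the set in its last vertex only. -/
lemma Walk.exists_isPath_first_mem {a b : V} (w : G.Walk a b) (S : Set V) (hb : b ∈ S) :
    ∃ y ∈ S, ∃ q : G.Walk a y, q.IsPath ∧ (∀ z ∈ q.support, z ∈ S → z = y) ∧
      q.support ⊆ w.support := by
  classical
  induction w with
  | nil => exact ⟨_, hb, nil, by simp, by simp, by simp⟩
  | @cons a c b h p ih =>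
    by_cases ha : a ∈ S
    · exact ⟨a, ha, nil, by simp, by simp, by simp⟩
    · obtain ⟨y, hy, q, -, hq, hs⟩ := ih hb
      have hsub := (cons h q).support_bypass_subset_support
      refine ⟨y, hy, (cons h q).bypass, bypass_isPath _, fun z hz hzS => ?_, fun z hz => ?_⟩
      · have := hsub hz
        rw [support_cons, List.mem_cons] at this
        rcases this with rfl | h'
        · exact absurd hzS ha
        · exact hq z h' hzS
      · have := hsub hz
        rw [support_cons, List.mem_cons] at this ⊢
        exact this.imp_right fun h' => hs h'

/-- A non-bridge leaving a cycle gives a diamond or a butterfly minor. -/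
lemma Walk.IsCycle.minor_of_ear {w x d : V} {c : G.Walk w w} (hc : c.IsCycle)
    (hx : x ∈ c.support) (hd : d ∉ c.support) (hxd : G.Adj x d)
    (hr : (G.deleteEdges {s(x, d)}).Reachable x d) :
    IsMinorOf diamondGraph G ∨ IsMinorOf butterflyGraph G := by
  obtain ⟨w'⟩ := hr.symm
  obtain ⟨y, hy, q, hq, hqS, -⟩ := w'.exists_isPath_first_mem {z | z ∈ c.support} hx
  obtain ⟨q, rfl⟩ : ∃ q' : (G.deleteEdges {s(x, d)}).Walk y d, q = q'.reverse :=
    ⟨q.reverse, by simp⟩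
  cases q with
  | nil => exact absurd hy hd
  | @cons _ d' _ hyd' q =>
    rw [isPath_reverse_iff, cons_isPath_iff] at hq
    have hqc : ∀ z ∈ q.support, z ∉ c.support := by
      intro z hz hzc
      have : z = y := hqS z (by simp [hz]) hzc
      exact hq.2 (this ▸ hz)
    obtain ⟨q', hq', hs'⟩ : ∃ q' : G.Walk d' d, q'.IsPath ∧ q'.support = q.support :=
      ⟨q.mapLe (deleteEdges_le _), hq.1.mapLe _, by simp⟩
    rw [← hs'] at hqc
    rw [deleteEdges_adj] at hyd'
    obtain ⟨u, v, p, hp, huv, hxp, hxu, hxv, hs, -, -⟩ := hc.exists_path hx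
    obtain ⟨A, B, hA, hB, dAB, huA, hvB, hpAB, tAB⟩ := hp.exists_split huv
    have hcA : ∀ z ∈ A, z ∈ c.support := fun z hz => (hs z).2 (Or.inr ((hpAB z).2 (Or.inl hz)))
    have hcB : ∀ z ∈ B, z ∈ c.support := fun z hz => (hs z).2 (Or.inr ((hpAB z).2 (Or.inr hz)))
    have hxA : Disjoint {x} A := by
      rw [Set.disjoint_singleton_left]
      exact fun h => hxp ((hpAB x).2 (Or.inl h))
    have hxB : Disjoint {x} B := by
      rw [Set.disjoint_singleton_left]
      exact fun h => hxp ((hpAB x).2 (Or.inr h))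
    have hdis : ∀ T T' : Set V, (∀ z ∈ T, z ∈ c.support) → (∀ z ∈ T', z ∈ q'.support) →
        Disjoint T T' := fun T T' h h' =>
      Set.disjoint_left.2 fun z hz hz' => hqc z (h' z hz') (h z hz)
    have hxc : ∀ z ∈ ({x} : Set V), z ∈ c.support := by simpa using hx
    by_cases hyx : y = x
    · subst hyx
      have hdd : d' ≠ d := by
        rintro rfl
        exact hyd'.2 rfl
      obtain ⟨C, D, hC, hD, dCD, hd'C, hdD, hqCD, tCD⟩ := hq'.exists_split hdd
      have hqC : ∀ z ∈ C, z ∈ q'.support := fun z hz => (hqCD z).2 (Or.inl hz)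
      have hqD : ∀ z ∈ D, z ∈ q'.support := fun z hz => (hqCD z).2 (Or.inr hz)
      exact Or.inr <| butterfly_isMinorOf (connected_induce_singleton G y) hA hB hC hD hxA hxB
        (hdis _ _ hxc hqC) (hdis _ _ hxc hqD) dAB (hdis _ _ hcA hqC) (hdis _ _ hcA hqD)
        (hdis _ _ hcB hqC) (hdis _ _ hcB hqD) dCD
        ⟨y, rfl, u, huA, hxu⟩ ⟨y, rfl, v, hvB, hxv⟩ tAB ⟨y, rfl, d', hd'C, hyd'.1⟩
        ⟨y, rfl, d, hdD, hxd⟩ tCD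
    · left
      have hqq : ∀ z ∈ {z | z ∈ q'.support}, z ∈ q'.support := fun z hz => hz
      have hxQ : G.Touches {x} {z | z ∈ q'.support} := ⟨x, rfl, d, q'.end_mem_support, hxd⟩
      rcases (hpAB y).1 (((hs y).1 hy).resolve_left hyx) with h | h
      · exact diamond_isMinorOf (connected_induce_singleton G x) hA hB
          q'.connected_induce_support hxA hxB (hdis _ _ hxc hqq) dAB (hdis _ _ hcA hqq)
          (hdis _ _ hcB hqq) ⟨x, rfl, u, huA, hxu⟩ ⟨x, rfl, v, hvB, hxv⟩ hxQ tAB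
          ⟨y, h, d', q'.start_mem_support, hyd'.1⟩
      · exact diamond_isMinorOf (connected_induce_singleton G x) hB hA
          q'.connected_induce_support hxB hxA (hdis _ _ hxc hqq) dAB.symm (hdis _ _ hcB hqq)
          (hdis _ _ hcA hqq) ⟨x, rfl, v, hvB, hxv⟩ ⟨x, rfl, u, huA, hxu⟩ hxQ tAB.symm
          ⟨y, h, d', q'.start_mem_support, hyd'.1⟩

/-- Two disjoint cycles in the same component give a butterfly minor. -/
lemma Walk.IsCycle.butterfly_of_disjoint {a b : V} {c : G.Walk a a} {c' : G.Walk b b}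
    (hc : c.IsCycle) (hc' : c'.IsCycle) (hr : G.Reachable a b)
    (hdis : ∀ z ∈ c.support, z ∉ c'.support) : IsMinorOf butterflyGraph G := by
  obtain ⟨w⟩ := hr
  obtain ⟨y, hy, q, -, hqy, -⟩ :=
    w.exists_isPath_first_mem {z | z ∈ c'.support} c'.start_mem_support
  obtain ⟨x, hx, r, -, hrx, hrq⟩ :=
    q.reverse.exists_isPath_first_mem {z | z ∈ c.support} c.start_mem_support
  have hry : ∀ z ∈ r.support, z ∈ c'.support → z = y := fun z hz =>
    hqy z (by simpa using hrq hz)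
  obtain ⟨u, v, p, hp, huv, hxp, hxu, hxv, hs, -, -⟩ := hc.exists_path hx
  obtain ⟨A, B, hA, hB, dAB, huA, hvB, hpAB, tAB⟩ := hp.exists_split huv
  obtain ⟨u', v', p', hp', huv', hyp', hyu', hyv', hs', -, -⟩ := hc'.exists_path hy
  obtain ⟨C, D, hC, hD, dCD, huC, hvD, hpCD, tCD⟩ := hp'.exists_split huv'
  have hA' : ∀ z ∈ A, z ∈ p.support := fun z hz => (hpAB z).2 (Or.inl hz)
  have hB' : ∀ z ∈ B, z ∈ p.support := fun z hz => (hpAB z).2 (Or.inr hz)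
  have hC' : ∀ z ∈ C, z ∈ p'.support := fun z hz => (hpCD z).2 (Or.inl hz)
  have hD' : ∀ z ∈ D, z ∈ p'.support := fun z hz => (hpCD z).2 (Or.inr hz)
  have d1 : ∀ T : Set V, (∀ z ∈ T, z ∈ p.support) → Disjoint {z | z ∈ r.support} T :=
    fun T hT => Set.disjoint_left.2 fun z hz hzT =>
      hxp (hrx z hz ((hs z).2 (Or.inr (hT z hzT))) ▸ hT z hzT)
  have d2 : ∀ T : Set V, (∀ z ∈ T, z ∈ p'.support) → Disjoint {z | z ∈ r.support} T :=
    fun T hT => Set.disjoint_left.2 fun z hz hzT =>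
      hyp' (hry z hz ((hs' z).2 (Or.inr (hT z hzT))) ▸ hT z hzT)
  have d3 : ∀ T T' : Set V, (∀ z ∈ T, z ∈ p.support) → (∀ z ∈ T', z ∈ p'.support) →
      Disjoint T T' := fun T T' hT hT' => Set.disjoint_left.2 fun z hz hz' =>
    hdis z ((hs z).2 (Or.inr (hT z hz))) ((hs' z).2 (Or.inr (hT' z hz')))
  exact butterfly_isMinorOf r.connected_induce_support hA hB hC hD (d1 A hA') (d1 B hB')
    (d2 C hC') (d2 D hD') dAB (d3 _ _ hA' hC') (d3 _ _ hA' hD') (d3 _ _ hB' hC') (d3 _ _ hB' hD')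
    dCD ⟨x, r.end_mem_support, u, huA, hxu⟩ ⟨x, r.end_mem_support, v, hvB, hxv⟩ tAB
    ⟨y, r.start_mem_support, u', huC, hyu'⟩ ⟨y, r.start_mem_support, v', hvD, hyv'⟩ tCD

lemma Walk.IsCycle.minor_of_edge_notMem {a b : V} {c : G.Walk a a} {c' : G.Walk b b}
    (hc : c.IsCycle) (hc' : c'.IsCycle) (hr : G.Reachable a b) {e : Sym2 V}
    (he : e ∉ c.edges) (he' : e ∈ c'.edges) :
    IsMinorOf diamondGraph G ∨ IsMinorOf butterflyGraph G := by
  classical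
  by_cases hdis : ∀ z ∈ c.support, z ∉ c'.support
  · exact Or.inr (hc.butterfly_of_disjoint hc' hr hdis)
  by_cases hsub : ∀ z ∈ c'.support, z ∈ c.support
  · left
    induction e with
    | h x y =>
      exact hc.diamond_of_chord (hsub x (c'.fst_mem_support_of_mem_edges he'))
        (hsub y (c'.snd_mem_support_of_mem_edges he')) (c'.adj_of_mem_edges he') he
  push Not at hdis hsub
  obtain ⟨x, hxc, hxc'⟩ := hdis
  obtain ⟨y, hyc', hyc⟩ := hsub
  have hy : y ∈ (c'.rotate x hxc').support := (c'.mem_support_rotate_iff x hxc').2 hyc'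
  obtain ⟨d, hd, hd1, hd2⟩ := ((c'.rotate x hxc').takeUntil y hy).exists_boundary_dart
    {z | z ∈ c.support} hxc hyc
  have hde : s(d.fst, d.snd) ∈ c'.edges := by
    rw [← (c'.rotate_edges x hxc').mem_iff]
    exact edges_takeUntil_subset_edges _ hy (List.mem_map_of_mem hd)
  exact hc.minor_of_ear hd1 hd2 d.adj
    (adj_and_reachable_delete_edges_iff_exists_cycle.2 ⟨b, c', hc', hde⟩).2

lemma minor_of_not_pseudoforest (h : ¬ Pseudoforest G) :
    IsMinorOf diamondGraph G ∨ IsMinorOf butterflyGraph G := by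
  unfold Pseudoforest at h
  push Not at h
  obtain ⟨u, v, c, c', hc, hc', hr, e, ⟨he, he'⟩ | ⟨he, he'⟩⟩ := h
  · exact hc'.minor_of_edge_notMem hc hr.symm he' he
  · exact hc.minor_of_edge_notMem hc' hr he he'

/-- The union of the branch sets of a model of a connected graph is connected. -/
lemma connected_induce_iUnion {H : SimpleGraph W} (hH : H.Connected) {f : W → Set V}
    (hc : ∀ w, (G.induce (f w)).Connected)
    (ht : ∀ ⦃w w' : W⦄, H.Adj w w' → G.Touches (f w) (f w')) :
    (G.induce (⋃ w, f w)).Connected := by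
  have key : ∀ (w w' : W), H.Reachable w w' → ∀ a (ha : a ∈ f w) b (hb : b ∈ f w'),
      (G.induce (⋃ w, f w)).Reachable ⟨a, Set.mem_iUnion_of_mem w ha⟩
        ⟨b, Set.mem_iUnion_of_mem w' hb⟩ := by
    have base : ∀ w a (ha : a ∈ f w) b (hb : b ∈ f w),
        (G.induce (⋃ w, f w)).Reachable ⟨a, Set.mem_iUnion_of_mem w ha⟩
          ⟨b, Set.mem_iUnion_of_mem w hb⟩ := fun w a ha b hb =>
      ((hc w).preconnected ⟨a, ha⟩ ⟨b, hb⟩).map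
        (induceHomOfLE G (Set.subset_iUnion f w)).toHom
    rintro w w' ⟨p⟩
    induction p with
    | nil => exact base _
    | @cons u v x h p ih =>
      intro a ha b hb
      obtain ⟨y, hy, z, hz, hyz⟩ := ht h
      refine ((base _ a ha y hy).trans (Adj.reachable ?_)).trans (ih z hz b hb)
      exact hyz
  obtain ⟨w₀⟩ := hH.nonempty
  obtain ⟨⟨v₀, hv₀⟩⟩ := (hc w₀).nonempty
  have : Nonempty (⋃ w, f w) := ⟨⟨v₀, Set.mem_iUnion_of_mem w₀ hv₀⟩⟩
  refine ⟨?_⟩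
  rintro ⟨a, ha⟩ ⟨b, hb⟩
  obtain ⟨w, hw⟩ := Set.mem_iUnion.1 ha
  obtain ⟨w', hw'⟩ := Set.mem_iUnion.1 hb
  exact key w w' (hH.preconnected w w') a hw b hw'

lemma isMinorOf_trans {K : SimpleGraph U} {H : SimpleGraph W} (h₁ : IsMinorOf K H)
    (h₂ : IsMinorOf H G) : IsMinorOf K G := by
  obtain ⟨g, gc, gd, gt⟩ := h₁
  obtain ⟨f, fc, fd, ft⟩ := h₂
  refine ⟨fun u => ⋃ w : g u, f w, fun u => ?_, fun u u' huu => ?_, fun u u' huu => ?_⟩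
  · exact connected_induce_iUnion (gc u) (fun w => fc w) fun w w' hw => ft hw
  · simp only [Set.disjoint_iUnion_left, Set.disjoint_iUnion_right]
    rintro ⟨w, hw⟩ ⟨w', hw'⟩
    refine fd ?_
    rintro rfl
    exact Set.disjoint_left.1 (gd huu) hw' hw
  · obtain ⟨w, hw, w', hw', hww⟩ := gt huu
    obtain ⟨a, ha, b, hb, hab⟩ := ft hww
    exact ⟨a, Set.mem_iUnion_of_mem ⟨w, hw⟩ ha, b, Set.mem_iUnion_of_mem ⟨w', hw'⟩ hb, hab⟩

lemma isMinorOf_of_injective_hom {H : SimpleGraph W} (φ : H →g G) (hφ : Function.Injective φ) :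
    IsMinorOf H G :=
  ⟨fun w => {φ w}, fun w => connected_induce_singleton G (φ w),
    fun w w' h => by simpa using fun h' => h (hφ h'),
    fun w w' h => ⟨φ w, rfl, φ w', rfl, φ.map_adj h⟩⟩

/-- A minor model yields an injection of vertices, which is a homomorphism if it is surjective. -/
lemma exists_injective_of_isMinorOf {H : SimpleGraph W} (h : IsMinorOf H G) :
    ∃ φ : W → V, Function.Injective φ ∧
      (Function.Surjective φ → ∀ ⦃w w'⦄, H.Adj w w' → G.Adj (φ w) (φ w')) := by
  obtain ⟨f, fc, fd, ft⟩ := h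
  have hne : ∀ w, ∃ v, v ∈ f w := fun w => by
    obtain ⟨⟨v, hv⟩⟩ := (fc w).nonempty
    exact ⟨v, hv⟩
  choose φ hφ using hne
  have hdis : ∀ w w' v, v ∈ f w → v ∈ f w' → w = w' := fun w w' v hv hv' => by
    by_contra hww
    exact Set.disjoint_left.1 (fd hww) hv hv'
  refine ⟨φ, fun w w' hww => hdis w w' _ (hφ w) (hww ▸ hφ w'), fun hs w w' hww => ?_⟩
  obtain ⟨a, ha, b, hb, hab⟩ := ft hww
  obtain ⟨x, rfl⟩ := hs a
  obtain ⟨y, rfl⟩ := hs b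
  rwa [hdis w x _ ha (hφ x), hdis w' y _ hb (hφ y)]

lemma card_le_of_isMinorOf [Finite V] {H : SimpleGraph W} (h : IsMinorOf H G) :
    Nat.card W ≤ Nat.card V := by
  obtain ⟨φ, hφ, -⟩ := exists_injective_of_isMinorOf h
  exact Nat.card_le_card_of_injective φ hφ

/-- The minor relation is antisymmetric on finite graphs. -/
lemma nonempty_iso_of_isMinorOf [Finite V] [Finite W] {H : SimpleGraph W} (h₁ : IsMinorOf H G)
    (h₂ : IsMinorOf G H) : Nonempty (H ≃g G) := by
  have hcard : Nat.card W = Nat.card V :=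
    le_antisymm (card_le_of_isMinorOf h₁) (card_le_of_isMinorOf h₂)
  obtain ⟨φ, hφ, hφa⟩ := exists_injective_of_isMinorOf h₁
  obtain ⟨ψ, hψ, hψa⟩ := exists_injective_of_isMinorOf h₂
  have hφb := (Nat.bijective_iff_injective_and_card φ).2 ⟨hφ, hcard⟩
  have hψb := (Nat.bijective_iff_injective_and_card ψ).2 ⟨hψ, hcard.symm⟩
  let Φ : H →g G := ⟨φ, fun h => hφa hφb.2 h⟩
  let Ψ : G →g H := ⟨ψ, fun h => hψa hψb.2 h⟩
  have hE : Function.Bijective Φ.mapEdgeSet :=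
    (Nat.bijective_iff_injective_and_card _).2 ⟨Hom.mapEdgeSet.injective Φ hφ,
      le_antisymm (Nat.card_le_card_of_injective _ (Hom.mapEdgeSet.injective Φ hφ))
        (Nat.card_le_card_of_injective _ (Hom.mapEdgeSet.injective Ψ hψ))⟩
  refine ⟨⟨Equiv.ofBijective φ hφb, fun {a b} => ⟨fun hab => ?_, fun hab => hφa hφb.2 hab⟩⟩⟩
  obtain ⟨⟨e, he⟩, hee⟩ := hE.2 ⟨s(φ a, φ b), hab⟩
  have hee' : Sym2.map φ e = Sym2.map φ s(a, b) := congrArg Subtype.val hee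
  rw [← mem_edgeSet, ← Sym2.map.injective hφ hee']
  exact he

/-- A graph having a minor with a universal vertex and two edges avoiding it is not a
pseudoforest. -/
lemma not_pseudoforest_of_isMinorOf {H : SimpleGraph W} (h : IsMinorOf H G) {o p q r s : W}
    (ho : ∀ w, w ≠ o → H.Adj o w) (hpq : H.Adj p q) (hrs : H.Adj r s)
    (hp : p ≠ o) (hq : q ≠ o) (hr : r ≠ o) (hs : s ≠ o) (hne : s(p, q) ≠ s(r, s)) :
    ¬ Pseudoforest G := by
  classical
  obtain ⟨f, fc, fd, ft⟩ := h
  have hdis : ∀ w w' v, v ∈ f w → v ∈ f w' → w = w' := fun w w' v hv hv' => by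
    by_contra hww
    exact Set.disjoint_left.1 (fd hww) hv hv'
  obtain ⟨a, ha, b, hb, hab⟩ := ft hpq
  obtain ⟨c, hc, d, hd, hcd⟩ := ft hrs
  have hee : s(a, b) ≠ s(c, d) := by
    intro h
    apply hne
    rw [Sym2.eq_iff] at h ⊢
    rcases h with ⟨rfl, rfl⟩ | ⟨rfl, rfl⟩
    · exact Or.inl ⟨hdis _ _ _ ha hc, hdis _ _ _ hb hd⟩
    · exact Or.inr ⟨hdis _ _ _ ha hd, hdis _ _ _ hb hc⟩
  have hin : ∀ w x y, x ∈ f w → y ∈ f w → s(x, y) ≠ s(a, b) ∧ s(x, y) ≠ s(c, d) := by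
    intro w x y hx hy
    constructor <;> intro h <;> rw [Sym2.eq_iff] at h
    · rcases h with ⟨rfl, rfl⟩ | ⟨rfl, rfl⟩
      · exact hpq.ne ((hdis _ _ _ ha hx).trans (hdis _ _ _ hy hb))
      · exact hpq.ne ((hdis _ _ _ ha hy).trans (hdis _ _ _ hx hb))
    · rcases h with ⟨rfl, rfl⟩ | ⟨rfl, rfl⟩
      · exact hrs.ne ((hdis _ _ _ hc hx).trans (hdis _ _ _ hy hd))
      · exact hrs.ne ((hdis _ _ _ hc hy).trans (hdis _ _ _ hx hd))
  have hout : ∀ x y, x ∈ f o → s(x, y) ≠ s(a, b) ∧ s(x, y) ≠ s(c, d) := by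
    intro x y hx
    constructor <;> intro h <;> rw [Sym2.eq_iff] at h
    · rcases h with ⟨rfl, rfl⟩ | ⟨rfl, rfl⟩
      · exact hp (hdis _ _ _ ha hx)
      · exact hq (hdis _ _ _ hb hx)
    · rcases h with ⟨rfl, rfl⟩ | ⟨rfl, rfl⟩
      · exact hr (hdis _ _ _ hc hx)
      · exact hs (hdis _ _ _ hd hx)
  have hconn : ((G.deleteEdges {s(a, b), s(c, d)}).induce (⋃ w, f w)).Connected := by
    refine connected_induce_iUnion (H := SimpleGraph.fromRel fun x _ => x = o) ?_
      (fun w => ?_) ?_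
    · have key : ∀ w, (SimpleGraph.fromRel fun x _ : W => x = o).Reachable o w := fun w => by
        by_cases hw : w = o
        · rw [hw]
        · exact Adj.reachable ⟨Ne.symm hw, Or.inl rfl⟩
      exact (connected_iff_exists_forall_reachable _).2 ⟨o, key⟩
    · convert fc w using 1
      ext ⟨x, hx⟩ ⟨y, hy⟩
      simpa using fun _ => hin w x y hx hy
    · have key : ∀ w, w ≠ o → (G.deleteEdges {s(a, b), s(c, d)}).Touches (f o) (f w) := by
        intro w hw
        obtain ⟨x, hx, y, hy, hxy⟩ := ft (ho w hw)
        exact ⟨x, hx, y, hy, by simpa [hxy] using hout x y hx⟩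
      rintro w w' ⟨hww, rfl | rfl⟩
      · exact key w' hww.symm
      · exact (key w hww).symm
  have hreach : ∀ w w' x y, x ∈ f w → y ∈ f w' →
      (G.deleteEdges {s(a, b), s(c, d)}).Reachable x y := fun w w' x y hx hy =>
    (hconn.preconnected ⟨x, Set.mem_iUnion_of_mem w hx⟩ ⟨y, Set.mem_iUnion_of_mem w' hy⟩).map
      (Embedding.induce _).toHom
  obtain ⟨u, C, hC, hCe⟩ := (adj_and_reachable_delete_edges_iff_exists_cycle
    (G := G.deleteEdges {s(c, d)}) (v := a) (w := b)).1 ⟨by simpa [hab] using hee, by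
      rw [deleteEdges_deleteEdges, Set.union_comm]
      exact hreach p q a b ha hb⟩
  obtain ⟨v, D, hD, hDe⟩ := (adj_and_reachable_delete_edges_iff_exists_cycle
    (G := G) (v := c) (w := d)).1 ⟨hcd, (hreach r s c d hc hd).mono
      (deleteEdges_anti (by simp))⟩
  have hCc : s(c, d) ∉ C.edges := fun h => by
    simpa using C.adj_of_mem_edges h
  intro hG
  have hle : G.deleteEdges {s(c, d)} ≤ G := deleteEdges_le _
  have huv : G.Reachable u v := by
    have h₁ : G.Reachable u a :=
      ⟨(C.mapLe hle).takeUntil a (by simpa using C.fst_mem_support_of_mem_edges hCe)⟩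
    have h₂ : G.Reachable v c := ⟨D.takeUntil c (D.fst_mem_support_of_mem_edges hDe)⟩
    exact h₁.trans (((hreach p r a c ha hc).mono (deleteEdges_le _)).trans h₂.symm)
  have := (hG (C.mapLe hle) D (hC.mapLe hle) hD huv s(c, d)).2 hDe
  exact hCc (by simpa using this)

lemma not_pseudoforest_of_diamond (h : IsMinorOf diamondGraph G) : ¬ Pseudoforest G :=
  not_pseudoforest_of_isMinorOf h (o := 0) (p := 1) (q := 2) (r := 1) (s := 3)
    (by decide) (by decide) (by decide) (by decide) (by decide) (by decide) (by decide)
    (by decide)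

lemma not_pseudoforest_of_butterfly (h : IsMinorOf butterflyGraph G) : ¬ Pseudoforest G :=
  not_pseudoforest_of_isMinorOf h (o := 0) (p := 1) (q := 2) (r := 3) (s := 4)
    (by decide) (by decide) (by decide) (by decide) (by decide) (by decide) (by decide)
    (by decide)

lemma Reachable.apply_eq_of_forall_adj {α : Type} {φ : V → α}
    (h : ∀ a b, G.Adj a b → φ a = φ b) {a b : V} (hr : G.Reachable a b) : φ a = φ b := by
  obtain ⟨p⟩ := hr
  induction p with
  | nil => rfl
  | cons hab _ ih => exact (h _ _ hab).trans ih

lemma not_diamond_isMinorOf_butterfly : ¬ IsMinorOf diamondGraph butterflyGraph := by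
  rintro ⟨f, fc, fd, ft⟩
  have hdis : ∀ w w' v, v ∈ f w → v ∈ f w' → w = w' := fun w w' v hv hv' => by
    by_contra hww
    exact Set.disjoint_left.1 (fd hww) hv hv'
  obtain ⟨o, ho⟩ : ∃ o, ∀ w, w ≠ o → (0 : Fin 5) ∉ f w := by
    by_cases h : ∃ o, (0 : Fin 5) ∈ f o
    · obtain ⟨o, h⟩ := h
      exact ⟨o, fun w hw hw' => hw (hdis _ _ _ hw' h)⟩
    · push Not at h
      exact ⟨0, fun w _ => h w⟩
  have hside : ∀ a b : Fin 5, a ≠ 0 → b ≠ 0 → butterflyGraph.Adj a b →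
      decide (a < 3) = decide (b < 3) := by decide
  have hin : ∀ w, w ≠ o → ∀ a ∈ f w, ∀ b ∈ f w, decide (a < 3) = decide (b < 3) := by
    intro w hw a ha b hb
    refine Reachable.apply_eq_of_forall_adj (φ := fun x : f w => decide ((x : Fin 5) < 3))
      ?_ ((fc w).preconnected ⟨a, ha⟩ ⟨b, hb⟩)
    rintro ⟨x, hx⟩ ⟨y, hy⟩ hxy
    refine hside x y ?_ ?_ hxy <;> rintro rfl
    · exact ho w hw hx
    · exact ho w hw hy
  have hadj : ∀ w w', w ≠ o → w' ≠ o → diamondGraph.Adj w w' → ∀ a ∈ f w, ∀ b ∈ f w',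
      decide (a < 3) = decide (b < 3) := by
    intro w w' hw hw' hww a ha b hb
    obtain ⟨x, hx, y, hy, hxy⟩ := ft hww
    refine (hin w hw a ha x hx).trans ((hside x y ?_ ?_ hxy).trans (hin w' hw' y hy b hb)) <;>
      rintro rfl
    · exact ho w hw hx
    · exact ho w' hw' hy
  obtain ⟨u, m, v, hu, hm, hv, hum, hmv, huv⟩ : ∃ u m v, u ≠ o ∧ m ≠ o ∧ v ≠ o ∧
      diamondGraph.Adj u m ∧ diamondGraph.Adj m v ∧ u ≠ v := by
    clear ho hin hadj
    revert o
    decide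
  obtain ⟨⟨x, hx⟩⟩ := (fc u).nonempty
  obtain ⟨⟨y, hy⟩⟩ := (fc m).nonempty
  obtain ⟨⟨z, hz⟩⟩ := (fc v).nonempty
  have h₁ := hadj u m hu hm hum x hx y hy
  have h₂ := hadj m v hm hv hmv y hy z hz
  have hx0 : x ≠ 0 := by rintro rfl; exact ho u hu hx
  have hy0 : y ≠ 0 := by rintro rfl; exact ho m hm hy
  have hz0 : z ≠ 0 := by rintro rfl; exact ho v hv hz
  have hxy : x ≠ y := by rintro rfl; exact hum.ne (hdis _ _ _ hx hy)
  have hyz : y ≠ z := by rintro rfl; exact hmv.ne (hdis _ _ _ hy hz)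
  have hxz : x ≠ z := by rintro rfl; exact huv (hdis _ _ _ hx hz)
  clear hx hy hz
  revert x y z
  decide

lemma not_butterfly_isMinorOf_diamond : ¬ IsMinorOf butterflyGraph diamondGraph := fun h => by
  simpa using card_le_of_isMinorOf h

end SimpleGraph

/-- A graph is a pseudoforest iff it contains neither the diamond nor the butterfly as a
minor; equivalently the obstruction set of pseudoforests consists exactly of the diamond
and the butterfly. -/
theorem pseudoforest_obstructions :
    (∀ (V : Type) [Finite V] (G : SimpleGraph V),
      Pseudoforest G ↔ ¬ IsMinorOf diamondGraph G ∧ ¬ IsMinorOf butterflyGraph G) ∧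
    (∀ (V : Type) [Finite V] (G : SimpleGraph V),
      ObsPseudoforest G ↔ (Nonempty (G ≃g diamondGraph) ∨ Nonempty (G ≃g butterflyGraph))) := by
  have minor_of_iso : ∀ {V W : Type} {G : SimpleGraph V} {H : SimpleGraph W},
      (G ≃g H) → IsMinorOf G H := fun e => isMinorOf_of_injective_hom e.toHom e.injective
  refine ⟨fun V _ G => ⟨fun h => ⟨fun h' => not_pseudoforest_of_diamond h' h,
    fun h' => not_pseudoforest_of_butterfly h' h⟩, fun h => ?_⟩, fun V _ G => ⟨?_, ?_⟩⟩
  · by_contra hG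
    exact (minor_of_not_pseudoforest hG).elim h.1 h.2
  · rintro ⟨hG, hmin⟩
    by_contra hiso
    simp only [not_or, not_nonempty_iff] at hiso
    rcases minor_of_not_pseudoforest hG with h | h
    · exact not_pseudoforest_of_diamond (minor_of_iso .refl)
        (hmin _ _ h ⟨fun e => hiso.1.false e.symm⟩)
    · exact not_pseudoforest_of_butterfly (minor_of_iso .refl)
        (hmin _ _ h ⟨fun e => hiso.2.false e.symm⟩)
  · rintro (⟨⟨e⟩⟩ | ⟨⟨e⟩⟩)
    · refine ⟨not_pseudoforest_of_diamond (minor_of_iso e.symm), fun W _ H hH hiso => ?_⟩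
      by_contra hp
      rcases minor_of_not_pseudoforest hp with h | h
      · obtain ⟨i⟩ := nonempty_iso_of_isMinorOf hH (isMinorOf_trans (minor_of_iso e) h)
        exact hiso.false i
      · exact not_butterfly_isMinorOf_diamond
          (isMinorOf_trans h (isMinorOf_trans hH (minor_of_iso e)))
    · refine ⟨not_pseudoforest_of_butterfly (minor_of_iso e.symm), fun W _ H hH hiso => ?_⟩
      by_contra hp
      rcases minor_of_not_pseudoforest hp with h | h
      · exact not_diamond_isMinorOf_butterfly
          (isMinorOf_trans h (isMinorOf_trans hH (minor_of_iso e)))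
      · obtain ⟨i⟩ := nonempty_iso_of_isMinorOf hH (isMinorOf_trans (minor_of_iso e) h)
        exact hiso.false i
end

section
/- Every triconnected graph (on at least four vertices) that is not isomorphic to the wheel W_r for any r >= 3 contains at least one of the following three graphs as a minor: the prism, the complete bipartite graph K(3,3), or the complete graph K5 minus one edge. -/
open SimpleGraph

/-- `G` is `k`-connected: between any two distinct vertices `u ≠ v` there exist `k`
pairwise distinct `(u,v)`-paths, any two of which share no vertices other than `u,v`. -/
def KConnected {V : Type} (k : ℕ) (G : SimpleGraph V) : Prop :=
  ∀ ⦃u v : V⦄, u ≠ v → ∃ P : Fin k → G.Walk u v,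
    Function.Injective P ∧ (∀ i, (P i).IsPath) ∧
      ∀ i j, i ≠ j → ∀ x, x ∈ (P i).support → x ∈ (P j).support → x = u ∨ x = v

/-- The wheel `W_r`: a cycle on `r` vertices plus a central vertex joined to all of them. -/
def wheelGraph (r : ℕ) : SimpleGraph (Option (Fin r)) :=
  SimpleGraph.fromRel fun x y =>
    match x, y with
    | none, some _ => True
    | some i, some j => ((j : ℕ) = ((i : ℕ) + 1) % r)
    | _, _ => False

/-- The prism: two triangles joined by a perfect matching. -/
def prismGraph : SimpleGraph (Fin 6) :=
  mkGraph 6 [(0,1),(0,2),(1,2),(3,4),(3,5),(4,5),(0,3),(1,4),(2,5)]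

/-- The complete bipartite graph `K₃,₃`. -/
def K33Graph : SimpleGraph (Fin 6) :=
  mkGraph 6 [(0,3),(0,4),(0,5),(1,3),(1,4),(1,5),(2,3),(2,4),(2,5)]

/-- `K₅` minus one edge. -/
def K5eGraph : SimpleGraph (Fin 5) :=
  mkGraph 5 [(0,1),(0,2),(0,3),(0,4),(1,2),(1,3),(1,4),(2,3),(2,4)]

/-- `G` has no vertex separator with at most two elements. -/
def TwoCutFree {V : Type} (G : SimpleGraph V) : Prop :=
  ∀ (x y : V) (X : Set V), X.Nonempty → x ∉ X → y ∉ X →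
    (∀ a ∈ X, ∀ b, G.Adj a b → b ∈ X ∨ b = x ∨ b = y) → ∀ z, z ∈ X ∨ z = x ∨ z = y

/-- `X` is a nonempty union of components of `G` minus the vertices `x`, `y`, `z`, and does not
contain all the remaining vertices. -/
def IsThreeCut {V : Type} (G : SimpleGraph V) (x y z : V) (X : Set V) : Prop :=
  X.Nonempty ∧ x ∉ X ∧ y ∉ X ∧ z ∉ X ∧
    (∀ a ∈ X, ∀ b, G.Adj a b → b ∈ X ∨ b = x ∨ b = y ∨ b = z) ∧
    ∃ w, w ∉ X ∧ w ≠ x ∧ w ≠ y ∧ w ≠ z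

/-- `G` is a wheel with hub `h` and rim `p 0, …, p (r - 1)`. -/
structure IsWheelWith {V : Type} (G : SimpleGraph V) (r : ℕ) (h : V) (p : ℕ → V) : Prop where
  ne_hub : ∀ i < r, p i ≠ h
  inj : ∀ i < r, ∀ j < r, p i = p j → i = j
  cover : ∀ x, x = h ∨ ∃ i < r, p i = x
  hub_adj : ∀ i < r, G.Adj h (p i)
  adj : ∀ i j, i < j → j < r → (G.Adj (p i) (p j) ↔ j = i + 1 ∨ (i = 0 ∧ j + 1 = r))

/-- The map collapsing `v` onto `u`. -/
noncomputable def collapse {V : Type} {u v : V} (huv : u ≠ v) (x : V) : {x : V // x ≠ v} :=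
  open Classical in if h : x = v then ⟨u, huv⟩ else ⟨x, h⟩

/-- The graph obtained from `G` by contracting `v` onto `u`. -/
noncomputable def contract {V : Type} (G : SimpleGraph V) {u v : V} (huv : u ≠ v) :
    SimpleGraph {x : V // x ≠ v} :=
  G.map (collapse huv)

section Contraction

variable {V : Type} {G : SimpleGraph V} {u v : V}

theorem collapse_self (huv : u ≠ v) : collapse huv v = ⟨u, huv⟩ := by
  simp [collapse]

theorem collapse_of_ne (huv : u ≠ v) {x : V} (h : x ≠ v) : collapse huv x = ⟨x, h⟩ := by
  simp [collapse, h]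

theorem collapse_eq_iff (huv : u ≠ v) (x : V) (y : {x : V // x ≠ v}) :
    collapse huv x = y ↔ x = y ∨ (x = v ∧ (y : V) = u) := by
  obtain ⟨y, hy⟩ := y
  by_cases h : x = v
  · subst h
    rw [collapse_self]
    simp only [Subtype.mk.injEq]
    grind
  · rw [collapse_of_ne huv h]
    simp only [Subtype.mk.injEq]
    grind

theorem contract_adj (huv : u ≠ v) (a b : {x : V // x ≠ v}) :
    (contract G huv).Adj a b ↔ a ≠ b ∧
      (G.Adj a b ∨ ((a : V) = u ∧ G.Adj v b) ∨ ((b : V) = u ∧ G.Adj v a)) := by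
  rw [contract, SimpleGraph.map_adj']
  simp only [collapse_eq_iff]
  obtain ⟨a, ha⟩ := a
  obtain ⟨b, hb⟩ := b
  simp only [ne_eq, Subtype.mk.injEq]
  constructor
  · rintro ⟨h, c, d, hcd, h1, h2⟩
    have := hcd.symm
    have := hcd.ne
    grind
  · rintro ⟨h, h1 | ⟨h1, h2⟩ | ⟨h1, h2⟩⟩
    · exact ⟨h, a, b, h1, .inl rfl, .inl rfl⟩
    · exact ⟨h, v, b, h2, .inr ⟨rfl, h1⟩, .inl rfl⟩
    · exact ⟨h, a, v, h2.symm, .inl rfl, .inr ⟨rfl, h1⟩⟩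

theorem contract_adj_collapse (huv : u ≠ v) {a b : V} (h : G.Adj a b)
    (hne : collapse huv a ≠ collapse huv b) :
    (contract G huv).Adj (collapse huv a) (collapse huv b) := by
  rw [contract, SimpleGraph.map_adj']
  exact ⟨hne, a, b, h, rfl, rfl⟩

theorem connected_preimage_collapse (huv : G.Adj u v) {S : Set {x : V // x ≠ v}}
    (hS : ((contract G huv.ne).induce S).Connected) :
    (G.induce (collapse huv.ne ⁻¹' S)).Connected := by
  have fib : ∀ a b : (collapse huv.ne ⁻¹' S : Set V),
      collapse huv.ne a = collapse huv.ne b → (G.induce (collapse huv.ne ⁻¹' S)).Reachable a b := by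
    intro a b hab
    by_cases h : a = b
    · rw [h]
    · apply SimpleGraph.Adj.reachable
      rw [SimpleGraph.induce_adj]
      have h' : (a : V) ≠ b := fun e => h (Subtype.ext e)
      have h1 := (collapse_eq_iff huv.ne (a : V) _).1 hab
      by_cases hb : (b : V) = v
      · rw [hb, collapse_self] at h1
        have : (a : V) = u := by grind
        rw [this, hb]
        exact huv
      · rw [collapse_of_ne huv.ne hb] at h1
        have : (a : V) = v ∧ (b : V) = u := by grind
        rw [this.1, this.2]
        exact huv.symm
  have lift : ∀ (c d : S), ((contract G huv.ne).induce S).Walk c d →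
      ∀ a b : (collapse huv.ne ⁻¹' S : Set V), collapse huv.ne a = c → collapse huv.ne b = d →
        (G.induce (collapse huv.ne ⁻¹' S)).Reachable a b := by
    intro c d w
    induction w with
    | nil => exact fun a b ha hb => fib a b (ha.trans hb.symm)
    | @cons c c' d hadj w ih =>
      intro a b ha hb
      rw [SimpleGraph.induce_adj, contract, SimpleGraph.map_adj'] at hadj
      obtain ⟨-, a₀, b₀, h, h1, h2⟩ := hadj
      have ha₀ : a₀ ∈ collapse huv.ne ⁻¹' S := by
        rw [Set.mem_preimage, h1]; exact c.2
      have hb₀ : b₀ ∈ collapse huv.ne ⁻¹' S := by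
        rw [Set.mem_preimage, h2]; exact c'.2
      refine (fib a ⟨a₀, ha₀⟩ (ha.trans h1.symm)).trans
        (SimpleGraph.Reachable.trans (SimpleGraph.Adj.reachable ?_) (ih ⟨b₀, hb₀⟩ b h2 hb))
      exact h
  have hne : Nonempty (collapse huv.ne ⁻¹' S : Set V) := by
    obtain ⟨⟨⟨x, hx⟩, hxS⟩⟩ := hS.nonempty
    refine ⟨⟨x, ?_⟩⟩
    rwa [Set.mem_preimage, collapse_of_ne huv.ne hx]
  refine ⟨fun a b => ?_⟩
  obtain ⟨w⟩ := hS.preconnected ⟨_, a.2⟩ ⟨_, b.2⟩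
  exact lift _ _ w a b rfl rfl

theorem IsMinorOf.of_contract {W : Type} {H : SimpleGraph W} (huv : G.Adj u v)
    (h : IsMinorOf H (contract G huv.ne)) : IsMinorOf H G := by
  obtain ⟨f, h1, h2, h3⟩ := h
  refine ⟨fun w => collapse huv.ne ⁻¹' f w, fun w => connected_preimage_collapse huv (h1 w),
    fun w w' hw => (h2 hw).preimage _, fun w w' hw => ?_⟩
  obtain ⟨a, ha, b, hb, hab⟩ := h3 hw
  rw [contract, SimpleGraph.map_adj'] at hab
  obtain ⟨-, a₀, b₀, h, rfl, rfl⟩ := hab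
  exact ⟨a₀, ha, b₀, hb, h⟩

theorem TwoCutFree.contract_or_threeCut (hG : TwoCutFree G) (huv : u ≠ v) :
    TwoCutFree (contract G huv) ∨ ∃ z X, IsThreeCut G u v z X := by
  by_contra! hcon
  obtain ⟨hnot, hcut⟩ := hcon
  apply hnot
  intro s t X hX hs ht hcl z
  by_contra! hz
  obtain ⟨⟨x, hx⟩, hxX⟩ := hX
  have hne : (collapse huv ⁻¹' X).Nonempty := ⟨x, by rwa [Set.mem_preimage, collapse_of_ne huv hx]⟩
  have memiff : ∀ y : {x : V // x ≠ v}, (y : V) ∈ collapse huv ⁻¹' X ↔ y ∈ X := fun y => by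
    rw [Set.mem_preimage, collapse_of_ne huv y.2]
  have hv : v ∈ collapse huv ⁻¹' X ↔ (⟨u, huv⟩ : {x : V // x ≠ v}) ∈ X := by
    rw [Set.mem_preimage, collapse_self]
  have hcl' : ∀ a ∈ collapse huv ⁻¹' X, ∀ b, G.Adj a b → b ∈ collapse huv ⁻¹' X ∨
      collapse huv b = s ∨ collapse huv b = t := by
    intro a ha b hab
    by_cases h : collapse huv a = collapse huv b
    · left
      rw [Set.mem_preimage, ← h]
      exact ha
    · exact hcl _ ha _ (contract_adj_collapse huv hab h)
  simp only [collapse_eq_iff] at hcl'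
  have hzs : (z : V) ≠ s := fun e => hz.2.1 (Subtype.ext e)
  have hzt : (z : V) ≠ t := fun e => hz.2.2 (Subtype.ext e)
  by_cases hsu : (s : V) = u
  · have hs' : s = ⟨u, huv⟩ := Subtype.ext hsu
    refine hcut t (collapse huv ⁻¹' X) ⟨hne, ?_, ?_, ?_, ?_, z, ?_, ?_, z.2, hzt⟩
    · exact (memiff ⟨u, huv⟩).not.2 (by rw [← hs']; exact hs)
    · rw [hv, ← hs']; exact hs
    · rw [memiff]; exact ht
    · intro a ha b hab
      have := hcl' a ha b hab
      grind
    · rw [memiff]; exact hz.1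
    · rw [← hsu]; exact hzs
  by_cases htu : (t : V) = u
  · have ht' : t = ⟨u, huv⟩ := Subtype.ext htu
    refine hcut s (collapse huv ⁻¹' X) ⟨hne, ?_, ?_, ?_, ?_, z, ?_, ?_, z.2, hzs⟩
    · exact (memiff ⟨u, huv⟩).not.2 (by rw [← ht']; exact ht)
    · rw [hv, ← ht']; exact ht
    · rw [memiff]; exact hs
    · intro a ha b hab
      have := hcl' a ha b hab
      grind
    · rw [memiff]; exact hz.1
    · rw [← htu]; exact hzt
  have := hG s t _ hne (by rw [memiff]; exact hs) (by rw [memiff]; exact ht)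
    (fun a ha b hab => by have := hcl' a ha b hab; grind) z
  rw [memiff] at this
  exact this.elim hz.1 (fun h => h.elim hzs hzt)

theorem IsThreeCut.compl {x y z : V} {X : Set V} (h : IsThreeCut G x y z X) :
    IsThreeCut G x y z {w | w ∉ X ∧ w ≠ x ∧ w ≠ y ∧ w ≠ z} := by
  obtain ⟨⟨a, ha⟩, hx, hy, hz, hcl, w, hw⟩ := h
  refine ⟨⟨w, hw⟩, by simp, by simp, by simp, ?_, a, by simp [ha], ?_, ?_, ?_⟩
  · intro b hb c hbc
    have := hcl c
    have := hbc.symm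
    simp only [Set.mem_ofPred_eq] at hb ⊢
    grind
  all_goals grind

/-- A graph without small separators has a contractible edge. -/
theorem TwoCutFree.exists_contract [Finite V] (hG : TwoCutFree G) (hE : ∃ a b, G.Adj a b) :
    ∃ (u v : V) (huv : G.Adj u v), TwoCutFree (contract G huv.ne) := by
  by_contra! hcon
  have hcut : ∀ u v, G.Adj u v → ∃ z X, IsThreeCut G u v z X := fun u v huv =>
    (hG.contract_or_threeCut huv.ne).resolve_left (hcon u v huv)
  have hmin : ∀ n : ℕ, ∀ x y z X, G.Adj x y → IsThreeCut G x y z X → X.ncard = n → False := by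
    intro n
    induction n using Nat.strong_induction_on with
    | _ n ih =>
    intro x y z X hxy hX hn
    have hX' := hX
    obtain ⟨hne, hx, hy, hz, hcl, w₀, hw₀⟩ := hX
    obtain ⟨v, hvX, hzv⟩ : ∃ v ∈ X, G.Adj z v := by
      by_contra! hno
      have := hG x y X hne hx hy (fun a ha b hab => by
        have := hcl a ha b hab
        have := hno a ha
        have := hab.symm
        grind) w₀
      grind
    have key : ∀ w D, IsThreeCut G z v w D → x ∉ D → y ∉ D → False := by
      intro w D hD hxD hyD
      obtain ⟨hDne, hzD, hvD, hwD, hDcl, w₁, hw₁⟩ := hD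
      obtain ⟨d, hdD, hvd⟩ : ∃ d ∈ D, G.Adj v d := by
        by_contra! hno
        have := hG z w D hDne hzD hwD (fun a ha b hab => by
          have := hDcl a ha b hab
          have := hno a ha
          have := hab.symm
          grind) w₁
        grind
      have hdX : d ∈ X := by
        have := hcl v hvX d hvd
        grind
      refine ih (D ∩ X).ncard ?_ z v w (D ∩ X) hzv ⟨⟨d, hdD, hdX⟩, ?_, ?_, ?_, ?_, w₁, ?_⟩ rfl
      · rw [← hn]
        exact Set.ncard_lt_ncard ⟨Set.inter_subset_right, fun h => hvD (h hvX).1⟩ X.toFinite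
      · exact fun h => hzD h.1
      · exact fun h => hvD h.1
      · exact fun h => hwD h.1
      · rintro a ⟨haD, haX⟩ b hab
        have := hcl a haX b hab
        have := hDcl a haD b hab
        simp only [Set.mem_inter_iff]
        grind
      · simp only [Set.mem_inter_iff]
        grind
    obtain ⟨w, D, hD⟩ := hcut z v hzv
    by_cases h : x ∉ D ∧ y ∉ D
    · exact key w D hD h.1 h.2
    · refine key w _ hD.compl ?_ ?_
      · have := hD.2.2.2.2.1 y
        have := hxy.symm
        simp only [Set.mem_ofPred_eq]
        grind
      · have := hD.2.2.2.2.1 x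
        simp only [Set.mem_ofPred_eq]
        grind
  obtain ⟨a, b, hab⟩ := hE
  obtain ⟨z, X, hX⟩ := hcut a b hab
  exact hmin _ a b z X hab hX rfl

end Contraction

theorem KConnected.twoCutFree {V : Type} {G : SimpleGraph V} (h : KConnected 3 G) :
    TwoCutFree G := by
  rintro x y X ⟨a, ha⟩ hx hy hcl z
  by_contra! hz
  obtain ⟨P, -, -, hP⟩ := h (u := a) (v := z) (fun e => hz.1 (e ▸ ha))
  have hit : ∀ (b c : V) (w : G.Walk b c), b ∈ X → c ∉ X → x ∈ w.support ∨ y ∈ w.support := by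
    intro b c w
    induction w with
    | nil => exact fun h h' => absurd h h'
    | @cons b b' c hadj w ih =>
      intro hb hc
      simp only [SimpleGraph.Walk.support_cons, List.mem_cons]
      rcases hcl b hb b' hadj with h | rfl | rfl
      · exact (ih h hc).imp .inr .inr
      · exact .inl (.inr w.start_mem_support)
      · exact .inr (.inr w.start_mem_support)
  have h0 := hit _ _ (P 0) ha hz.1
  have h1 := hit _ _ (P 1) ha hz.1
  have h2 := hit _ _ (P 2) ha hz.1
  have h01 := hP 0 1 (by decide)
  have h02 := hP 0 2 (by decide)
  have h12 := hP 1 2 (by decide)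
  have hxa : x ≠ a := fun e => hx (e ▸ ha)
  have hya : y ≠ a := fun e => hy (e ▸ ha)
  grind

theorem exists_ne_of_four_le_card {V : Type} [Finite V] (hcard : 4 ≤ Nat.card V) (a b c : V) :
    ∃ d, d ≠ a ∧ d ≠ b ∧ d ≠ c := by
  classical
  by_contra! hno
  have h : (Set.univ : Set V) ⊆ ({a, b, c} : Finset V) := by
    intro x _
    have := hno x
    simp only [Finset.coe_insert, Finset.coe_singleton, Set.mem_insert_iff, Set.mem_singleton_iff]
    grind
  have h1 := Set.ncard_le_ncard h (Finset.finite_toSet _)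
  rw [Set.ncard_univ, Set.ncard_coe_finset] at h1
  have := Finset.card_le_three (a := a) (b := b) (c := c)
  omega

/-- In a graph without small separators every vertex has at least three neighbours. -/
theorem TwoCutFree.exists_adj {V : Type} [Finite V] {G : SimpleGraph V} (h : TwoCutFree G)
    (hcard : 4 ≤ Nat.card V) (a x y : V) : ∃ b, b ≠ x ∧ b ≠ y ∧ G.Adj a b := by
  by_contra! hno
  have key : ∀ x' y', x' ≠ a → y' ≠ a → (x = x' ∨ x = a) → (y = y' ∨ y = a) → False := by
    intro x' y' hx hy h1 h2
    obtain ⟨d, hd⟩ := exists_ne_of_four_le_card hcard a x' y'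
    have := h x' y' {a} ⟨a, rfl⟩ hx hy (fun b hb c hbc => by
      have := hno c
      have := hbc.ne
      grind) d
    grind
  obtain ⟨d, hd, -⟩ := exists_ne_of_four_le_card hcard a a a
  by_cases hx : x = a <;> by_cases hy : y = a
  · exact key d d hd hd (.inr hx) (.inr hy)
  · exact key d y hd hy (.inr hx) (.inl rfl)
  · exact key x d hx hd (.inl rfl) (.inr hy)
  · exact key x y hx hy (.inl rfl) (.inl rfl)

section Minors

variable {V : Type} {G : SimpleGraph V}

theorem induce_singleton_connected (G : SimpleGraph V) (x : V) :
    (G.induce ({x} : Set V)).Connected := by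
  have : Nonempty ({x} : Set V) := ⟨⟨x, rfl⟩⟩
  exact ⟨fun a b => by rw [Subsingleton.elim a b]⟩

theorem induce_image_Icc_connected {p : ℕ → V} {a b : ℕ} (hab : a ≤ b)
    (hp : ∀ i, a ≤ i → i < b → G.Adj (p i) (p (i + 1))) :
    (G.induce (p '' Set.Icc a b)).Connected := by
  have base : p a ∈ p '' Set.Icc a b := ⟨a, ⟨le_rfl, hab⟩, rfl⟩
  have key : ∀ k (h : a ≤ k ∧ k ≤ b), (G.induce (p '' Set.Icc a b)).Reachable ⟨p a, base⟩
      ⟨p k, ⟨k, h, rfl⟩⟩ := by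
    intro k
    induction k with
    | zero =>
      intro h
      obtain rfl : a = 0 := by omega
      rfl
    | succ k ih =>
      intro h
      rcases h.1.eq_or_lt with h' | h'
      · subst h'
        rfl
      · have : a ≤ k := by omega
        refine (ih ⟨this, by omega⟩).trans (SimpleGraph.Adj.reachable ?_)
        exact hp k this (by omega)
  have : Nonempty (p '' Set.Icc a b) := ⟨⟨p a, base⟩⟩
  refine ⟨?_⟩
  rintro ⟨_, i, hi, rfl⟩ ⟨_, j, hj, rfl⟩
  exact (key i hi).symm.trans (key j hj)

/-- Some edge of `G` joins `A` and `B`. -/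
def Touch (G : SimpleGraph V) (A B : Set V) : Prop := ∃ a ∈ A, ∃ b ∈ B, G.Adj a b

theorem Touch.symm {A B : Set V} (h : Touch G A B) : Touch G B A := by
  obtain ⟨a, ha, b, hb, hab⟩ := h
  exact ⟨b, hb, a, ha, hab.symm⟩

theorem isMinorOf_mkGraph {n : ℕ} {E : List (ℕ × ℕ)} (f : Fin n → Set V)
    (hc : ∀ i, (G.induce (f i)).Connected) (hd : ∀ i j, i < j → Disjoint (f i) (f j))
    (ht : ∀ i j : Fin n, ((i : ℕ), (j : ℕ)) ∈ E → Touch G (f i) (f j)) :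
    IsMinorOf (mkGraph n E) G := by
  refine ⟨f, hc, fun i j hij => ?_, fun i j hij => ?_⟩
  · rcases lt_or_gt_of_ne hij with h | h
    · exact hd i j h
    · exact (hd j i h).symm
  · rw [mkGraph, SimpleGraph.fromRel_adj] at hij
    rcases hij.2 with h | h
    · exact ht i j h
    · exact (ht j i h).symm

theorem isMinorOf_prism {A B C D E F : Set V}
    (hc : ∀ X ∈ [A, B, C, D, E, F], (G.induce X).Connected)
    (hd : [A, B, C, D, E, F].Pairwise Disjoint)
    (hAB : Touch G A B) (hAC : Touch G A C) (hBC : Touch G B C)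
    (hDE : Touch G D E) (hDF : Touch G D F) (hEF : Touch G E F)
    (hAD : Touch G A D) (hBE : Touch G B E) (hCF : Touch G C F) : IsMinorOf prismGraph G := by
  refine isMinorOf_mkGraph [A, B, C, D, E, F].get (fun i => hc _ ([A, B, C, D, E, F].get_mem i))
    (fun i j hij => List.pairwise_iff_get.1 hd i j hij) (fun i j hij => ?_)
  fin_cases i <;> fin_cases j <;> first | assumption | (exfalso; revert hij; decide)

theorem isMinorOf_K33 {A B C D E F : Set V}
    (hc : ∀ X ∈ [A, B, C, D, E, F], (G.induce X).Connected)
    (hd : [A, B, C, D, E, F].Pairwise Disjoint)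
    (hAD : Touch G A D) (hAE : Touch G A E) (hAF : Touch G A F)
    (hBD : Touch G B D) (hBE : Touch G B E) (hBF : Touch G B F)
    (hCD : Touch G C D) (hCE : Touch G C E) (hCF : Touch G C F) : IsMinorOf K33Graph G := by
  refine isMinorOf_mkGraph [A, B, C, D, E, F].get (fun i => hc _ ([A, B, C, D, E, F].get_mem i))
    (fun i j hij => List.pairwise_iff_get.1 hd i j hij) (fun i j hij => ?_)
  fin_cases i <;> fin_cases j <;> first | assumption | (exfalso; revert hij; decide)

theorem isMinorOf_K5e {a b c d e : V} (hd : [a, b, c, d, e].Pairwise (· ≠ ·))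
    (hab : G.Adj a b) (hac : G.Adj a c) (had : G.Adj a d) (hae : G.Adj a e)
    (hbc : G.Adj b c) (hbd : G.Adj b d) (hbe : G.Adj b e)
    (hcd : G.Adj c d) (hce : G.Adj c e) : IsMinorOf K5eGraph G := by
  refine isMinorOf_mkGraph (fun i => {[a, b, c, d, e].get i})
    (fun i => induce_singleton_connected G _)
    (fun i j hij => Set.disjoint_singleton.2 (List.pairwise_iff_get.1 hd i j hij))
    (fun i j hij => ⟨_, rfl, _, rfl, ?_⟩)
  fin_cases i <;> fin_cases j <;> first | assumption | (exfalso; revert hij; decide)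

end Minors

section SmallOrder

variable {V : Type} [Finite V] {G : SimpleGraph V}

theorem TwoCutFree.wheel_of_card_eq_four (h : TwoCutFree G) (hcard : Nat.card V = 4) :
    ∃ x p, IsWheelWith G 3 x p := by
  obtain ⟨e⟩ : Nonempty (Fin 4 ≃ V) := ⟨(Finite.equivFinOfCardEq hcard).symm⟩
  have cov : ∀ x, x = e 0 ∨ x = e 1 ∨ x = e 2 ∨ x = e 3 := by
    intro x
    obtain ⟨i, rfl⟩ := e.surjective x
    fin_cases i <;> simp
  have h01 : e 0 ≠ e 1 := by simp
  have h02 : e 0 ≠ e 2 := by simp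
  have h03 : e 0 ≠ e 3 := by simp
  have h12 : e 1 ≠ e 2 := by simp
  have h13 : e 1 ≠ e 3 := by simp
  have h23 : e 2 ≠ e 3 := by simp
  generalize e 0 = a at *
  generalize e 1 = b at *
  generalize e 2 = c at *
  generalize e 3 = d at *
  have adj : ∀ x y, x ≠ y → G.Adj x y := by
    have key : ∀ x y z w, (∀ t, t = x ∨ t = y ∨ t = z ∨ t = w) → G.Adj x y := by
      intro x y z w hcov
      obtain ⟨t, ht1, ht2, ht⟩ := h.exists_adj hcard.ge x z w
      have := ht.ne
      have := hcov t
      grind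
    intro x y hxy
    have hx := cov x
    have hy := cov y
    rcases hx with rfl | rfl | rfl | rfl <;> rcases hy with rfl | rfl | rfl | rfl <;>
      first | exact absurd rfl hxy | skip
    · exact key _ _ c d (fun t => by have := cov t; tauto)
    · exact key _ _ b d (fun t => by have := cov t; tauto)
    · exact key _ _ b c (fun t => by have := cov t; tauto)
    · exact key _ _ c d (fun t => by have := cov t; tauto)
    · exact key _ _ a d (fun t => by have := cov t; tauto)
    · exact key _ _ a c (fun t => by have := cov t; tauto)
    · exact key _ _ b d (fun t => by have := cov t; tauto)
    · exact key _ _ a d (fun t => by have := cov t; tauto)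
    · exact key _ _ a b (fun t => by have := cov t; tauto)
    · exact key _ _ b c (fun t => by have := cov t; tauto)
    · exact key _ _ a c (fun t => by have := cov t; tauto)
    · exact key _ _ a b (fun t => by have := cov t; tauto)
  refine ⟨d, fun i => if i = 0 then a else if i = 1 then b else c, ?_, ?_, ?_, ?_, ?_⟩
  · grind
  · grind
  · intro x
    by_cases hx : x = d
    · exact .inl hx
    right
    rcases cov x with rfl | rfl | rfl | rfl
    · exact ⟨0, by simp⟩
    · exact ⟨1, by simp⟩
    · exact ⟨2, by simp⟩
    · exact absurd rfl hx
  · grind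
  · intro i j hij hj
    exact iff_of_true (adj _ _ (by grind)) (by omega)

theorem TwoCutFree.of_card_eq_five (h : TwoCutFree G) (hcard : Nat.card V = 5) :
    IsMinorOf K5eGraph G ∨ ∃ x p, IsWheelWith G 4 x p := by
  obtain ⟨e⟩ : Nonempty (Fin 5 ≃ V) := ⟨(Finite.equivFinOfCardEq hcard).symm⟩
  have irr := fun x => G.irrefl (v := x)
  have sym := fun x y => G.adj_comm x y
  let D : V → V → V → V → V → Prop := fun a b c d e =>
    a ≠ b ∧ a ≠ c ∧ a ≠ d ∧ a ≠ e ∧ b ≠ c ∧ b ≠ d ∧ b ≠ e ∧ c ≠ d ∧ c ≠ e ∧ d ≠ e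
  have ext : ∀ a b : V, a ≠ b → ∃ c d e, D a b c d e ∧
      ∀ x, x = a ∨ x = b ∨ x = c ∨ x = d ∨ x = e := by
    have H : ∀ i j : Fin 5, i ≠ j → ∃ k l m, (i ≠ j ∧ i ≠ k ∧ i ≠ l ∧ i ≠ m ∧ j ≠ k ∧ j ≠ l ∧ j ≠ m ∧
        k ≠ l ∧ k ≠ m ∧ l ≠ m) ∧
      ∀ x, x = i ∨ x = j ∨ x = k ∨ x = l ∨ x = m := by decide
    intro a b hab
    obtain ⟨i, rfl⟩ := e.surjective a
    obtain ⟨j, rfl⟩ := e.surjective b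
    obtain ⟨k, l, m, h1, h2⟩ := H i j (fun e => hab (by rw [e]))
    refine ⟨e k, e l, e m, ?_, fun x => ?_⟩
    · simpa [D] using h1
    · have := h2 (e.symm x)
      simpa only [Equiv.symm_apply_eq] using this
  have uniq : ∀ a b c, a ≠ b → a ≠ c → b ≠ c → G.Adj a b ∨ G.Adj a c := by
    intro a b c hab hac hbc
    obtain ⟨c', d, e, hd, hcov⟩ := ext a b hab
    by_contra! hno
    have key : ∀ x y, (∀ t, t = a ∨ t = b ∨ t = c ∨ t = x ∨ t = y) → False := by
      intro x y hcov
      obtain ⟨t, ht1, ht2, ht⟩ := h.exists_adj (by omega) a x y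
      have := ht.ne
      have := hcov t
      grind
    rcases hcov c with hc | hc | rfl | rfl | rfl
    · exact hac hc.symm
    · exact hbc hc.symm
    · exact key d e hcov
    · exact key c' e (fun t => by have := hcov t; tauto)
    · exact key c' d (fun t => by have := hcov t; tauto)
  have wheel : ∀ a b c d e, D a b c d e →
      (∀ x, x = a ∨ x = b ∨ x = c ∨ x = d ∨ x = e) → ¬ G.Adj a b → ¬ G.Adj c d →
      ∃ x p, IsWheelWith G 4 x p := by
    intro a b c d e hd hcov hab hcd
    simp only [D] at hd
    refine ⟨e, fun i => if i = 0 then a else if i = 1 then c else if i = 2 then b else d,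
      ?_, ?_, ?_, ?_, ?_⟩
    · grind
    · grind
    · intro x
      rcases hcov x with rfl | rfl | rfl | rfl | rfl
      · exact .inr ⟨0, by simp⟩
      · exact .inr ⟨2, by simp⟩
      · exact .inr ⟨1, by simp⟩
      · exact .inr ⟨3, by simp⟩
      · exact .inl rfl
    · have h1 := uniq a b e
      have h2 := uniq b a e
      have h3 := uniq c d e
      have h4 := uniq d c e
      grind
    · have h1 := uniq a b c
      have h2 := uniq a b d
      have h3 := uniq b a c
      have h4 := uniq b a d
      intro i j hij hj
      interval_cases j <;> interval_cases i <;> simp <;> grind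
  by_cases hall : ∃ a b, a ≠ b ∧ ¬ G.Adj a b
  · obtain ⟨a, b, hne, hab⟩ := hall
    obtain ⟨c, d, e, hd, hcov⟩ := ext a b hne
    by_cases hcd : G.Adj c d
    · by_cases hce : G.Adj c e
      · by_cases hde : G.Adj d e
        · left
          simp only [D] at hd
          have H := uniq a b
          have H' := uniq b a
          clear wheel uniq ext
          refine isMinorOf_K5e (a := c) (b := d) (c := e) (d := a) (e := b) ?_ hcd hce ?_ ?_ hde
            ?_ ?_ ?_ ?_
          · grind
          all_goals grind
        · exact .inr (wheel a b d e c (by grind) (fun t => by have := hcov t; tauto) hab hde)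
      · exact .inr (wheel a b c e d (by grind) (fun t => by have := hcov t; tauto) hab hce)
    · exact .inr (wheel a b c d e hd hcov hab hcd)
  · push Not at hall
    left
    refine isMinorOf_K5e (a := e 0) (b := e 1) (c := e 2) (d := e 3) (e := e 4) (by simp)
      ?_ ?_ ?_ ?_ ?_ ?_ ?_ ?_ ?_
    all_goals exact hall _ _ (by simp)

end SmallOrder

/-- A concrete wheel is isomorphic to `wheelGraph r`. -/
theorem IsWheelWith.nonempty_iso {V : Type} {G : SimpleGraph V} {r : ℕ} {h : V} {p : ℕ → V}
    (hW : IsWheelWith G r h p) (hr : 3 ≤ r) : Nonempty (G ≃g wheelGraph r) := by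
  let f : Option (Fin r) → V := fun o => o.elim h (fun i => p i)
  have hf : Function.Bijective f := by
    constructor
    · rintro (_ | i) (_ | j) hij
      · rfl
      · exact absurd hij.symm (hW.ne_hub j j.2)
      · exact absurd hij (hW.ne_hub i i.2)
      · exact congrArg some (Fin.ext (hW.inj i i.2 j j.2 hij))
    · intro x
      rcases hW.cover x with rfl | ⟨i, hi, rfl⟩
      · exact ⟨none, rfl⟩
      · exact ⟨some ⟨i, hi⟩, rfl⟩
  have rim : ∀ i j : ℕ, i < j → j < r →
      (G.Adj (p i) (p j) ↔ (j = (i + 1) % r ∨ i = (j + 1) % r)) := by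
    intro i j hij hj
    rw [hW.adj i j hij hj, Nat.mod_eq_of_lt (by omega : i + 1 < r)]
    rcases (by omega : j + 1 < r ∨ j + 1 = r) with h | h
    · rw [Nat.mod_eq_of_lt h]
      omega
    · rw [h, Nat.mod_self]
      omega
  refine ⟨RelIso.symm ⟨Equiv.ofBijective f hf, ?_⟩⟩
  rintro (_ | i) (_ | j)
  · simp [f, wheelGraph]
  · simpa [f, wheelGraph] using hW.hub_adj j j.2
  · simpa [f, wheelGraph] using (hW.hub_adj i i.2).symm
  · simp only [Equiv.ofBijective_apply, Option.elim, f, wheelGraph, SimpleGraph.fromRel_adj, ne_eq,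
      Option.some.injEq]
    rcases lt_trichotomy i j with hij | rfl | hij
    · rw [rim i j hij j.2]
      simp [hij.ne]
    · simp
    · rw [G.adj_comm, rim j i hij i.2]
      simp [hij.ne', or_comm]

/-- Rotating the numbering of the rim of a wheel. -/
theorem IsWheelWith.rotate {V : Type} {G : SimpleGraph V} {r : ℕ} {h : V} {p : ℕ → V}
    (hW : IsWheelWith G r h p) {k : ℕ} (hk : k < r) :
    IsWheelWith G r h (fun i => if i + k < r then p (i + k) else p (i + k - r)) where
  ne_hub i hi := by
    split
    · exact hW.ne_hub _ (by omega)
    · exact hW.ne_hub _ (by omega)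
  inj i hi j hj hij := by
    have := hW.inj
    grind
  cover x := by
    rcases hW.cover x with h | ⟨i, hi, rfl⟩
    · exact .inl h
    right
    by_cases hik : k ≤ i
    · exact ⟨i - k, by omega, by rw [if_pos (by omega), Nat.sub_add_cancel hik]⟩
    · refine ⟨i + r - k, by omega, ?_⟩
      rw [if_neg (by omega)]
      congr 1
      omega
  hub_adj i hi := by
    split
    · exact hW.hub_adj _ (by omega)
    · exact hW.hub_adj _ (by omega)
  adj i j hij hj := by
    split_ifs with h1 h2 h2
    · rw [hW.adj _ _ (by omega) (by omega)]
      omega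
    · rw [G.adj_comm, hW.adj _ _ (by omega) (by omega)]
      omega
    · omega
    · rw [hW.adj _ _ (by omega) (by omega)]
      omega

/-- The configuration obtained from a wheel by splitting a rim vertex into `x` and `y`. -/
structure IsSplitRim {V : Type} (G : SimpleGraph V) (r : ℕ) (h x y : V) (p : ℕ → V) : Prop where
  hub_ne_left : h ≠ x
  hub_ne_right : h ≠ y
  ne_hub : ∀ i, 1 ≤ i → i < r → p i ≠ h
  ne_left : ∀ i, 1 ≤ i → i < r → p i ≠ x
  ne_right : ∀ i, 1 ≤ i → i < r → p i ≠ y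
  inj : ∀ i j, 1 ≤ i → i < r → 1 ≤ j → j < r → p i = p j → i = j
  cover : ∀ z, z = h ∨ z = x ∨ z = y ∨ ∃ i, 1 ≤ i ∧ i < r ∧ p i = z
  hub_adj : ∀ i, 1 ≤ i → i < r → G.Adj h (p i)
  adj : ∀ i j, 1 ≤ i → i < j → j < r → (G.Adj (p i) (p j) ↔ j = i + 1)
  adj_split : G.Adj x y
  left_adj : ∀ i, 1 ≤ i → i < r → G.Adj x (p i) → i = 1 ∨ i + 1 = r
  right_adj : ∀ i, 1 ≤ i → i < r → G.Adj y (p i) → i = 1 ∨ i + 1 = r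
  hub_split : G.Adj x h ∨ G.Adj y h
  first_split : G.Adj x (p 1) ∨ G.Adj y (p 1)
  last_split : G.Adj x (p (r - 1)) ∨ G.Adj y (p (r - 1))

namespace IsSplitRim

variable {V : Type} {G : SimpleGraph V} {r : ℕ} {h x y : V} {p : ℕ → V}

theorem swap (S : IsSplitRim G r h x y p) : IsSplitRim G r h y x p where
  hub_ne_left := S.hub_ne_right
  hub_ne_right := S.hub_ne_left
  ne_hub := S.ne_hub
  ne_left := S.ne_right
  ne_right := S.ne_left
  inj := S.inj
  cover z := by have := S.cover z; tauto
  hub_adj := S.hub_adj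
  adj := S.adj
  adj_split := S.adj_split.symm
  left_adj := S.right_adj
  right_adj := S.left_adj
  hub_split := S.hub_split.symm
  first_split := S.first_split.symm
  last_split := S.last_split.symm

theorem reflect (S : IsSplitRim G r h x y p) (hr : 4 ≤ r) :
    IsSplitRim G r h x y (fun i => p (r - i)) where
  hub_ne_left := S.hub_ne_left
  hub_ne_right := S.hub_ne_right
  ne_hub i h1 h2 := S.ne_hub _ (by omega) (by omega)
  ne_left i h1 h2 := S.ne_left _ (by omega) (by omega)
  ne_right i h1 h2 := S.ne_right _ (by omega) (by omega)
  inj i j h1 h2 h3 h4 e := by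
    have := S.inj _ _ (by omega) (by omega) (by omega) (by omega) e
    omega
  cover z := by
    rcases S.cover z with h | h | h | ⟨i, h1, h2, rfl⟩
    · exact .inl h
    · exact .inr (.inl h)
    · exact .inr (.inr (.inl h))
    · refine .inr (.inr (.inr ⟨r - i, by omega, by omega, ?_⟩))
      congr 1
      omega
  hub_adj i h1 h2 := S.hub_adj _ (by omega) (by omega)
  adj i j h1 h2 h3 := by
    rw [G.adj_comm, S.adj _ _ (by omega) (by omega) (by omega)]
    omega
  adj_split := S.adj_split
  left_adj i h1 h2 h3 := by
    have := S.left_adj _ (by omega) (by omega) h3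
    omega
  right_adj i h1 h2 h3 := by
    have := S.right_adj _ (by omega) (by omega) h3
    omega
  hub_split := S.hub_split
  first_split := S.last_split
  last_split := by
    have : r - (r - 1) = 1 := by omega
    rw [this]
    exact S.first_split

theorem prism (S : IsSplitRim G r h x y p) (hr : 4 ≤ r) (hx1 : G.Adj x (p 1))
    (hx2 : G.Adj x (p (r - 1))) (hyh : G.Adj y h) (hy1 : G.Adj y (p 1)) :
    IsMinorOf prismGraph G := by
  refine isMinorOf_prism (A := {x}) (B := {y}) (C := {p 1}) (D := p '' Set.Icc 3 (r - 1))
    (E := {h}) (F := {p 2}) ?_ ?_ ?_ ?_ ?_ ?_ ?_ ?_ ?_ ?_ ?_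
  · simp only [List.mem_cons, List.not_mem_nil, or_false, forall_eq_or_imp, forall_eq,
      induce_singleton_connected, true_and, and_true]
    exact induce_image_Icc_connected (by omega)
      fun i h1 h2 => (S.adj _ _ (by omega) (by omega) (by omega)).2 rfl
  · have h1 := S.ne_hub
    have h2 := S.ne_left
    have h3 := S.ne_right
    have h4 := S.inj
    have h5 := S.hub_ne_left
    have h6 := S.hub_ne_right
    have h7 := S.adj_split.ne
    simp only [List.pairwise_cons, List.mem_cons, List.not_mem_nil, or_false, forall_eq_or_imp,
      forall_eq, IsEmpty.forall_iff, implies_true, List.Pairwise.nil, and_true,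
      Set.disjoint_singleton_left, Set.disjoint_singleton_right, Set.mem_singleton_iff,
      Set.mem_image, Set.mem_Icc, not_exists, not_and]
    refine ⟨⟨h7, (h2 1 (by omega) (by omega)).symm, fun i hi => h2 i (by omega) (by omega),
      h5.symm, (h2 2 (by omega) (by omega)).symm⟩, ⟨(h3 1 (by omega) (by omega)).symm,
      fun i hi => h3 i (by omega) (by omega), h6.symm, (h3 2 (by omega) (by omega)).symm⟩, ?_, ?_, ?_⟩
    all_goals grind
  · exact ⟨_, rfl, _, rfl, S.adj_split⟩
  · exact ⟨_, rfl, _, rfl, hx1⟩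
  · exact ⟨_, rfl, _, rfl, hy1⟩
  · exact ⟨_, ⟨3, ⟨le_rfl, by omega⟩, rfl⟩, _, rfl, (S.hub_adj _ (by omega) (by omega)).symm⟩
  · exact ⟨_, ⟨3, ⟨le_rfl, by omega⟩, rfl⟩, _, rfl,
      ((S.adj _ _ (by omega) (by omega) (by omega)).2 rfl).symm⟩
  · exact ⟨_, rfl, _, rfl, S.hub_adj _ (by omega) (by omega)⟩
  · exact ⟨_, rfl, _, ⟨r - 1, ⟨by omega, le_rfl⟩, rfl⟩, hx2⟩
  · exact ⟨_, rfl, _, rfl, hyh⟩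
  · exact ⟨_, rfl, _, rfl, (S.adj _ _ (by omega) (by omega) (by omega)).2 rfl⟩

theorem wheel (S : IsSplitRim G r h x y p) (hr : 4 ≤ r) (hxh : G.Adj x h) (hyh : G.Adj y h)
    (hx1 : G.Adj x (p 1)) (hx2 : ¬ G.Adj x (p (r - 1))) (hy1 : ¬ G.Adj y (p 1))
    (hy2 : G.Adj y (p (r - 1))) :
    IsWheelWith G (r + 1) h (fun i => if i = 0 then x else if i < r then p i else y) where
  ne_hub i hi := by
    have := S.ne_hub i
    have := S.hub_ne_left
    have := S.hub_ne_right
    grind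
  inj i hi j hj hij := by
    have h1 := S.ne_left
    have h2 := S.ne_right
    have h3 := S.inj
    have := S.adj_split.ne
    grind
  cover z := by
    rcases S.cover z with h | rfl | rfl | ⟨i, h1, h2, rfl⟩
    · exact .inl h
    · exact .inr ⟨0, by omega, by simp⟩
    · exact .inr ⟨r, by omega, by rw [if_neg (by omega), if_neg (by omega)]⟩
    · exact .inr ⟨i, by omega, by rw [if_neg (by omega), if_pos h2]⟩
  hub_adj i hi := by
    have := S.hub_adj i
    have := hxh.symm
    have := hyh.symm
    grind
  adj i j hij hj := by
    rw [if_neg (by omega : j ≠ 0)]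
    split_ifs with h1 h2 h2 h2
    · refine ⟨fun h => ?_, fun h => ?_⟩
      · have := S.left_adj j (by omega) h2 h
        have : j ≠ r - 1 := fun e => hx2 (e ▸ h)
        omega
      · obtain rfl : j = 1 := by omega
        exact hx1
    · exact iff_of_true S.adj_split (by omega)
    · rw [S.adj i j (by omega) hij (by omega)]
      omega
    · rw [G.adj_comm]
      refine ⟨fun h => ?_, fun h => ?_⟩
      · have := S.right_adj i (by omega) (by omega) h
        have : i ≠ 1 := fun e => hy1 (e ▸ h)
        omega
      · obtain rfl : i = r - 1 := by omega
        exact hy2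
    all_goals omega

theorem left_degree (S : IsSplitRim G r h x y p)
    (hdeg : ∀ a b c, ∃ d, d ≠ b ∧ d ≠ c ∧ G.Adj a d) :
    (G.Adj x (p 1) ∨ G.Adj x (p (r - 1))) ∧ (G.Adj x h ∨ G.Adj x (p 1)) ∧
      (G.Adj x h ∨ G.Adj x (p (r - 1))) := by
  have key : ∀ c, ∃ d, d ≠ c ∧ G.Adj x d ∧ (d = h ∨ d = p 1 ∨ d = p (r - 1)) := by
    intro c
    obtain ⟨d, h1, h2, h3⟩ := hdeg x y c
    refine ⟨d, h2, h3, ?_⟩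
    rcases S.cover d with h | h | h | ⟨i, h4, h5, rfl⟩
    · exact .inl h
    · exact absurd h h3.ne'
    · exact absurd h h1
    · rcases S.left_adj i h4 h5 h3 with h | h
      · exact .inr (.inl (by rw [h]))
      · exact .inr (.inr (by rw [← h]; rfl))
  obtain ⟨d₁, h₁⟩ := key h
  obtain ⟨d₂, h₂⟩ := key (p 1)
  obtain ⟨d₃, h₃⟩ := key (p (r - 1))
  grind

theorem prism_or_wheel (S : IsSplitRim G r h x y p) (hr : 4 ≤ r)
    (hdeg : ∀ a b c, ∃ d, d ≠ b ∧ d ≠ c ∧ G.Adj a d) :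
    IsMinorOf prismGraph G ∨ ∃ q, IsWheelWith G (r + 1) h q := by
  have dx := S.left_degree hdeg
  have dy := S.swap.left_degree hdeg
  have h1 := S.prism hr
  have h2 := S.swap.prism hr
  have h3 := (S.reflect hr).prism hr
  have h4 := (S.reflect hr).swap.prism hr
  rw [show r - (r - 1) = 1 by omega] at h3 h4
  have h5 := fun a b c d e f => Exists.intro (p := fun q => IsWheelWith G (r + 1) h q) _
    (S.wheel hr a b c d e f)
  have h6 := fun a b c d e f => Exists.intro (p := fun q => IsWheelWith G (r + 1) h q) _
    (S.swap.wheel hr a b c d e f)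
  have := S.hub_split
  have := S.first_split
  have := S.last_split
  grind

end IsSplitRim

/-- The configuration obtained from a wheel by splitting the hub into `x` and `y`. -/
structure IsSplitHub {V : Type} (G : SimpleGraph V) (r : ℕ) (x y : V) (p : ℕ → V) : Prop where
  ne_left : ∀ i < r, p i ≠ x
  ne_right : ∀ i < r, p i ≠ y
  inj : ∀ i < r, ∀ j < r, p i = p j → i = j
  adj : ∀ i, i + 1 < r → G.Adj (p i) (p (i + 1))
  adj_last : G.Adj (p (r - 1)) (p 0)
  adj_split : G.Adj x y
  rim_split : ∀ i < r, G.Adj x (p i) ∨ G.Adj y (p i)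

namespace IsSplitHub

variable {V : Type} {G : SimpleGraph V} {r : ℕ} {x y : V} {p : ℕ → V}

theorem swap (S : IsSplitHub G r x y p) : IsSplitHub G r y x p where
  ne_left := S.ne_right
  ne_right := S.ne_left
  inj := S.inj
  adj := S.adj
  adj_last := S.adj_last
  adj_split := S.adj_split.symm
  rim_split i hi := (S.rim_split i hi).symm

theorem rotate (S : IsSplitHub G r x y p) {k : ℕ} (hk : k < r) :
    IsSplitHub G r x y (fun i => if i + k < r then p (i + k) else p (i + k - r)) where
  ne_left i hi := by
    split
    · exact S.ne_left _ (by omega)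
    · exact S.ne_left _ (by omega)
  ne_right i hi := by
    split
    · exact S.ne_right _ (by omega)
    · exact S.ne_right _ (by omega)
  inj i hi j hj hij := by
    have := S.inj
    grind
  adj i hi := by
    split_ifs with h1 h2 h2
    · rw [show i + 1 + k = i + k + 1 by omega]
      exact S.adj _ (by omega)
    · rw [show i + k = r - 1 by omega, show i + 1 + k - r = 0 by omega]
      exact S.adj_last
    · omega
    · rw [show i + 1 + k - r = i + k - r + 1 by omega]
      exact S.adj _ (by omega)
  adj_last := by
    rw [if_pos (by omega : 0 + k < r), Nat.zero_add]
    split_ifs with h1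
    · obtain rfl : k = 0 := by omega
      exact S.adj_last
    · have := S.adj (r - 1 + k - r) (by omega)
      rwa [show r - 1 + k - r + 1 = k by omega] at this
  adj_split := S.adj_split
  rim_split i hi := by
    split
    · exact S.rim_split _ (by omega)
    · exact S.rim_split _ (by omega)

theorem prism_of_zero_one (S : IsSplitHub G r x y p) (h0 : G.Adj y (p 0)) (h1 : G.Adj y (p 1))
    {i j : ℕ} (hi : 2 ≤ i) (hij : i < j) (hj : j < r) (hxi : G.Adj x (p i))
    (hxj : G.Adj x (p j)) : IsMinorOf prismGraph G := by
  refine isMinorOf_prism (A := {y}) (B := {p 1}) (C := {p 0}) (D := {x})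
    (E := p '' Set.Icc 2 i) (F := p '' Set.Icc (i + 1) (r - 1)) ?_ ?_ ?_ ?_ ?_ ?_ ?_ ?_ ?_ ?_ ?_
  · simp only [List.mem_cons, List.not_mem_nil, or_false, forall_eq_or_imp, forall_eq,
      induce_singleton_connected, true_and]
    exact ⟨induce_image_Icc_connected (by omega) fun k _ _ => S.adj _ (by omega),
      induce_image_Icc_connected (by omega) fun k _ _ => S.adj _ (by omega)⟩
  · have h1 := S.ne_left
    have h2 := S.ne_right
    have h3 := S.inj
    have h4 := S.adj_split.ne
    simp only [List.pairwise_cons, List.mem_cons, List.not_mem_nil, or_false, forall_eq_or_imp,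
      forall_eq, IsEmpty.forall_iff, implies_true, List.Pairwise.nil, and_true,
      Set.mem_singleton_iff,
      Set.disjoint_left, Set.mem_image, Set.mem_Icc, not_exists, not_and]
    refine ⟨?_, ?_, ?_, ?_, ?_⟩
    all_goals grind
  · exact ⟨_, rfl, _, rfl, h1⟩
  · exact ⟨_, rfl, _, rfl, h0⟩
  · exact ⟨_, rfl, _, rfl, (S.adj 0 (by omega)).symm⟩
  · exact ⟨_, rfl, _, ⟨i, ⟨hi, le_rfl⟩, rfl⟩, hxi⟩
  · exact ⟨_, rfl, _, ⟨j, ⟨hij, by omega⟩, rfl⟩, hxj⟩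
  · exact ⟨_, ⟨i, ⟨hi, le_rfl⟩, rfl⟩, _, ⟨i + 1, ⟨le_rfl, by omega⟩, rfl⟩, S.adj _ (by omega)⟩
  · exact ⟨_, rfl, _, rfl, S.adj_split.symm⟩
  · exact ⟨_, rfl, _, ⟨2, ⟨le_rfl, hi⟩, rfl⟩, S.adj _ (by omega)⟩
  · exact ⟨_, rfl, _, ⟨r - 1, ⟨by omega, le_rfl⟩, rfl⟩, S.adj_last.symm⟩

theorem prism_of_pair (S : IsSplitHub G r x y p) {k l i j : ℕ} (hk : k < r) (hl : l < r)
    (hkl : l = k + 1 ∨ (k + 1 = r ∧ l = 0)) (hyk : G.Adj y (p k)) (hyl : G.Adj y (p l))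
    (hi : i < r) (hj : j < r) (hij : i ≠ j) (hik : i ≠ k) (hil : i ≠ l) (hjk : j ≠ k)
    (hjl : j ≠ l) (hxi : G.Adj x (p i)) (hxj : G.Adj x (p j)) : IsMinorOf prismGraph G := by
  have key : ∀ m < r, ∀ z, G.Adj z (p m) → m ≠ k → m ≠ l → ∃ n, 2 ≤ n ∧ n < r ∧
      (n + k = m ∨ n + k = m + r) ∧
      G.Adj z (if n + k < r then p (n + k) else p (n + k - r)) := by
    intro m hm z hz h1 h2
    by_cases h : k ≤ m
    · refine ⟨m - k, by omega, by omega, .inl (by omega), ?_⟩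
      rwa [if_pos (by omega), Nat.sub_add_cancel h]
    · refine ⟨m + r - k, by omega, by omega, .inr (by omega), ?_⟩
      rwa [if_neg (by omega), show m + r - k + k - r = m by omega]
  obtain ⟨i', hi1, hi2, hi3, hi4⟩ := key i hi x hxi hik hil
  obtain ⟨j', hj1, hj2, hj3, hj4⟩ := key j hj x hxj hjk hjl
  have T := S.rotate hk
  have h0 : G.Adj y (if 0 + k < r then p (0 + k) else p (0 + k - r)) := by
    rwa [if_pos (by omega), Nat.zero_add]
  have h1 : G.Adj y (if 1 + k < r then p (1 + k) else p (1 + k - r)) := by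
    split_ifs with h
    · rwa [show 1 + k = l by omega]
    · rwa [show 1 + k - r = l by omega]
  rcases lt_or_gt_of_ne (by omega : i' ≠ j') with h | h
  · exact T.prism_of_zero_one h0 h1 hi1 h hj2 hi4 hj4
  · exact T.prism_of_zero_one h0 h1 hj1 h hi2 hj4 hi4

theorem K33_of_zero (S : IsSplitHub G r x y p) (h0 : G.Adj y (p 0)) {k : ℕ} (hk : 2 ≤ k)
    (hkr : k + 2 ≤ r) (hyk : G.Adj y (p k)) (h1 : G.Adj x (p 1)) (hr : G.Adj x (p (r - 1))) :
    IsMinorOf K33Graph G := by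
  refine isMinorOf_K33 (A := {x}) (B := {p 0}) (C := {p k}) (D := {y})
    (E := p '' Set.Icc 1 (k - 1)) (F := p '' Set.Icc (k + 1) (r - 1))
    ?_ ?_ ?_ ?_ ?_ ?_ ?_ ?_ ?_ ?_ ?_
  · simp only [List.mem_cons, List.not_mem_nil, or_false, forall_eq_or_imp, forall_eq,
      induce_singleton_connected, true_and]
    exact ⟨induce_image_Icc_connected (by omega) fun k _ _ => S.adj _ (by omega),
      induce_image_Icc_connected (by omega) fun k _ _ => S.adj _ (by omega)⟩
  · have h1 := S.ne_left
    have h2 := S.ne_right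
    have h3 := S.inj
    have h4 := S.adj_split.ne
    simp only [List.pairwise_cons, List.mem_cons, List.not_mem_nil, or_false, forall_eq_or_imp,
      forall_eq, IsEmpty.forall_iff, implies_true, List.Pairwise.nil, and_true,
      Set.mem_singleton_iff,
      Set.disjoint_left, Set.mem_image, Set.mem_Icc, not_exists, not_and]
    refine ⟨?_, ?_, ?_, ?_, ?_⟩
    all_goals grind
  · exact ⟨_, rfl, _, rfl, S.adj_split⟩
  · exact ⟨_, rfl, _, ⟨1, ⟨le_rfl, by omega⟩, rfl⟩, h1⟩
  · exact ⟨_, rfl, _, ⟨r - 1, ⟨by omega, le_rfl⟩, rfl⟩, hr⟩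
  · exact ⟨_, rfl, _, rfl, h0.symm⟩
  · exact ⟨_, rfl, _, ⟨1, ⟨le_rfl, by omega⟩, rfl⟩, S.adj 0 (by omega)⟩
  · exact ⟨_, rfl, _, ⟨r - 1, ⟨by omega, le_rfl⟩, rfl⟩, S.adj_last.symm⟩
  · exact ⟨_, rfl, _, rfl, hyk.symm⟩
  · refine ⟨_, rfl, _, ⟨k - 1, ⟨by omega, le_rfl⟩, rfl⟩, ?_⟩
    have := S.adj (k - 1) (by omega)
    rw [Nat.sub_add_cancel (by omega)] at this
    exact this.symm
  · exact ⟨_, rfl, _, ⟨k + 1, ⟨le_rfl, by omega⟩, rfl⟩, S.adj _ (by omega)⟩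

/-- Either two consecutive rim vertices are adjacent to `y`, or there is a `K₃,₃` minor. -/
theorem exists_pair_or_K33 (S : IsSplitHub G r x y p) {i j : ℕ} (hij : i < j) (hj : j < r)
    (hyi : G.Adj y (p i)) (hyj : G.Adj y (p j)) :
    (∃ k l, k < r ∧ l < r ∧ (l = k + 1 ∨ (k + 1 = r ∧ l = 0)) ∧ G.Adj y (p k) ∧ G.Adj y (p l)) ∨
      IsMinorOf K33Graph G := by
  by_contra! hcon
  obtain ⟨hno, hK⟩ := hcon
  have h1 : ¬ (j = i + 1) := fun h => hno i j (by omega) hj (.inl h) hyi hyj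
  have h2 : ¬ (j + 1 = r ∧ i = 0) := fun h => hno j i hj (by omega) (.inr h) hyj hyi
  refine hK ((S.rotate (hij.trans hj)).K33_of_zero (k := j - i) ?_ (by omega) (by omega) ?_ ?_ ?_)
  · rwa [if_pos (by omega), Nat.zero_add]
  · rwa [if_pos (by omega), Nat.sub_add_cancel hij.le]
  · rw [if_pos (by omega)]
    exact (S.rim_split _ (by omega)).resolve_right
      (hno i (1 + i) (by omega) (by omega) (by omega) hyi)
  · split_ifs with h
    · exact (S.rim_split _ (by omega)).resolve_right
        (fun h' => hno _ i (by omega) (by omega) (by omega) h' hyi)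
    · exact (S.rim_split _ (by omega)).resolve_right
        (fun h' => hno _ i (by omega) (by omega) (by omega) h' hyi)

theorem prism_of_pairs_aux (S : IsSplitHub G r x y p) (hr : 4 ≤ r) (h0 : G.Adj x (p 0))
    (h1 : G.Adj x (p 1)) {m l : ℕ} (hm : m < r) (hl : l < r)
    (hml : l = m + 1 ∨ (m + 1 = r ∧ l = 0)) (hym : G.Adj y (p m)) (hyl : G.Adj y (p l)) :
    IsMinorOf prismGraph G := by
  by_contra hP
  have key : ∀ {k l i j : ℕ}, k < r → l < r → (l = k + 1 ∨ (k + 1 = r ∧ l = 0)) →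
      G.Adj x (p k) → G.Adj x (p l) → i < r → j < r → i ≠ j → G.Adj y (p i) → G.Adj y (p j) →
      i = k ∨ i = l ∨ j = k ∨ j = l := by
    intro k l i j hk hl hkl hxk hxl hi hj hij hyi hyj
    by_contra! hne
    exact hP (S.swap.prism_of_pair hk hl hkl hxk hxl hi hj hij hne.1 hne.2.1 hne.2.2.1 hne.2.2.2
      hyi hyj)
  have h01 := key (by omega) (by omega) (.inl rfl) h0 h1 hm hl (by omega) hym hyl
  by_cases h2 : G.Adj y (p 2)
  · have hlast : ¬ G.Adj y (p (r - 1)) := fun h => by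
      have := key (by omega) (by omega) (.inl rfl) h0 h1 (by omega) (by omega) (by omega) h2 h
      omega
    have hxlast := (S.rim_split (r - 1) (by omega)).resolve_right hlast
    have hm' : m ≠ r - 1 := fun e => hlast (e ▸ hym)
    have hl' : l ≠ r - 1 := fun e => hlast (e ▸ hyl)
    have := key (k := r - 1) (l := 0) (by omega) (by omega) (by omega) hxlast h0 hm hl (by omega)
      hym hyl
    obtain rfl : m = 0 := by omega
    obtain rfl : l = 1 := by omega
    have h3 : ¬ G.Adj x (p (r - 2)) := fun h => hP <| S.prism_of_pair (i := r - 1) (j := r - 2)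
      hm hl hml hym hyl (by omega) (by omega) (by omega) (by omega) (by omega) (by omega)
      (by omega) hxlast h
    have := key (k := r - 1) (l := 0) (by omega) (by omega) (by omega) hxlast h0 hl (by omega)
      (by omega) hyl ((S.rim_split (r - 2) (by omega)).resolve_left h3)
    omega
  · have hx2 := (S.rim_split 2 (by omega)).resolve_right h2
    have hm' : m ≠ 2 := fun e => h2 (e ▸ hym)
    have hl' : l ≠ 2 := fun e => h2 (e ▸ hyl)
    have := key (by omega) (by omega) (.inl rfl) h1 hx2 hm hl (by omega) hym hyl
    obtain rfl : m = 0 := by omega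
    obtain rfl : l = 1 := by omega
    have h3 : ¬ G.Adj x (p 3) := fun h => hP <| S.prism_of_pair (i := 2) (j := 3)
      hm hl hml hym hyl (by omega) (by omega) (by omega) (by omega) (by omega) (by omega)
      (by omega) hx2 h
    have := key (by omega) (by omega) (.inl rfl) h1 hx2 hm (by omega)
      (by omega) hym ((S.rim_split 3 (by omega)).resolve_left h3)
    omega

theorem prism_of_pairs (S : IsSplitHub G r x y p) (hr : 4 ≤ r) {k k' m l : ℕ} (hk : k < r)
    (hk' : k' < r) (hkk' : k' = k + 1 ∨ (k + 1 = r ∧ k' = 0)) (hxk : G.Adj x (p k))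
    (hxk' : G.Adj x (p k')) (hm : m < r) (hl : l < r)
    (hml : l = m + 1 ∨ (m + 1 = r ∧ l = 0)) (hym : G.Adj y (p m)) (hyl : G.Adj y (p l)) :
    IsMinorOf prismGraph G := by
  have key : ∀ z, ∀ n < r, G.Adj z (p n) →
      G.Adj z (if (if k ≤ n then n - k else n + r - k) + k < r
        then p ((if k ≤ n then n - k else n + r - k) + k)
        else p ((if k ≤ n then n - k else n + r - k) + k - r)) := by
    intro z n hn hz
    split_ifs with h1 h2 h2
    · rwa [Nat.sub_add_cancel h1]
    · omega
    · omega
    · rwa [show n + r - k + k - r = n by omega]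
  refine (S.rotate hk).prism_of_pairs_aux hr ?_ ?_
    (m := if k ≤ m then m - k else m + r - k) (l := if k ≤ l then l - k else l + r - k)
    ?_ ?_ ?_ (key y m hm hym) (key y l hl hyl)
  · rwa [if_pos (by omega), Nat.zero_add]
  · split_ifs with h
    · rwa [show 1 + k = k' by omega]
    · rwa [show 1 + k - r = k' by omega]
  all_goals split_ifs <;> omega

theorem prism_or_K33 (S : IsSplitHub G r x y p) (hr : 4 ≤ r)
    (hx : ∃ i j, i < j ∧ j < r ∧ G.Adj x (p i) ∧ G.Adj x (p j))
    (hy : ∃ i j, i < j ∧ j < r ∧ G.Adj y (p i) ∧ G.Adj y (p j)) :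
    IsMinorOf prismGraph G ∨ IsMinorOf K33Graph G := by
  obtain ⟨i, j, hij, hj, hxi, hxj⟩ := hx
  obtain ⟨i', j', hij', hj', hyi, hyj⟩ := hy
  rcases S.swap.exists_pair_or_K33 hij hj hxi hxj with ⟨k, k', hk, hk', hkk', hxk, hxk'⟩ | h
  · rcases S.exists_pair_or_K33 hij' hj' hyi hyj with ⟨m, l, hm, hl, hml, hym, hyl⟩ | h
    · exact .inl (S.prism_of_pairs hr hk hk' hkk' hxk hxk' hm hl hml hym hyl)
    · exact .inr h
  · exact .inr h

end IsSplitHub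

/-- If contracting an edge of a graph of minimum degree at least three gives a wheel, then the
graph is a wheel or has one of the two minors. -/
theorem IsWheelWith.of_contract {V : Type} {G : SimpleGraph V} {u v : V} (huv : G.Adj u v)
    (hdeg : ∀ a b c, ∃ d, d ≠ b ∧ d ≠ c ∧ G.Adj a d) {r : ℕ} (hr : 4 ≤ r)
    {h : {x : V // x ≠ v}} {p : ℕ → {x : V // x ≠ v}}
    (hW : IsWheelWith (contract G huv.ne) r h p) :
    IsMinorOf prismGraph G ∨ IsMinorOf K33Graph G ∨ ∃ q, IsWheelWith G (r + 1) h q := by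
  rcases hW.cover ⟨u, huv.ne⟩ with rfl | ⟨k, hk, hku⟩
  · have hne : ∀ i < r, (p i : V) ≠ u := fun i hi e => hW.ne_hub i hi (Subtype.ext e)
    have hadj : ∀ i < r, ∀ j < r, (contract G huv.ne).Adj (p i) (p j) → G.Adj (p i) (p j) := by
      intro i hi j hj hij
      rw [contract_adj] at hij
      have := hne i hi
      have := hne j hj
      tauto
    have S : IsSplitHub G r u v (fun i => p i) :=
      { ne_left := hne
        ne_right := fun i hi => (p i).2
        inj := fun i hi j hj hij => hW.inj i hi j hj (Subtype.ext hij)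
        adj := fun i hi => hadj _ (by omega) _ hi ((hW.adj _ _ (by omega) hi).2 (.inl rfl))
        adj_last := (hadj 0 (by omega) (r - 1) (by omega)
          ((hW.adj _ _ (by omega) (by omega)).2 (by omega))).symm
        adj_split := huv
        rim_split := fun i hi => by
          have := hW.hub_adj i hi
          rw [contract_adj] at this
          have := hne i hi
          tauto }
    have two : ∀ a b, (∀ z, z = a ∨ z = b ∨ ∃ i < r, (p i : V) = z) →
        ∃ i j, i < j ∧ j < r ∧ G.Adj a (p i) ∧ G.Adj a (p j) := by
      intro a b hcov
      obtain ⟨c, hcb, -, hac⟩ := hdeg a b b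
      obtain ⟨d, hdb, hdc, had⟩ := hdeg a b c
      rcases hcov c with e | e | ⟨i, hi, rfl⟩
      · exact absurd e hac.ne'
      · exact absurd e hcb
      rcases hcov d with e | e | ⟨j, hj, rfl⟩
      · exact absurd e had.ne'
      · exact absurd e hdb
      rcases lt_trichotomy i j with hij | rfl | hij
      · exact ⟨i, j, hij, hj, hac, had⟩
      · exact absurd rfl hdc
      · exact ⟨j, i, hij, hi, had, hac⟩
    have cov : ∀ z, z = u ∨ z = v ∨ ∃ i < r, (p i : V) = z := by
      intro z
      by_cases hz : z = v
      · exact .inr (.inl hz)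
      rcases hW.cover ⟨z, hz⟩ with e | ⟨i, hi, e⟩
      · exact .inl (congrArg Subtype.val e)
      · exact .inr (.inr ⟨i, hi, congrArg Subtype.val e⟩)
    have := S.prism_or_K33 hr (two u v cov) (two v u fun z => by have := cov z; tauto)
    tauto
  · have hW' := hW.rotate hk
    have hp0 : (fun i => if i + k < r then p (i + k) else p (i + k - r)) 0 = ⟨u, huv.ne⟩ := by
      simp only [Nat.zero_add, if_pos hk, hku]
    generalize (fun i => if i + k < r then p (i + k) else p (i + k - r)) = q at hW' hp0
    have hhu : (h : V) ≠ u := fun e => hW'.ne_hub 0 (by omega) (hp0.trans (Subtype.ext e.symm))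
    have hne : ∀ i, 1 ≤ i → i < r → (q i : V) ≠ u := by
      intro i h1 h2 e
      have := hW'.inj i h2 0 (by omega) ((Subtype.ext e).trans hp0.symm)
      omega
    have hrim0 : ∀ i, 1 ≤ i → i < r →
        ((G.Adj u (q i) ∨ G.Adj v (q i)) ↔ i = 1 ∨ i + 1 = r) := by
      intro i h1 h2
      have := hW'.adj 0 i (by omega) h2
      rw [hp0, contract_adj] at this
      have := hne i h1 h2
      have : (⟨u, huv.ne⟩ : {x : V // x ≠ v}) ≠ q i := fun e => this (by rw [← e])
      simp only [zero_add, true_and] at *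
      tauto
    have S : IsSplitRim G r h u v (fun i => q i) :=
      { hub_ne_left := hhu
        hub_ne_right := h.2
        ne_hub := fun i h1 h2 e => hW'.ne_hub i h2 (Subtype.ext e)
        ne_left := hne
        ne_right := fun i h1 h2 => (q i).2
        inj := fun i j h1 h2 h3 h4 e => hW'.inj i h2 j h4 (Subtype.ext e)
        cover := fun z => by
          by_cases hz : z = v
          · exact .inr (.inr (.inl hz))
          rcases hW'.cover ⟨z, hz⟩ with e | ⟨i, hi, e⟩
          · exact .inl (congrArg Subtype.val e)
          · rcases Nat.eq_zero_or_pos i with rfl | h0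
            · exact .inr (.inl (congrArg Subtype.val (e.symm.trans hp0)))
            · exact .inr (.inr (.inr ⟨i, h0, hi, congrArg Subtype.val e⟩))
        hub_adj := fun i h1 h2 => by
          have := hW'.hub_adj i h2
          rw [contract_adj] at this
          have := hne i h1 h2
          tauto
        adj := fun i j h1 h2 h3 => by
          have := hW'.adj i j h2 h3
          rw [contract_adj] at this
          have h4 := hne i h1 (by omega)
          have h5 := hne j (by omega) h3
          have h6 : q i ≠ q j := fun e => by
            have := hW'.inj i (by omega) j h3 e
            omega
          have h7 : i ≠ 0 := by omega
          tauto
        adj_split := huv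
        left_adj := fun i h1 h2 h3 => (hrim0 i h1 h2).1 (.inl h3)
        right_adj := fun i h1 h2 h3 => (hrim0 i h1 h2).1 (.inr h3)
        hub_split := by
          have := hW'.hub_adj 0 (by omega)
          rw [hp0, contract_adj] at this
          have := G.adj_comm h u
          tauto
        first_split := (hrim0 1 le_rfl (by omega)).2 (.inl rfl)
        last_split := (hrim0 (r - 1) (by omega) (by omega)).2 (by omega) }
    have := S.prism_or_wheel hr hdeg
    tauto

theorem TwoCutFree.minor_or_wheel (n : ℕ) : ∀ {V : Type} [Finite V] {G : SimpleGraph V},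
    TwoCutFree G → Nat.card V = n + 5 →
      IsMinorOf prismGraph G ∨ IsMinorOf K33Graph G ∨ IsMinorOf K5eGraph G ∨
        ∃ r, 4 ≤ r ∧ ∃ x p, IsWheelWith G r x p := by
  induction n with
  | zero =>
    intro V _ G hG hcard
    rcases hG.of_card_eq_five hcard with h | h
    · exact .inr (.inr (.inl h))
    · exact .inr (.inr (.inr ⟨4, le_rfl, h⟩))
  | succ n ih =>
    intro V _ G hG hcard
    have hdeg := hG.exists_adj (by omega)
    have hE : ∃ a b, G.Adj a b := by
      obtain ⟨a⟩ : Nonempty V := (Nat.card_pos_iff.1 (by omega)).1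
      obtain ⟨b, -, -, hab⟩ := hdeg a a a
      exact ⟨a, b, hab⟩
    obtain ⟨u, v, huv, hcon⟩ := hG.exists_contract hE
    have hcard' : Nat.card {x : V // x ≠ v} = n + 5 := by
      classical
      have := Nat.card_congr (Equiv.optionSubtypeNe v)
      rw [Finite.card_option] at this
      omega
    rcases ih hcon hcard' with h | h | h | ⟨r, hr, x, p, hW⟩
    · exact .inl (h.of_contract huv)
    · exact .inr (.inl (h.of_contract huv))
    · exact .inr (.inr (.inl (h.of_contract huv)))
    · rcases hW.of_contract huv hdeg hr with h | h | ⟨q, hq⟩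
      · exact .inl h
      · exact .inr (.inl h)
      · exact .inr (.inr (.inr ⟨r + 1, by omega, _, q, hq⟩))

/-- Every triconnected graph on at least four vertices that is not a wheel contains the
prism, `K₃,₃` or `K₅` minus an edge as a minor. -/
theorem triconnected_nonwheel {V : Type} [Finite V] (G : SimpleGraph V)
    (hcard : 4 ≤ Nat.card V) (h3 : KConnected 3 G)
    (hwheel : ∀ r : ℕ, 3 ≤ r → IsEmpty (G ≃g wheelGraph r)) :
    IsMinorOf prismGraph G ∨ IsMinorOf K33Graph G ∨ IsMinorOf K5eGraph G := by
  have hG := h3.twoCutFree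
  have hno : ∀ r, 3 ≤ r → ∀ x p, ¬ IsWheelWith G r x p := fun r hr x p hW =>
    not_isEmpty_iff.2 (hW.nonempty_iso hr) (hwheel r hr)
  rcases hcard.eq_or_lt with h | h
  · obtain ⟨x, p, hW⟩ := hG.wheel_of_card_eq_four h.symm
    exact absurd hW (hno 3 le_rfl x p)
  · rcases hG.minor_or_wheel (Nat.card V - 5) (by omega) with h | h | h | ⟨r, hr, x, p, hW⟩
    · exact .inl h
    · exact .inr (.inl h)
    · exact .inr (.inr h)
    · exact absurd hW (hno r (by omega) x p)
end

section
/- If G is a disconnected graph in obs(P1), then G has exactly two connected components, and each of these components is isomorphic to the diamond or to the butterfly. -/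
open SimpleGraph

/-- An apex-pseudoforest: removing at most one vertex yields a pseudoforest. -/
def ApexPseudoforest {V : Type} (G : SimpleGraph V) : Prop :=
  ∃ s : Set V, s.Subsingleton ∧ Pseudoforest (G.induce sᶜ)

/-- `G` is a minor-obstruction for the class of apex-pseudoforests: `G` is not an
apex-pseudoforest but every proper minor of `G` is. -/
def ObsApexPseudoforest {V : Type} (G : SimpleGraph V) : Prop :=
  ¬ ApexPseudoforest G ∧
    ∀ (W : Type) [Finite W] (H : SimpleGraph W),
      IsMinorOf H G → IsEmpty (H ≃g G) → ApexPseudoforest H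

namespace SimpleGraph

lemma Connected.induce_image {V W : Type} {G : SimpleGraph V} {H : SimpleGraph W} (φ : H →g G)
    {s : Set W} (hs : (H.induce s).Connected) : (G.induce (φ '' s)).Connected :=
  hs.map (induceHom φ (Set.mapsTo_image φ s)) (by
    rintro ⟨_, a, ha, rfl⟩
    exact ⟨⟨a, ha⟩, rfl⟩)

/-- The preimage of a connected set under a contraction is connected. -/
lemma Connected.induce_preimage {V W : Type} {G : SimpleGraph V} {π : V → W} {s : Set W}
    (hπ : Function.Surjective π)
    (hfib : ∀ a b, π a = π b → a = b ∨ G.Adj a b)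
    (hs : ((G.map π).induce s).Connected) : (G.induce (π ⁻¹' s)).Connected := by
  have fib : ∀ a b : π ⁻¹' s, π a = π b → (G.induce (π ⁻¹' s)).Reachable a b := by
    intro a b hab
    rcases hfib _ _ hab with h | h
    · rw [Subtype.ext h]
    · exact Adj.reachable (by simpa using h)
  have key : ∀ x y : s, ((G.map π).induce s).Walk x y → ∀ a b : π ⁻¹' s, π a = x → π b = y →
      (G.induce (π ⁻¹' s)).Reachable a b := by
    intro x y p
    induction p with
    | nil => intro a b ha hb; exact fib a b (ha.trans hb.symm)
    | @cons x z y h p ih =>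
      intro a b ha hb
      obtain ⟨-, a', z', hadj, hx, hz⟩ := h
      have ha' : a' ∈ π ⁻¹' s := by simp [hx]
      have hz' : z' ∈ π ⁻¹' s := by simp [hz]
      exact ((fib a ⟨a', ha'⟩ (ha.trans hx.symm)).trans
        (Adj.reachable (by simpa using hadj))).trans (ih ⟨z', hz'⟩ b hz hb)
  obtain ⟨x⟩ := hs.nonempty
  obtain ⟨a, ha⟩ := hπ x
  refine (connected_iff _).2 ⟨fun a b => ?_, ⟨⟨a, by simp [ha]⟩⟩⟩
  obtain ⟨p⟩ := hs.preconnected ⟨π a, a.2⟩ ⟨π b, b.2⟩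
  exact key _ _ p a b rfl rfl

lemma card_edgeSet_deleteEdges_singleton {V : Type} [Finite V] {G : SimpleGraph V} {e : Sym2 V}
    (he : e ∈ G.edgeSet) : Nat.card (G.deleteEdges {e}).edgeSet + 1 = Nat.card G.edgeSet := by
  rw [edgeSet_deleteEdges, Nat.card_coe_set_eq, Nat.card_coe_set_eq]
  exact Set.ncard_sdiff_singleton_add_one he (Set.toFinite _)

lemma Connected.deleteEdges_of_mem_cycle {V : Type} {G : SimpleGraph V} (hG : G.Connected)
    {e : Sym2 V} {u : V} {c : G.Walk u u} (hc : c.IsCycle) (he : e ∈ c.edges) :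
    (G.deleteEdges {e}).Connected := by
  induction e with
  | h x y =>
    exact hG.connected_delete_edge_of_not_isBridge fun hb => hb.notMem_edges_of_isCycle hc he

lemma isCycle_of_triangle {V : Type} {G : SimpleGraph V} {a b c : V} (hab : G.Adj a b)
    (hbc : G.Adj b c) (hca : G.Adj c a) :
    (Walk.cons hab (Walk.cons hbc (Walk.cons hca Walk.nil))).IsCycle := by
  have := hab.ne; have := hbc.ne; have := hca.ne
  rw [Walk.isCycle_def]
  simp [Walk.isTrail_def]
  grind

/-- Contracting the edge `uv` identifies `v` with `u`. -/
noncomputable def contractVert {V : Type} {u v : V} (h : u ≠ v) (a : V) : {w : V // w ≠ v} :=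
  open Classical in if ha : a = v then ⟨u, h⟩ else ⟨a, ha⟩

lemma contractVert_eq_iff {V : Type} {u v : V} (h : u ≠ v) {a b : V} :
    contractVert h a = contractVert h b ↔
      a = b ∨ (a = u ∧ b = v) ∨ (a = v ∧ b = u) := by
  unfold contractVert
  split_ifs <;> simp only [Subtype.mk.injEq] <;> grind

lemma contractVert_surjective {V : Type} {u v : V} (h : u ≠ v) :
    Function.Surjective (contractVert h) :=
  fun w => ⟨w, by simp [contractVert, w.2]⟩

/-- Contracting an edge which lies in no triangle loses exactly that edge. -/
lemma card_edgeSet_le_card_edgeSet_map_contractVert {V : Type} [Finite V] {G : SimpleGraph V}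
    {u v : V} (huv : G.Adj u v) (hT : ∀ w, G.Adj u w → ¬ G.Adj v w) :
    Nat.card G.edgeSet ≤ Nat.card (G.map (contractVert huv.ne)).edgeSet + 1 := by
  rw [← card_edgeSet_deleteEdges_singleton (G.mem_edgeSet.2 huv), Nat.card_coe_set_eq,
    Nat.card_coe_set_eq]
  gcongr
  refine Set.ncard_le_ncard_of_injOn (Sym2.map (contractVert huv.ne)) ?_ ?_ (Set.toFinite _)
  · intro e
    induction e with
    | h a b =>
      intro hab
      simp only [mem_edgeSet, deleteEdges_adj, Set.mem_singleton_iff] at hab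
      rw [Sym2.map_mk, mem_edgeSet]
      refine map_adj_apply' hab.1 fun h => hab.2 ?_
      have := hab.1.ne
      rcases (contractVert_eq_iff _).1 h with h | ⟨rfl, rfl⟩ | ⟨rfl, rfl⟩
      · exact absurd h this
      · rfl
      · exact Sym2.eq_swap
  · intro e he e' he' h
    induction e with
    | h a b =>
      induction e' with
      | h c d =>
        simp only [mem_edgeSet, deleteEdges_adj, Set.mem_singleton_iff, Sym2.eq_iff] at he he'
        simp only [Sym2.map_mk, Sym2.eq_iff, contractVert_eq_iff] at h
        have hT' : ∀ w, G.Adj w u → G.Adj w v → False := fun w h h' => hT w h.symm h'.symm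
        have hT1 : ∀ w, G.Adj u w → G.Adj w v → False := fun w h h' => hT w h h'.symm
        have hT2 : ∀ w, G.Adj w u → G.Adj v w → False := fun w h h' => hT w h.symm h'
        rw [Sym2.eq_iff]
        obtain ⟨he, he2⟩ := he
        obtain ⟨he', he2'⟩ := he'
        have h1 := he.ne
        have h2 := he'.ne
        rcases h with ⟨h | h | h, h' | h' | h'⟩ | ⟨h | h | h, h' | h' | h'⟩ <;> grind

/-- A connected graph containing two distinct cycles has at least one edge more than vertices. -/
lemma Connected.card_lt_card_edgeSet_of_isCycle {V : Type} [Finite V] {G : SimpleGraph V}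
    (hG : G.Connected) {u v : V} {c : G.Walk u u} {c' : G.Walk v v} (hc : c.IsCycle)
    (hc' : c'.IsCycle) {e : Sym2 V} (he : e ∈ c.edges) (he' : e ∉ c'.edges) :
    Nat.card V < Nat.card G.edgeSet := by
  have h1 := hG.deleteEdges_of_mem_cycle hc he
  have hc2 := Walk.IsCycle.toDeleteEdges G {e} hc' fun x hx (h : x = e) => he' (h ▸ hx)
  obtain ⟨f, hf⟩ := List.exists_mem_of_ne_nil _ (mt Walk.edges_eq_nil.1 hc2.not_nil)
  have h2 := (h1.deleteEdges_of_mem_cycle hc2 hf).card_vert_le_card_edgeSet_add_one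
  have h3 := card_edgeSet_deleteEdges_singleton (Walk.edges_subset_edgeSet _ hf)
  have h4 := card_edgeSet_deleteEdges_singleton (Walk.edges_subset_edgeSet _ he)
  omega

end SimpleGraph

lemma IsMinorOf.of_injective_hom {V W : Type} {G : SimpleGraph V} {H : SimpleGraph W}
    (φ : H →g G) (hφ : Function.Injective φ) : IsMinorOf H G := by
  refine ⟨fun w => {φ w}, fun w => ?_, fun w w' h => ?_, fun w w' h => ?_⟩
  · exact (connected_iff _).2 ⟨Preconnected.of_subsingleton, inferInstance⟩
  · simpa using hφ.ne h
  · exact ⟨_, rfl, _, rfl, φ.map_adj h⟩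

lemma IsMinorOf.of_map {V W U : Type} {G : SimpleGraph V} {π : V → W} {H : SimpleGraph U}
    (hπ : Function.Surjective π) (hfib : ∀ a b, π a = π b → a = b ∨ G.Adj a b)
    (h : IsMinorOf H (G.map π)) : IsMinorOf H G := by
  obtain ⟨f, hc, hd, ha⟩ := h
  refine ⟨fun w => π ⁻¹' f w, fun w => (hc w).induce_preimage hπ hfib,
    fun w w' h => (hd h).preimage π, fun w w' h => ?_⟩
  obtain ⟨_, hx, _, hy, -, a, b, hab, rfl, rfl⟩ := ha h
  exact ⟨a, hx, b, hy, hab⟩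

lemma IsMinorOf.sum {V W₁ W₂ : Type} {G : SimpleGraph V} {s t : Set V} {H₁ : SimpleGraph W₁}
    {H₂ : SimpleGraph W₂} (hst : Disjoint s t) (h₁ : IsMinorOf H₁ (G.induce s))
    (h₂ : IsMinorOf H₂ (G.induce t)) : IsMinorOf (H₁ ⊕g H₂) G := by
  obtain ⟨f, fc, fd, fa⟩ := h₁
  obtain ⟨g, gc, gd, ga⟩ := h₂
  have hfs : ∀ w, Subtype.val '' f w ⊆ s := fun w => by simp
  have hgt : ∀ w, Subtype.val '' g w ⊆ t := fun w => by simp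
  refine ⟨Sum.elim (fun w => Subtype.val '' f w) (fun w => Subtype.val '' g w), ?_, ?_, ?_⟩
  · rintro (w | w)
    · exact (fc w).induce_image (Embedding.induce s).toHom
    · exact (gc w).induce_image (Embedding.induce t).toHom
  · rintro (w | w) (w' | w') h
    · exact (Set.disjoint_image_iff Subtype.val_injective).2 (fd (by simpa using h))
    · exact hst.mono (hfs w) (hgt w')
    · exact hst.symm.mono (hgt w) (hfs w')
    · exact (Set.disjoint_image_iff Subtype.val_injective).2 (gd (by simpa using h))
  · rintro (w | w) (w' | w') h
    · obtain ⟨a, ha, b, hb, hab⟩ := fa (sum_adj_inl.1 h)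
      exact ⟨a, ⟨a, ha, rfl⟩, b, ⟨b, hb, rfl⟩, hab⟩
    · simp at h
    · simp at h
    · obtain ⟨a, ha, b, hb, hab⟩ := ga (sum_adj_inr.1 h)
      exact ⟨a, ⟨a, ha, rfl⟩, b, ⟨b, hb, rfl⟩, hab⟩

lemma Pseudoforest.of_injective_hom {V W : Type} {G : SimpleGraph V} {H : SimpleGraph W}
    (hG : Pseudoforest G) (φ : H →g G) (hφ : Function.Injective φ) : Pseudoforest H := by
  intro u v c c' hc hc' huv e
  have := hG (c.map φ) (c'.map φ) (hc.map hφ) (hc'.map hφ) (huv.map φ) (e.map φ)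
  simpa only [Walk.edges_map, List.mem_map_of_injective (Sym2.map.injective hφ)] using this

/-- A disjoint union of two pseudoforests is a pseudoforest. -/
lemma Pseudoforest.of_induce_compl {V : Type} {G : SimpleGraph V} (s : Set V)
    (hs : ∀ a b, G.Adj a b → (a ∈ s ↔ b ∈ s)) (h₁ : Pseudoforest (G.induce s))
    (h₂ : Pseudoforest (G.induce sᶜ)) : Pseudoforest G := by
  have inv : ∀ {a b : V} (p : G.Walk a b), ∀ x ∈ p.support, (x ∈ s ↔ a ∈ s) := by
    intro a b p
    induction p with
    | nil => simp
    | cons h p ih =>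
      have := hs _ _ h
      simp only [Walk.support_cons, List.mem_cons]
      grind
  have side : ∀ (t : Set V), (∀ {a b : V} (p : G.Walk a b), ∀ x ∈ p.support, (x ∈ t ↔ a ∈ t)) →
      Pseudoforest (G.induce t) → ∀ ⦃u v : V⦄ (c : G.Walk u u) (c' : G.Walk v v),
      c.IsCycle → c'.IsCycle → G.Reachable u v → u ∈ t → ∀ e, e ∈ c.edges ↔ e ∈ c'.edges := by
    intro t ht hP u v c c' hc hc' ⟨p⟩ hu e
    have hv : v ∈ t := (ht p v p.end_mem_support).2 hu
    have hcs : ∀ x ∈ c.support, x ∈ t := fun x hx => (ht c x hx).2 hu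
    have hcs' : ∀ x ∈ c'.support, x ∈ t := fun x hx => (ht c' x hx).2 hv
    have hps : ∀ x ∈ p.support, x ∈ t := fun x hx => (ht p x hx).2 hu
    have inj : Function.Injective (Embedding.induce (G := G) t).toHom := Subtype.val_injective
    have hce := (congrArg Walk.edges (Walk.map_induce c hcs)).symm.trans (Walk.edges_map _ _)
    have hce' := (congrArg Walk.edges (Walk.map_induce c' hcs')).symm.trans (Walk.edges_map _ _)
    rw [← Walk.map_induce c hcs] at hc
    rw [← Walk.map_induce c' hcs'] at hc'
    have := hP (c.induce t hcs) (c'.induce t hcs') ((Walk.isCycle_map_iff_of_injective inj).1 hc)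
      ((Walk.isCycle_map_iff_of_injective inj).1 hc') ⟨p.induce t hps⟩
    refine (hce ▸ List.mem_map).trans (Iff.trans ?_ (hce' ▸ List.mem_map).symm)
    exact exists_congr fun x => and_congr_left' (this x)
  intro u v c c' hc hc' huv
  by_cases hu : u ∈ s
  · exact side s inv h₁ c c' hc hc' huv hu
  · exact side sᶜ (fun p x hx => not_congr (inv p x hx)) h₂ c c' hc hc' huv hu

lemma not_pseudoforest_of_triangles {V : Type} {G : SimpleGraph V} {a b c x y : V}
    (hab : G.Adj a b) (hbc : G.Adj b c) (hca : G.Adj c a) (hax : G.Adj a x) (hxy : G.Adj x y)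
    (hya : G.Adj y a) (hcx : c ≠ x) (hcy : c ≠ y) : ¬ Pseudoforest G := by
  intro h
  have := (h _ _ (isCycle_of_triangle hab hbc hca) (isCycle_of_triangle hax hxy hya) .rfl
    s(c, a)).1 (by simp)
  have := hca.ne
  simp at *
  grind

lemma not_pseudoforest_diamondGraph : ¬ Pseudoforest diamondGraph :=
  not_pseudoforest_of_triangles (a := 0) (b := 1) (c := 2) (x := 1) (y := 3)
    (by simp [diamondGraph, mkGraph]) (by simp [diamondGraph, mkGraph])
    (by simp [diamondGraph, mkGraph]) (by simp [diamondGraph, mkGraph])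
    (by simp [diamondGraph, mkGraph]) (by simp [diamondGraph, mkGraph]) (by simp) (by simp)

lemma not_pseudoforest_butterflyGraph : ¬ Pseudoforest butterflyGraph :=
  not_pseudoforest_of_triangles (a := 0) (b := 1) (c := 2) (x := 3) (y := 4)
    (by simp [butterflyGraph, mkGraph]) (by simp [butterflyGraph, mkGraph])
    (by simp [butterflyGraph, mkGraph]) (by simp [butterflyGraph, mkGraph])
    (by simp [butterflyGraph, mkGraph]) (by simp [butterflyGraph, mkGraph]) (by simp) (by simp)

lemma connected_of_forall_adj_zero {n : ℕ} [NeZero n] {G : SimpleGraph (Fin n)}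
    (h : ∀ i, i ≠ 0 → G.Adj 0 i) : G.Connected := by
  have h0 : ∀ i, G.Reachable 0 i := fun i => by
    by_cases hi : i = 0
    · rw [hi]
    · exact (h i hi).reachable
  exact (connected_iff _).2 ⟨fun i j => (h0 i).symm.trans (h0 j), ⟨0⟩⟩

lemma connected_diamondGraph : diamondGraph.Connected :=
  connected_of_forall_adj_zero fun i hi => by
    fin_cases i <;> simp_all [diamondGraph, mkGraph]

lemma connected_butterflyGraph : butterflyGraph.Connected :=
  connected_of_forall_adj_zero fun i hi => by
    fin_cases i <;> simp_all [butterflyGraph, mkGraph]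

lemma isMinorOf_diamondGraph {V : Type} {G : SimpleGraph V} {a b c d : V} (hab : G.Adj a b)
    (hac : G.Adj a c) (had : G.Adj a d) (hbc : G.Adj b c) (hbd : G.Adj b d) (hcd : c ≠ d) :
    IsMinorOf diamondGraph G := by
  have := hab.ne; have := hac.ne; have := had.ne; have := hbc.ne; have := hbd.ne
  refine .of_injective_hom ⟨![a, b, c, d], fun {i j} h => ?_⟩ fun i j h => ?_
  · fin_cases i <;> fin_cases j <;> simp [diamondGraph, mkGraph] at h ⊢ <;>
      first | assumption | (apply Adj.symm; assumption)
  · change ![a, b, c, d] i = ![a, b, c, d] j at h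
    fin_cases i <;> fin_cases j <;> simp at h ⊢ <;> grind

lemma isMinorOf_butterflyGraph {V : Type} {G : SimpleGraph V} {a b c x y : V} (hab : G.Adj a b)
    (hac : G.Adj a c) (hbc : G.Adj b c) (hax : G.Adj a x) (hay : G.Adj a y) (hxy : G.Adj x y)
    (hbx : b ≠ x) (hby : b ≠ y) (hcx : c ≠ x) (hcy : c ≠ y) : IsMinorOf butterflyGraph G := by
  have := hab.ne; have := hac.ne; have := hbc.ne; have := hax.ne; have := hay.ne; have := hxy.ne
  refine .of_injective_hom ⟨![a, b, c, x, y], fun {i j} h => ?_⟩ fun i j h => ?_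
  · fin_cases i <;> fin_cases j <;> simp [butterflyGraph, mkGraph] at h ⊢ <;>
      first | assumption | (apply Adj.symm; assumption)
  · change ![a, b, c, x, y] i = ![a, b, c, x, y] j at h
    fin_cases i <;> fin_cases j <;> simp at h ⊢ <;> grind

/-- A graph with more edges than vertices contains the diamond or the butterfly as a minor. -/
lemma isMinorOf_diamondGraph_or_butterflyGraph {V : Type} [Finite V] {G : SimpleGraph V}
    (h : Nat.card V < Nat.card G.edgeSet) :
    IsMinorOf diamondGraph G ∨ IsMinorOf butterflyGraph G := by
  induction hn : Nat.card V generalizing V with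
  | zero =>
    have := Finite.card_eq_zero_iff.1 hn
    have : IsEmpty G.edgeSet := ⟨fun e => by
      obtain ⟨⟨a, b⟩, -⟩ := e
      exact isEmptyElim a⟩
    simp at h
  | succ n ih =>
    by_cases hT : ∃ u v, ∃ huv : G.Adj u v, ∀ w, G.Adj u w → ¬ G.Adj v w
    · obtain ⟨u, v, huv, hT⟩ := hT
      have hE := card_edgeSet_le_card_edgeSet_map_contractVert huv hT
      have hV : Nat.card {w : V // w ≠ v} = n := by
        have := Set.ncard_sdiff_singleton_add_one (Set.mem_univ v) (Set.toFinite _)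
        rw [Set.ncard_univ, hn, ← Nat.card_coe_set_eq] at this
        have h2 : Nat.card {w : V // w ≠ v} = Nat.card ↥(Set.univ \ {v}) :=
          Nat.card_congr (Equiv.subtypeEquivRight (by simp))
        omega
      have hfib : ∀ a b, contractVert huv.ne a = contractVert huv.ne b → a = b ∨ G.Adj a b := by
        intro a b hab
        rcases (contractVert_eq_iff _).1 hab with h | ⟨rfl, rfl⟩ | ⟨rfl, rfl⟩
        exacts [.inl h, .inr huv, .inr huv.symm]
      exact (ih (by omega) hV).imp (.of_map (contractVert_surjective _) hfib)
        (.of_map (contractVert_surjective _) hfib)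
    · push Not at hT
      classical
      have := Fintype.ofFinite V
      obtain ⟨v, hv⟩ : ∃ v, 2 < G.degree v := by
        by_contra! hd
        have h1 := Finset.sum_le_sum fun v (_ : v ∈ Finset.univ) => hd v
        rw [sum_degrees_eq_twice_card_edges] at h1
        simp only [Finset.sum_const, Finset.card_univ, smul_eq_mul] at h1
        rw [Nat.card_eq_fintype_card, Nat.card_eq_fintype_card, ← edgeFinset_card] at h
        omega
      rw [← card_neighborFinset_eq_degree] at hv
      obtain ⟨a, ha⟩ := Finset.card_pos.1 (by omega : 0 < (G.neighborFinset v).card)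
      rw [mem_neighborFinset] at ha
      obtain ⟨x, hvx, hax⟩ := hT v a ha
      obtain ⟨c, hc, hc'⟩ := Finset.exists_mem_notMem_of_card_lt_card
        ((Finset.card_le_two (a := a) (b := x)).trans_lt hv)
      rw [mem_neighborFinset] at hc
      obtain ⟨y, hvy, hcy⟩ := hT v c hc
      simp only [Finset.mem_insert, Finset.mem_singleton, not_or] at hc'
      by_cases hya : a = y
      · subst hya
        exact .inl (isMinorOf_diamondGraph ha hvx hc hax hcy.symm (Ne.symm hc'.2))
      by_cases hyx : x = y
      · subst hyx
        exact .inl (isMinorOf_diamondGraph hvx ha hc hax.symm hcy.symm (Ne.symm hc'.1))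
      · exact .inr (isMinorOf_butterflyGraph ha hvx hax hc hvy hcy (Ne.symm hc'.1) hya
          (Ne.symm hc'.2) hyx)

lemma isMinorOf_of_not_pseudoforest {V : Type} [Finite V] {G : SimpleGraph V}
    (hG : G.Connected) (h : ¬ Pseudoforest G) :
    IsMinorOf diamondGraph G ∨ IsMinorOf butterflyGraph G := by
  apply isMinorOf_diamondGraph_or_butterflyGraph
  simp only [Pseudoforest, not_forall] at h
  obtain ⟨u, v, c, c', hc, hc', -, e, he⟩ := h
  by_cases h1 : e ∈ c.edges
  · exact hG.card_lt_card_edgeSet_of_isCycle hc hc' h1 (by simpa [h1] using he)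
  · exact hG.card_lt_card_edgeSet_of_isCycle hc' hc (by simpa [h1] using he) h1

lemma not_apexPseudoforest_sum {W₁ W₂ : Type} {H₁ : SimpleGraph W₁} {H₂ : SimpleGraph W₂}
    (h₁ : ¬ Pseudoforest H₁) (h₂ : ¬ Pseudoforest H₂) : ¬ ApexPseudoforest (H₁ ⊕g H₂) := by
  rintro ⟨s, hs, hP⟩
  by_cases h : ∃ a, Sum.inl a ∈ s
  · obtain ⟨a, ha⟩ := h
    have hn : ∀ b : W₂, Sum.inr b ∈ sᶜ := fun b hb => by simpa using hs ha hb
    exact h₂ (hP.of_injective_hom ⟨fun b => ⟨.inr b, hn b⟩, fun h => by simpa using h⟩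
      fun b b' h => by simpa using h)
  · push Not at h
    exact h₁ (hP.of_injective_hom ⟨fun b => ⟨.inl b, h b⟩, fun h => by simpa using h⟩
      fun b b' h => by simpa using h)

lemma ObsApexPseudoforest.not_pseudoforest_induce_supp {V : Type} [Finite V] {G : SimpleGraph V}
    (h : ObsApexPseudoforest G) (C : G.ConnectedComponent) : ¬ Pseudoforest (G.induce C.supp) := by
  intro hC
  obtain ⟨s, hs, hP⟩ := h.2 _ (G.induce C.suppᶜ)
    (.of_injective_hom (Embedding.induce _).toHom Subtype.val_injective) ⟨fun φ => by
      obtain ⟨v, hv⟩ := C.nonempty_supp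
      obtain ⟨w, rfl⟩ := (Finite.injective_iff_surjective_of_equiv φ.toEquiv).1
        Subtype.val_injective v
      exact w.2 hv⟩
  refine h.1 ⟨Subtype.val '' s, hs.image _, ?_⟩
  refine .of_induce_compl (Subtype.val ⁻¹' C.supp) ?_ ?_ ?_
  · rintro a b hab
    exact C.mem_supp_congr_adj hab
  · refine hC.of_injective_hom ⟨fun x => ⟨x.1.1, x.2⟩, fun h => h⟩ fun x y h => ?_
    exact Subtype.ext (Subtype.ext (congrArg (fun z => z.1) h))
  · refine hP.of_injective_hom ⟨fun x => ⟨⟨x.1.1, x.2⟩, fun hx => x.1.2 ⟨_, hx, rfl⟩⟩,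
      fun h => h⟩ fun x y h => ?_
    exact Subtype.ext (Subtype.ext (congrArg (fun z => z.1.1) h))

/-- The image of a connected graph under an embedding onto a connected component. -/
lemma nonempty_iso_induce_supp {V W : Type} {G : SimpleGraph V} {H : SimpleGraph W} (φ : H ↪g G)
    (C : G.ConnectedComponent) (h : Set.range φ = C.supp) : Nonempty (G.induce C.supp ≃g H) :=
  h ▸ ⟨φ.isoInduceRange.symm⟩

lemma components_of_iso_sum {V W₁ W₂ : Type} {G : SimpleGraph V} {H₁ : SimpleGraph W₁}
    {H₂ : SimpleGraph W₂} (h₁ : H₁.Connected) (h₂ : H₂.Connected) (φ : H₁ ⊕g H₂ ≃g G) :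
    Nat.card G.ConnectedComponent = 2 ∧ ∀ C : G.ConnectedComponent,
      Nonempty (G.induce C.supp ≃g H₁) ∨ Nonempty (G.induce C.supp ≃g H₂) := by
  have r₁ : ∀ a b, G.Reachable (φ (.inl a)) (φ (.inl b)) := fun a b =>
    ((h₁.preconnected a b).map Embedding.sumInl.toHom).map φ.toHom
  have r₂ : ∀ a b, G.Reachable (φ (.inr a)) (φ (.inr b)) := fun a b =>
    ((h₂.preconnected a b).map Embedding.sumInr.toHom).map φ.toHom
  have r₃ : ∀ a b, ¬ G.Reachable (φ (.inl a)) (φ (.inr b)) := fun a b h =>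
    not_reachable_sum_inl_inr a b (φ.reachable_iff.1 h)
  obtain ⟨a⟩ := h₁.nonempty
  obtain ⟨b⟩ := h₂.nonempty
  constructor
  · rw [Nat.card_eq_two_iff]
    refine ⟨G.connectedComponentMk (φ (.inl a)), G.connectedComponentMk (φ (.inr b)),
      fun h => r₃ a b (ConnectedComponent.exact h), ?_⟩
    rw [Set.eq_univ_iff_forall]
    intro C
    induction C using ConnectedComponent.ind with | h v =>
    obtain ⟨x | x, rfl⟩ := φ.surjective v
    · exact .inl (ConnectedComponent.sound (r₁ x a))
    · exact .inr (ConnectedComponent.sound (r₂ x b))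
  · intro C
    induction C using ConnectedComponent.ind with | h v =>
    obtain ⟨x | x, rfl⟩ := φ.surjective v
    · refine .inl (nonempty_iso_induce_supp (φ.toEmbedding.comp Embedding.sumInl) _ ?_)
      ext w
      obtain ⟨y | y, rfl⟩ := φ.surjective w
      · simpa using r₁ y x
      · simpa using fun h => r₃ x y h.symm
    · refine .inr (nonempty_iso_induce_supp (φ.toEmbedding.comp Embedding.sumInr) _ ?_)
      ext w
      obtain ⟨y | y, rfl⟩ := φ.surjective w
      · simpa using r₃ y x
      · simpa using r₂ y x

lemma ObsApexPseudoforest.nonempty {V : Type} {G : SimpleGraph V} (h : ObsApexPseudoforest G) :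
    Nonempty V := by
  by_contra hV
  rw [not_nonempty_iff] at hV
  exact h.1 ⟨∅, Set.subsingleton_empty, fun u => hV.elim u⟩

lemma ObsApexPseudoforest.exists_minor_induce_supp {V : Type} [Finite V] {G : SimpleGraph V}
    (h : ObsApexPseudoforest G) (C : G.ConnectedComponent) :
    ∃ n, ∃ H : SimpleGraph (Fin n), IsMinorOf H (G.induce C.supp) ∧ H.Connected ∧
      ¬ Pseudoforest H ∧ ∀ (W : Type) (K : SimpleGraph W), Nonempty (K ≃g H) →
        Nonempty (K ≃g diamondGraph) ∨ Nonempty (K ≃g butterflyGraph) := by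
  rcases isMinorOf_of_not_pseudoforest C.connected_toSimpleGraph
    (h.not_pseudoforest_induce_supp C) with hm | hm
  · exact ⟨4, _, hm, connected_diamondGraph, not_pseudoforest_diamondGraph, fun _ _ => .inl⟩
  · exact ⟨5, _, hm, connected_butterflyGraph, not_pseudoforest_butterflyGraph, fun _ _ => .inr⟩

/-- A disconnected obstruction for apex-pseudoforests has exactly two connected components,
each isomorphic to the diamond or to the butterfly. -/
theorem disconnected_obstruction {V : Type} [Finite V] (G : SimpleGraph V)
    (h1 : ObsApexPseudoforest G) (h2 : ¬ G.Connected) :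
    Nat.card G.ConnectedComponent = 2 ∧
    ∀ C : G.ConnectedComponent,
      Nonempty ((G.induce C.supp) ≃g diamondGraph) ∨
        Nonempty ((G.induce C.supp) ≃g butterflyGraph) := by
  have := h1.nonempty
  obtain ⟨u, v, huv⟩ : ∃ u v, ¬ G.Reachable u v := by
    by_contra! h
    exact h2 ((connected_iff _).2 ⟨h, inferInstance⟩)
  have hne : G.connectedComponentMk u ≠ G.connectedComponentMk v :=
    fun h => huv (ConnectedComponent.exact h)
  obtain ⟨m, H₁, hm₁, hc₁, hp₁, hi₁⟩ := h1.exists_minor_induce_supp (G.connectedComponentMk u)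
  obtain ⟨n, H₂, hm₂, hc₂, hp₂, hi₂⟩ := h1.exists_minor_induce_supp (G.connectedComponentMk v)
  have hiso : Nonempty (H₁ ⊕g H₂ ≃g G) := by
    by_contra h
    exact not_apexPseudoforest_sum hp₁ hp₂
      (h1.2 _ _ (hm₁.sum (pairwise_disjoint_supp_connectedComponent G hne) hm₂)
        (not_nonempty_iff.1 h))
  obtain ⟨φ⟩ := hiso
  obtain ⟨hcard, hcomp⟩ := components_of_iso_sum hc₁ hc₂ φ
  exact ⟨hcard, fun C => (hcomp C).elim (hi₁ _ _) (hi₂ _ _)⟩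
end

section
/- Let G be a biconnected graph and let S = {x,y} be a separator of G such that two distinct members of C(G,S) each contain a subdivision of K4 as a subgraph. Then the graph obtained from the complete bipartite graph K(2,4) (with parts {s,t} and {m1,m2,m3,m4}) by adding the two edges m1m2 and m3m4 is a minor of G. -/
open SimpleGraph

/-- A separator: a vertex set whose deletion increases the number of connected components. -/
def IsSeparator {V : Type} (G : SimpleGraph V) (S : Set V) : Prop :=
  Nat.card G.ConnectedComponent < Nat.card (G.induce Sᶜ).ConnectedComponent

/-- The augmented connected component of `G` corresponding to a connected component `C`
of `G - S`: the induced subgraph on `V(C) ∪ S` together with all edges inside `S`. -/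
def augComp {V : Type} (G : SimpleGraph V) (S : Set V)
    (C : (G.induce Sᶜ).ConnectedComponent) :
    SimpleGraph ↥(Subtype.val '' C.supp ∪ S) :=
  SimpleGraph.fromRel fun a b => G.Adj (a : V) (b : V) ∨ ((a : V) ∈ S ∧ (b : V) ∈ S)

/-- A witness that `G` contains a subdivision of `H` as a subgraph: an injective choice of
branch vertices together with, for each edge of `H`, a path of `G` between the corresponding
branch vertices, these paths being internally disjoint from each other and from the branch
vertices. -/
structure SubdivisionEmbedding {W V : Type} (H : SimpleGraph W) (G : SimpleGraph V) where
  branch : W → V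
  inj : Function.Injective branch
  walk : ∀ ⦃w w' : W⦄, H.Adj w w' → G.Walk (branch w) (branch w')
  walk_isPath : ∀ ⦃w w' : W⦄ (h : H.Adj w w'), (walk h).IsPath
  walk_symm : ∀ ⦃w w' : W⦄ (h : H.Adj w w'), walk h.symm = (walk h).reverse
  branch_support : ∀ ⦃w w' : W⦄ (h : H.Adj w w') (u : W),
    branch u ∈ (walk h).support → u = w ∨ u = w'
  support_disjoint : ∀ ⦃w₁ w₁' w₂ w₂' : W⦄ (h₁ : H.Adj w₁ w₁') (h₂ : H.Adj w₂ w₂'),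
    s(w₁, w₁') ≠ s(w₂, w₂') → ∀ v : V,
      v ∈ (walk h₁).support → v ∈ (walk h₂).support →
      ∃ u : W, branch u = v ∧ (u = w₁ ∨ u = w₁') ∧ (u = w₂ ∨ u = w₂')

/-- Two vertex sets that split the support `s` of a path into two connected pieces joined by an
edge. -/
structure IsSplit {V : Type*} (G : SimpleGraph V) (s A B : Set V) : Prop where
  union_eq : A ∪ B = s
  disjoint : Disjoint A B
  left_connected : (G.induce A).Connected
  right_connected : (G.induce B).Connected
  exists_adj : ∃ a ∈ A, ∃ b ∈ B, G.Adj a b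

/-- A path can be cut into two connected pieces separating any two given distinct vertices. -/
theorem exists_isSplit {V : Type*} {G : SimpleGraph V} {a b : V} (p : G.Walk a b)
    (hp : p.IsPath) {z w : V} (hz : z ∈ p.support) (hw : w ∈ p.support) (hzw : z ≠ w) :
    ∃ A B, IsSplit G {v | v ∈ p.support} A B ∧ a ∈ A ∧ b ∈ B ∧
      (z ∈ A ∧ w ∈ B ∨ w ∈ A ∧ z ∈ B) := by
  induction p with
  | nil => simp_all
  | @cons a c b h q ih =>
    rw [Walk.cons_isPath_iff] at hp
    have hins : {v | v ∈ (Walk.cons h q).support} = insert a {v | v ∈ q.support} := by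
      ext v; simp
    by_cases hend : z = a ∨ w = a
    · refine ⟨{a}, {v | v ∈ q.support}, ⟨by rw [hins]; rfl, by simpa using hp.2, ?_,
        q.connected_induce_support, a, rfl, c, q.start_mem_support, h⟩, rfl,
        q.end_mem_support, ?_⟩
      · rw [induce_singleton_eq_top]; exact connected_top
      · simp only [Walk.support_cons, List.mem_cons] at hz hw
        simp only [Set.mem_singleton_iff, Set.mem_ofPred_eq]
        grind
    · push Not at hend
      simp only [Walk.support_cons, List.mem_cons, hend.1, hend.2, false_or] at hz hw
      obtain ⟨A, B, hs, hcA, hbB, hsep⟩ := ih hp.1 hz hw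
      have hAq : A ⊆ {v | v ∈ q.support} := hs.union_eq ▸ Set.subset_union_left
      have hBq : B ⊆ {v | v ∈ q.support} := hs.union_eq ▸ Set.subset_union_right
      refine ⟨insert a A, B, ⟨by rw [hins, ← hs.union_eq, Set.insert_union], ?_, ?_,
        hs.right_connected, ?_⟩, Set.mem_insert _ _, hbB, ?_⟩
      · rw [Set.disjoint_insert_left]
        exact ⟨fun haB => hp.2 (hBq haB), hs.disjoint⟩
      · have := connected_induce_union (G := G) (s := {a}) (t := A) (v := a) (w := c)
          (by rw [induce_singleton_eq_top]; exact connected_top.preconnected)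
          hs.left_connected.preconnected rfl hcA h
        exact this
      · obtain ⟨u, hu, v, hv, huv⟩ := hs.exists_adj
        exact ⟨u, Or.inr hu, v, hv, huv⟩
      · rcases hsep with ⟨h₁, h₂⟩ | ⟨h₁, h₂⟩
        · exact Or.inl ⟨Or.inr h₁, h₂⟩
        · exact Or.inr ⟨Or.inr h₁, h₂⟩

/-- A family of branch sets of a complete minor indexed by `ι`. -/
structure IsCompleteModel {ι V : Type*} (G : SimpleGraph V) (f : ι → Set V) : Prop where
  connected : ∀ i, (G.induce (f i)).Connected
  disjoint : ∀ ⦃i j⦄, i ≠ j → Disjoint (f i) (f j)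
  exists_adj : ∀ ⦃i j⦄, i ≠ j → ∃ a ∈ f i, ∃ b ∈ f j, G.Adj a b

/-- A branch set may be enlarged by a connected set meeting the model's ambient set in at most
one vertex. -/
theorem IsCompleteModel.update {ι V : Type*} [DecidableEq ι] {G : SimpleGraph V}
    {f : ι → Set V} (hf : IsCompleteModel G f) {K A : Set V} (hK : ∀ i, f i ⊆ K) {i : ι} {k : V}
    (hk : k ∈ f i) (hkA : k ∈ A) (hA : (G.induce A).Connected) (hAK : A ∩ K ⊆ {k}) :
    IsCompleteModel G (Function.update f i (f i ∪ A)) := by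
  have hsub : ∀ j, f j ⊆ Function.update f i (f i ∪ A) j := by
    intro j
    by_cases hj : j = i
    · subst hj; simp
    · simp [hj]
  have hdis : ∀ j, j ≠ i → Disjoint (f i ∪ A) (f j) := by
    intro j hj
    rw [Set.disjoint_union_left]
    refine ⟨hf.disjoint hj.symm, Set.disjoint_left.2 fun v hvA hvj => ?_⟩
    obtain rfl : v = k := hAK ⟨hvA, hK j hvj⟩
    exact Set.disjoint_left.1 (hf.disjoint hj) hvj hk
  refine ⟨fun j => ?_, fun j l hjl => ?_, fun j l hjl => ?_⟩
  · by_cases hj : j = i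
    · subst hj
      rw [Function.update_self]
      exact induce_union_connected (hf.connected j).preconnected hA.preconnected ⟨k, hk, hkA⟩
    · rw [Function.update_of_ne hj]
      exact hf.connected j
  · by_cases hj : j = i
    · subst hj
      simpa [hjl.symm] using hdis l hjl.symm
    · by_cases hl : l = i
      · subst hl
        simpa [hj] using (hdis j hj).symm
      · simpa [hj, hl] using hf.disjoint hjl
  · obtain ⟨a, ha, b, hb, hab⟩ := hf.exists_adj hjl
    exact ⟨a, hsub j ha, b, hsub l hb, hab⟩

/-- Every two distinct vertices of `K` lie in different branch sets of some complete model whose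
branch sets are contained in `K`. -/
def SeparatedByModels {V : Type*} (ι : Type*) (G : SimpleGraph V) (K : Set V) : Prop :=
  ∀ ⦃z w⦄, z ∈ K → w ∈ K → z ≠ w → ∃ f : ι → Set V, IsCompleteModel G f ∧ (∀ i, f i ⊆ K) ∧
    ∃ i j, i ≠ j ∧ z ∈ f i ∧ w ∈ f j

/-- Separation by complete models is preserved by adding an ear. -/
theorem SeparatedByModels.union_ear {ι V : Type*} {G : SimpleGraph V} {K : Set V}
    (hK : SeparatedByModels ι G K) {k k' : V} (hkk' : k ≠ k') (hk : k ∈ K) (hk' : k' ∈ K)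
    (p : G.Walk k k') (hp : p.IsPath) (hpK : ∀ v ∈ p.support, v ∈ K → v = k ∨ v = k') :
    SeparatedByModels ι G (K ∪ {v | v ∈ p.support}) := by
  classical
  have hone : ∀ ⦃z w⦄, z ∈ p.support → w ∈ K → w ≠ k → w ≠ k' →
      ∃ f : ι → Set V, IsCompleteModel G f ∧ (∀ i, f i ⊆ K ∪ {v | v ∈ p.support}) ∧
        ∃ i j, i ≠ j ∧ z ∈ f i ∧ w ∈ f j := by
    intro z w hz hw hwk hwk'
    by_cases hzk' : z = k'
    · subst hzk'
      obtain ⟨f, hf, hfK, h⟩ := hK hk' hw hwk'.symm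
      exact ⟨f, hf, fun i => (hfK i).trans Set.subset_union_left, h⟩
    obtain ⟨A, B, hs, hkA, hkB, hsep⟩ := exists_isSplit p hp hz p.end_mem_support hzk'
    have hzA : z ∈ A := by
      rcases hsep with h | h
      · exact h.1
      · exact (Set.disjoint_left.1 hs.disjoint h.1 hkB).elim
    have hAp : A ⊆ {v | v ∈ p.support} := hs.union_eq ▸ Set.subset_union_left
    obtain ⟨f, hf, hfK, i, j, hij, hi, hj⟩ := hK hk hw hwk.symm
    refine ⟨Function.update f i (f i ∪ A), hf.update hfK hi hkA hs.left_connected ?_, ?_,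
      i, j, hij, by simp [hzA], by simpa [hij.symm] using hj⟩
    · rintro v ⟨hvA, hvK⟩
      rcases hpK v (hAp hvA) hvK with rfl | rfl
      · rfl
      · exact (Set.disjoint_left.1 hs.disjoint hvA hkB).elim
    · intro l
      by_cases hl : l = i
      · subst hl
        simpa using ⟨(hfK l).trans Set.subset_union_left, hAp.trans Set.subset_union_right⟩
      · simpa [hl] using (hfK l).trans Set.subset_union_left
  have hswap : ∀ ⦃z w : V⦄ ⦃L : Set V⦄, (∃ f : ι → Set V, IsCompleteModel G f ∧ (∀ i, f i ⊆ L) ∧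
      ∃ i j, i ≠ j ∧ z ∈ f i ∧ w ∈ f j) → ∃ f : ι → Set V, IsCompleteModel G f ∧
        (∀ i, f i ⊆ L) ∧ ∃ i j, i ≠ j ∧ w ∈ f i ∧ z ∈ f j := by
    rintro z w L ⟨f, hf, hfL, i, j, hij, hi, hj⟩
    exact ⟨f, hf, hfL, j, i, hij.symm, hj, hi⟩
  have hboth : ∀ ⦃z w⦄, z ∈ p.support → w ∈ p.support → z ≠ w →
      ∃ f : ι → Set V, IsCompleteModel G f ∧ (∀ i, f i ⊆ K ∪ {v | v ∈ p.support}) ∧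
        ∃ i j, i ≠ j ∧ z ∈ f i ∧ w ∈ f j := by
    intro z w hz hw hzw
    obtain ⟨A, B, hs, hkA, hkB, hsep⟩ := exists_isSplit p hp hz hw hzw
    have hAp : A ⊆ {v | v ∈ p.support} := hs.union_eq ▸ Set.subset_union_left
    have hBp : B ⊆ {v | v ∈ p.support} := hs.union_eq ▸ Set.subset_union_right
    obtain ⟨f, hf, hfK, i, j, hij, hi, hj⟩ := hK hk hk' hkk'
    have hg := hf.update hfK hi hkA hs.left_connected (by
      rintro v ⟨hvA, hvK⟩
      rcases hpK v (hAp hvA) hvK with rfl | rfl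
      · rfl
      · exact (Set.disjoint_left.1 hs.disjoint hvA hkB).elim)
    have hgK : ∀ l, Function.update f i (f i ∪ A) l ⊆ K ∪ A := by
      intro l
      by_cases hl : l = i
      · subst hl
        simpa using (hfK l).trans Set.subset_union_left
      · simpa [hl] using (hfK l).trans Set.subset_union_left
    set g := Function.update f i (f i ∪ A) with hgdef
    have hgj : g j = f j := by simp [hgdef, hij.symm]
    have hgi : g i = f i ∪ A := by simp [hgdef]
    have hh := hg.update hgK (hgj ▸ hj) hkB hs.right_connected (by
      rintro v ⟨hvB, hvK | hvA⟩
      · rcases hpK v (hBp hvB) hvK with rfl | rfl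
        · exact (Set.disjoint_left.1 hs.disjoint hkA hvB).elim
        · rfl
      · exact (Set.disjoint_left.1 hs.disjoint hvA hvB).elim)
    have hhK : ∀ l, Function.update g j (g j ∪ B) l ⊆ K ∪ {v | v ∈ p.support} := by
      have h : ∀ l, g l ⊆ K ∪ {v | v ∈ p.support} := fun l =>
        (hgK l).trans (Set.union_subset_union_right K hAp)
      intro l
      by_cases hl : l = j
      · subst hl
        simpa using ⟨h l, hBp.trans Set.subset_union_right⟩
      · simpa [hl] using h l
    rcases hsep with ⟨h₁, h₂⟩ | ⟨h₁, h₂⟩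
    · exact ⟨_, hh, hhK, i, j, hij, by simp [hij, hgi, h₁], by simp [h₂]⟩
    · exact ⟨_, hh, hhK, j, i, hij.symm, by simp [h₂], by simp [hij, hgi, h₁]⟩
  intro z w hz hw hzw
  by_cases hz' : z ∈ p.support
  · by_cases hw' : w ∈ p.support
    · exact hboth hz' hw' hzw
    · refine hone hz' (hw.resolve_right hw') ?_ ?_
      · rintro rfl; exact hw' p.start_mem_support
      · rintro rfl; exact hw' p.end_mem_support
  · have hzK := hz.resolve_right hz'
    by_cases hw' : w ∈ p.support
    · refine hswap (hone hw' hzK ?_ ?_)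
      · rintro rfl; exact hz' p.start_mem_support
      · rintro rfl; exact hz' p.end_mem_support
    · obtain ⟨f, hf, hfK, h⟩ := hK hzK (hw.resolve_right hw') hzw
      exact ⟨f, hf, fun i => (hfK i).trans Set.subset_union_left, h⟩

/-- Every walk into `K` has a path along it that stops at its first vertex in `K`. -/
theorem exists_isPath_to_first {V : Type*} {G : SimpleGraph V} {K : Set V} {v z : V}
    (p : G.Walk v z) (hz : z ∈ K) : ∃ k ∈ K, ∃ q : G.Walk v k, q.IsPath ∧
      (∀ u ∈ q.support, u ∈ p.support) ∧ ∀ u ∈ q.support, u ∈ K → u = k := by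
  classical
  suffices h : ∃ k ∈ K, ∃ q : G.Walk v k, (∀ u ∈ q.support, u ∈ p.support) ∧
      ∀ u ∈ q.support, u ∈ K → u = k by
    obtain ⟨k, hk, q, hqp, hq⟩ := h
    have hb := q.support_bypass_subset_support
    exact ⟨k, hk, q.bypass, q.bypass_isPath, fun u hu => hqp u (hb hu),
      fun u hu => hq u (hb hu)⟩
  induction p with
  | nil => exact ⟨_, hz, Walk.nil, by simp, by simp⟩
  | @cons v c z h p ih =>
    by_cases hv : v ∈ K
    · exact ⟨v, hv, Walk.nil, by simp, by simp⟩
    · obtain ⟨k, hk, q, hqp, hq⟩ := ih hz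
      refine ⟨k, hk, Walk.cons h q, ?_, ?_⟩
      · simp only [Walk.support_cons, List.mem_cons]
        rintro u (rfl | hu)
        · exact Or.inl rfl
        · exact Or.inr (hqp u hu)
      · simp only [Walk.support_cons, List.mem_cons]
        rintro u (rfl | hu) huK
        · exact (hv huK).elim
        · exact hq u hu huK

/-- If no single vertex separates `G`, then separation by complete models spreads from any set
with at least two vertices to the whole graph. -/
theorem SeparatedByModels.univ {ι V : Type*} [Finite V] {G : SimpleGraph V}
    (hG : ∀ k u v : V, u ≠ k → v ≠ k → ∃ p : G.Walk u v, k ∉ p.support)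
    {K : Set V} (hK : SeparatedByModels ι G K) (hKnt : K.Nontrivial) :
    SeparatedByModels ι G Set.univ := by
  obtain ⟨L, hKL, hL⟩ := (Set.toFinite {L : Set V | SeparatedByModels ι G L}).exists_le_maximal hK
  have hLnt : L.Nontrivial := hKnt.mono hKL
  suffices h : L = Set.univ from h ▸ hL.prop
  rw [Set.eq_univ_iff_forall]
  by_contra! hv
  obtain ⟨v, hv⟩ := hv
  obtain ⟨z, hz, z', hz', hzz'⟩ := hLnt
  obtain ⟨p, -⟩ := hG z' z v hzz' (fun h => hv (h ▸ hz'))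
  obtain ⟨d, -, hd₁, hd₂⟩ := p.exists_boundary_dart L hz hv
  obtain ⟨w, hw, hwd⟩ := (hKnt.mono hKL).exists_ne d.fst
  obtain ⟨q, hq⟩ := hG d.fst d.snd w (fun h => hd₂ (h ▸ hd₁)) hwd
  obtain ⟨k', hk', r, hr, hrq, hrL⟩ := exists_isPath_to_first q hw
  have hdr : d.fst ∉ r.support := fun h => hq (hrq _ h)
  have hear := hL.prop.union_ear (k := d.fst) (k' := k')
    (fun h => hdr (h ▸ r.end_mem_support)) hd₁ hk' (Walk.cons d.adj r)
    ((Walk.cons_isPath_iff _ _).2 ⟨hr, hdr⟩) (by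
      simp only [Walk.support_cons, List.mem_cons]
      rintro u (rfl | hu) huL
      · exact Or.inl rfl
      · exact Or.inr (hrL u hu huL))
  exact hd₂ (hL.le_of_ge hear Set.subset_union_left (Or.inr (by simp)))

/-- A subdivision of a complete graph gives a complete model in which a prescribed pair of vertices
on one subdivided edge is separated. -/
theorem SubdivisionEmbedding.exists_model {W V : Type} [LinearOrder W] {G : SimpleGraph V}
    (E : SubdivisionEmbedding (completeGraph W) G) {a b : W} (hab : a < b) {z w : V}
    (hz : z ∈ (E.walk (show (completeGraph W).Adj a b from hab.ne)).support)
    (hw : w ∈ (E.walk (show (completeGraph W).Adj a b from hab.ne)).support) (hzw : z ≠ w) :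
    ∃ f : W → Set V, IsCompleteModel G f ∧ (∀ i, E.branch i ∈ f i) ∧
      (∀ i, ∀ v ∈ f i, v = E.branch i ∨ ∃ (j : W) (h : (completeGraph W).Adj i j),
        v ∈ (E.walk h).support) ∧
      (∀ ⦃i j⦄ (h : (completeGraph W).Adj i j), ∀ v ∈ (E.walk h).support, v ∈ f i ∨ v ∈ f j) ∧
      (z ∈ f a ∧ w ∈ f b ∨ w ∈ f a ∧ z ∈ f b) := by
  have key : ∀ i j : W, ∃ A B : Set V, ∀ h : i < j,
      IsSplit G {v | v ∈ (E.walk (show (completeGraph W).Adj i j from h.ne)).support} A B ∧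
      E.branch i ∈ A ∧ E.branch j ∈ B ∧
      (i = a → j = b → (z ∈ A ∧ w ∈ B ∨ w ∈ A ∧ z ∈ B)) := by
    intro i j
    by_cases h : i < j
    · by_cases hij : i = a ∧ j = b
      · obtain ⟨rfl, rfl⟩ := hij
        obtain ⟨A, B, hs, hA, hB, hsep⟩ := exists_isSplit _ (E.walk_isPath _) hz hw hzw
        exact ⟨A, B, fun _ => ⟨hs, hA, hB, fun _ _ => hsep⟩⟩
      · obtain ⟨A, B, hs, hA, hB, -⟩ := exists_isSplit
          (E.walk (show (completeGraph W).Adj i j from h.ne)) (E.walk_isPath _)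
          (Walk.start_mem_support _) (Walk.end_mem_support _) (fun he => h.ne (E.inj he))
        exact ⟨A, B, fun _ => ⟨hs, hA, hB, fun h₁ h₂ => (hij ⟨h₁, h₂⟩).elim⟩⟩
    · exact ⟨∅, ∅, fun h' => (h h').elim⟩
  choose A B hAB using key
  have hsupp : ∀ ⦃i j⦄ (h : (completeGraph W).Adj i j) (v : V),
      v ∈ (E.walk h.symm).support ↔ v ∈ (E.walk h).support := by
    intro i j h v
    rw [E.walk_symm h]; simp
  let T : W → W → Set V := fun i j => if i < j then A i j else if j < i then B j i else {E.branch i}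
  have hTlt : ∀ {i j}, i < j → T i j = A i j := fun h => by simp [T, h]
  have hTgt : ∀ {i j}, j < i → T i j = B j i := fun h => by simp [T, h, h.not_gt]
  have hTself : ∀ i, T i i = {E.branch i} := fun i => by simp [T]
  have hTsplit : ∀ ⦃i j⦄ (h : (completeGraph W).Adj i j),
      IsSplit G {v | v ∈ (E.walk h).support} (T i j) (T j i) := by
    intro i j h
    rcases lt_or_gt_of_ne (show i ≠ j from h) with hlt | hlt
    · rw [hTlt hlt, hTgt hlt]; exact (hAB i j hlt).1
    · rw [hTgt hlt, hTlt hlt]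
      obtain ⟨h₁, h₂, h₃, h₄, u, hu, v, hv, huv⟩ := (hAB j i hlt).1
      refine ⟨?_, h₂.symm, h₄, h₃, v, hv, u, hu, huv.symm⟩
      rw [Set.union_comm, h₁]
      ext v
      exact hsupp h v
  have hTbranch : ∀ i j, E.branch i ∈ T i j := by
    intro i j
    rcases lt_trichotomy i j with h | rfl | h
    · rw [hTlt h]; exact (hAB i j h).2.1
    · rw [hTself]; rfl
    · rw [hTgt h]; exact (hAB j i h).2.2.1
  have hTconn : ∀ i j, (G.induce (T i j)).Connected := by
    intro i j
    by_cases h : i = j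
    · subst h; rw [hTself, induce_singleton_eq_top]; exact connected_top
    · exact (hTsplit h).left_connected
  have hTsub : ∀ ⦃i j⦄ (h : (completeGraph W).Adj i j), ∀ v ∈ T i j, v ∈ (E.walk h).support := by
    intro i j h v hv
    have := (hTsplit h).union_eq
    exact this.subset (Or.inl hv)
  have hTb : ∀ i j u, E.branch u ∈ T i j → u = i := by
    intro i j u hu
    by_cases h : i = j
    · subst h; rw [hTself] at hu; exact E.inj hu
    · rcases E.branch_support h u (hTsub h _ hu) with rfl | rfl
      · rfl
      · exact (Set.disjoint_left.1 (hTsplit h).disjoint hu (hTbranch _ _)).elim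
  have hTdis : ∀ i j k l, i ≠ k → Disjoint (T i j) (T k l) := by
    intro i j k l hik
    refine Set.disjoint_left.2 fun v hv hv' => ?_
    by_cases hij : i = j
    · subst hij
      rw [hTself] at hv
      subst hv
      exact hik (hTb _ _ _ hv')
    by_cases hkl : k = l
    · subst hkl
      rw [hTself] at hv'
      subst hv'
      exact hik (hTb _ _ _ hv).symm
    by_cases hs : s(i, j) = s(k, l)
    · rw [Sym2.eq_iff] at hs
      rcases hs with ⟨rfl, rfl⟩ | ⟨rfl, rfl⟩
      · exact hik rfl
      · exact Set.disjoint_left.1 (hTsplit hij).disjoint hv hv'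
    · obtain ⟨u, rfl, -⟩ := E.support_disjoint hij hkl hs v (hTsub hij v hv) (hTsub hkl v hv')
      exact hik ((hTb _ _ _ hv).symm.trans (hTb _ _ _ hv'))
  have hmem : ∀ ⦃i v⦄ j, v ∈ T i j → v ∈ ⋃ j, T i j := fun i v j h => Set.mem_iUnion.2 ⟨j, h⟩
  refine ⟨fun i => ⋃ j, T i j, ⟨fun i => ?_, fun i k hik => ?_, fun i j hij => ?_⟩,
    fun i => hmem i (hTbranch i i), fun i v hv => ?_, fun i j h v hv => ?_, ?_⟩
  · rw [← Set.sUnion_range]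
    apply induce_sUnion_connected_of_pairwise_not_disjoint (Set.range_nonempty_iff_nonempty.2 ⟨i⟩)
    · rintro _ _ ⟨j, rfl⟩ ⟨k, rfl⟩
      exact ⟨E.branch i, hTbranch i j, hTbranch i k⟩
    · rintro _ ⟨j, rfl⟩
      exact hTconn i j
  · simp only [Set.disjoint_iUnion_left, Set.disjoint_iUnion_right]
    exact fun j l => hTdis _ _ _ _ hik
  · obtain ⟨u, hu, v, hv, huv⟩ := (hTsplit hij).exists_adj
    exact ⟨u, hmem j hu, v, hmem i hv, huv⟩
  · obtain ⟨j, hj⟩ := Set.mem_iUnion.1 hv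
    by_cases h : i = j
    · subst h; rw [hTself] at hj; exact Or.inl hj
    · exact Or.inr ⟨j, h, hTsub h v hj⟩
  · exact ((hTsplit h).union_eq.symm.subset hv).imp (hmem j) (hmem i)
  · have h := (hAB a b hab).2.2.2 rfl rfl
    rw [← hTlt hab, ← hTgt hab] at h
    exact h.imp (And.imp (hmem b) (hmem a)) (And.imp (hmem b) (hmem a))

/-- Any two vertices of a subdivided complete graph are separated by a complete model inside it. -/
theorem SubdivisionEmbedding.separatedByModels {W V : Type} [LinearOrder W] {G : SimpleGraph V}
    (E : SubdivisionEmbedding (completeGraph W) G) :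
    SeparatedByModels W G
      {v | ∃ (i j : W) (h : (completeGraph W).Adj i j), v ∈ (E.walk h).support} := by
  set K := {v | ∃ (i j : W) (h : (completeGraph W).Adj i j), v ∈ (E.walk h).support}
  have hmodel : ∀ ⦃a b : W⦄ (hab : (completeGraph W).Adj a b) ⦃z w : V⦄,
      z ∈ (E.walk hab).support → w ∈ (E.walk hab).support → z ≠ w →
      ∃ f : W → Set V, IsCompleteModel G f ∧ (∀ i, f i ⊆ K) ∧ (∀ i, E.branch i ∈ f i) ∧
      (∀ ⦃i j⦄ (h : (completeGraph W).Adj i j), ∀ v ∈ (E.walk h).support, v ∈ f i ∨ v ∈ f j) ∧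
      (z ∈ f a ∧ w ∈ f b ∨ w ∈ f a ∧ z ∈ f b) := by
    intro a b hab z w hz hw hzw
    have hbranch : ∀ i, E.branch i ∈ K := by
      intro i
      by_cases h : i = a
      · subst h; exact ⟨i, b, hab, Walk.start_mem_support _⟩
      · exact ⟨i, a, h, Walk.start_mem_support _⟩
    rcases lt_or_gt_of_ne (show a ≠ b from hab) with hlt | hlt
    · obtain ⟨f, hf, hb, hsub, hcov, hsep⟩ := E.exists_model hlt hz hw hzw
      refine ⟨f, hf, fun i v hv => ?_, hb, hcov, hsep⟩
      rcases hsub i v hv with rfl | ⟨j, h, hj⟩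
      · exact hbranch i
      · exact ⟨i, j, h, hj⟩
    · have hrev : ∀ v, v ∈ (E.walk hab).support → v ∈ (E.walk hab.symm).support := by
        intro v hv
        rw [E.walk_symm hab]; simpa using hv
      obtain ⟨f, hf, hb, hsub, hcov, hsep⟩ := E.exists_model hlt (hrev z hz) (hrev w hw) hzw
      refine ⟨f, hf, fun i v hv => ?_, hb, hcov, hsep.symm.imp And.symm And.symm⟩
      rcases hsub i v hv with rfl | ⟨j, h, hj⟩
      · exact hbranch i
      · exact ⟨i, j, h, hj⟩
  intro z w hz hw hzw
  obtain ⟨a, b, hab, hza⟩ := hz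
  obtain ⟨c, d, hcd, hwc⟩ := hw
  by_cases hwa : w ∈ (E.walk hab).support
  · obtain ⟨f, hf, hfK, -, -, hsep⟩ := hmodel hab hza hwa hzw
    rcases hsep with ⟨h₁, h₂⟩ | ⟨h₁, h₂⟩
    · exact ⟨f, hf, hfK, a, b, hab, h₁, h₂⟩
    · exact ⟨f, hf, hfK, b, a, hab.symm, h₂, h₁⟩
  by_cases hzc : z ∈ (E.walk hcd).support
  · obtain ⟨f, hf, hfK, -, -, hsep⟩ := hmodel hcd hzc hwc hzw
    rcases hsep with ⟨h₁, h₂⟩ | ⟨h₁, h₂⟩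
    · exact ⟨f, hf, hfK, c, d, hcd, h₁, h₂⟩
    · exact ⟨f, hf, hfK, d, c, hcd.symm, h₂, h₁⟩
  wlog hacd : a ≠ c ∧ a ≠ d generalizing a b
  · refine this b a hab.symm (by rw [E.walk_symm hab]; simpa using hza)
      (by rw [E.walk_symm hab]; simpa using hwa) ⟨?_, ?_⟩
    · rintro rfl
      have had : a = d := by
        by_contra h
        exact hacd ⟨hab, h⟩
      subst had
      exact hwa (by rw [E.walk_symm hcd]; simpa using hwc)
    · rintro rfl
      have hac : a = c := by
        by_contra h
        exact hacd ⟨h, hab⟩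
      subst hac
      exact hwa hwc
  suffices h : ∃ f : W → Set V, IsCompleteModel G f ∧ (∀ i, f i ⊆ K) ∧
      (∀ ⦃i j⦄ (h : (completeGraph W).Adj i j), ∀ v ∈ (E.walk h).support, v ∈ f i ∨ v ∈ f j) ∧
      ∃ e, e ≠ c ∧ e ≠ d ∧ z ∈ f e by
    obtain ⟨f, hf, hfK, hcov, e, hec, hed, hze⟩ := h
    rcases hcov hcd w hwc with h | h
    · exact ⟨f, hf, hfK, e, c, hec, hze, h⟩
    · exact ⟨f, hf, hfK, e, d, hed, hze, h⟩
  by_cases hzb : z = E.branch b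
  · subst hzb
    obtain ⟨f, hf, hfK, hb, hcov, -⟩ := hmodel hab (Walk.start_mem_support _)
      (Walk.end_mem_support _) (fun he => hab (E.inj he))
    refine ⟨f, hf, hfK, hcov, b, ?_, ?_, hb b⟩
    · rintro rfl; exact hzc (Walk.start_mem_support _)
    · rintro rfl; exact hzc (Walk.end_mem_support _)
  · obtain ⟨f, hf, hfK, hb, hcov, hsep⟩ := hmodel hab hza (Walk.end_mem_support _) hzb
    refine ⟨f, hf, hfK, hcov, a, hacd.1, hacd.2, ?_⟩
    rcases hsep with h | h
    · exact h.1
    · exact (Set.disjoint_left.1 (hf.disjoint hab) h.1 (hb b)).elim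

/-- Deleting one vertex from a `2`-connected graph leaves the rest connected. -/
theorem KConnected.exists_walk_avoiding {V : Type} {G : SimpleGraph V} (hG : KConnected 2 G)
    {k u v : V} (hu : u ≠ k) (hv : v ≠ k) : ∃ p : G.Walk u v, k ∉ p.support := by
  by_cases huv : u = v
  · subst huv
    exact ⟨Walk.nil, by simpa using hu.symm⟩
  obtain ⟨P, -, -, hP⟩ := hG huv
  by_contra! h
  rcases hP 0 1 (by decide) k (h _) (h _) with rfl | rfl
  · exact hu rfl
  · exact hv rfl

section AugComp

variable {V : Type} {G : SimpleGraph V} {S : Set V} {C : (G.induce Sᶜ).ConnectedComponent}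

theorem augComp_adj {u v : ↥(Subtype.val '' C.supp ∪ S)} :
    (augComp G S C).Adj u v ↔ u ≠ v ∧ (G.Adj (u : V) v ∨ ((u : V) ∈ S ∧ (v : V) ∈ S)) := by
  simp only [augComp, fromRel_adj]
  constructor
  · rintro ⟨h, h' | h' | h'⟩
    · exact ⟨h, h'⟩
    · exact ⟨h, Or.inl h'.symm⟩
    · exact ⟨h, Or.inr h'.symm⟩
  · exact fun ⟨h, h'⟩ => ⟨h, Or.inl h'⟩

theorem mem_of_adj_of_not_mem {u v : V} (hu : u ∈ Subtype.val '' C.supp ∪ S)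
    (hv : v ∉ Subtype.val '' C.supp ∪ S) (h : G.Adj u v) : u ∈ S := by
  rcases hu with ⟨a, ha, rfl⟩ | hu
  · have hvS : v ∉ S := fun h' => hv (Or.inr h')
    refine (hv (Or.inl ⟨⟨v, hvS⟩, C.mem_supp_of_adj_mem_supp ha ?_, rfl⟩)).elim
    exact h
  · exact hu

/-- Deleting one vertex from an augmented component of a `2`-connected graph leaves the rest
connected. -/
theorem augComp_exists_walk_avoiding (hG : KConnected 2 G)
    (k u v : ↥(Subtype.val '' C.supp ∪ S)) (hu : u ≠ k) (hv : v ≠ k) :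
    ∃ p : (augComp G S C).Walk u v, k ∉ p.support := by
  obtain ⟨p, hp⟩ := hG.exists_walk_avoiding (k := (k : V)) (u := u) (v := v)
    (fun h => hu (Subtype.ext h)) (fun h => hv (Subtype.ext h))
  suffices h : ∀ (a b : V) (q : G.Walk a b) (hb : b ∈ Subtype.val '' C.supp ∪ S),
      (k : V) ∉ q.support →
      (∀ ha : a ∈ Subtype.val '' C.supp ∪ S,
        ∃ r : (augComp G S C).Walk ⟨a, ha⟩ ⟨b, hb⟩, k ∉ r.support) ∧
      (a ∉ Subtype.val '' C.supp ∪ S → ∀ s (hs : s ∈ S), s ≠ k →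
        ∃ r : (augComp G S C).Walk ⟨s, Or.inr hs⟩ ⟨b, hb⟩, k ∉ r.support) from
    (h u v p v.2 hp).1 u.2
  intro a b q hb
  induction q with
  | nil =>
    intro hk
    refine ⟨fun ha => ⟨Walk.nil, ?_⟩, fun ha => (ha hb).elim⟩
    simpa [Subtype.ext_iff] using hk
  | @cons a c b h q ih =>
    intro hk
    simp only [Walk.support_cons, List.mem_cons, not_or] at hk
    obtain ⟨ih₁, ih₂⟩ := ih hb hk.2
    have hck : c ≠ k := fun h' => hk.2 (h' ▸ q.start_mem_support)
    refine ⟨fun ha => ?_, fun ha s hs hsk => ?_⟩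
    · by_cases hc : c ∈ Subtype.val '' C.supp ∪ S
      · obtain ⟨r, hr⟩ := ih₁ hc
        refine ⟨Walk.cons (augComp_adj.2 ⟨?_, Or.inl h⟩) r, ?_⟩
        · exact fun h' => h.ne (congrArg Subtype.val h')
        · simpa [Subtype.ext_iff, hr] using hk.1
      · exact ih₂ hc a (mem_of_adj_of_not_mem ha hc h) (Ne.symm hk.1)
    · by_cases hc : c ∈ Subtype.val '' C.supp ∪ S
      · obtain ⟨r, hr⟩ := ih₁ hc
        by_cases hsc : s = c
        · subst hsc
          exact ⟨r, hr⟩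
        · refine ⟨Walk.cons (augComp_adj.2 ⟨?_, Or.inr ⟨hs, ?_⟩⟩) r, ?_⟩
          · exact fun h' => hsc (congrArg Subtype.val h')
          · exact mem_of_adj_of_not_mem hc ha h.symm
          · simpa [Subtype.ext_iff, hr] using hsk.symm
      · exact ih₂ hc s hs hsk

end AugComp

/-- If an augmented component at `{x, y}` contains a subdivided `K₄`, then it contains a `K₄` model
with `x` and `y` in different branch sets, which is a model in `G` up to the edge joining these
two branch sets. -/
theorem exists_rooted_model {V : Type} [Finite V] {G : SimpleGraph V} (hG : KConnected 2 G)
    {x y : V} (hxy : x ≠ y) (C : (G.induce (({x, y} : Set V)ᶜ)).ConnectedComponent)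
    (E : SubdivisionEmbedding (completeGraph (Fin 4)) (augComp G {x, y} C)) :
    ∃ f : Fin 4 → Set V, (∀ i, (G.induce (f i)).Connected) ∧
      (∀ ⦃i j⦄, i ≠ j → Disjoint (f i) (f j)) ∧
      (∀ ⦃i j⦄, i ≠ j → 2 ≤ j → ∃ a ∈ f i, ∃ b ∈ f j, G.Adj a b) ∧
      (∀ i, f i ⊆ Subtype.val '' C.supp ∪ {x, y}) ∧ x ∈ f 0 ∧ y ∈ f 1 := by
  have hK : SeparatedByModels (Fin 4) (augComp G {x, y} C) Set.univ := by
    refine E.separatedByModels.univ (augComp_exists_walk_avoiding hG) ?_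
    have h01 : (completeGraph (Fin 4)).Adj 0 1 := by decide
    exact ⟨_, ⟨0, 1, h01, Walk.start_mem_support _⟩, _, ⟨0, 1, h01, Walk.end_mem_support _⟩,
      fun he => h01 (E.inj he)⟩
  have hxS : x ∈ Subtype.val '' C.supp ∪ {x, y} := Or.inr (by simp)
  have hyS : y ∈ Subtype.val '' C.supp ∪ {x, y} := Or.inr (by simp)
  obtain ⟨f, hf, -, i, j, hij, hxi, hyj⟩ := hK (Set.mem_univ ⟨x, hxS⟩) (Set.mem_univ ⟨y, hyS⟩)
    (fun h => hxy (congrArg Subtype.val h))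
  obtain ⟨σ, hσ0, hσ1⟩ : ∃ σ : Equiv.Perm (Fin 4), σ 0 = i ∧ σ 1 = j := by
    have h : ∀ i j : Fin 4, i ≠ j → ∃ σ : Equiv.Perm (Fin 4), σ 0 = i ∧ σ 1 = j := by decide
    exact h i j hij
  have hx0 : ⟨x, hxS⟩ ∈ f (σ 0) := hσ0 ▸ hxi
  have hy1 : ⟨y, hyS⟩ ∈ f (σ 1) := hσ1 ▸ hyj
  have hxonly : ∀ l (u : ↥(Subtype.val '' C.supp ∪ {x, y})),
      u ∈ f (σ l) → (u : V) = x → l = 0 := by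
    intro l u hu hux
    obtain rfl : u = ⟨x, hxS⟩ := Subtype.ext hux
    by_contra h
    exact Set.disjoint_left.1 (hf.disjoint (fun h' => h (σ.injective h'))) hu hx0
  have hyonly : ∀ l (u : ↥(Subtype.val '' C.supp ∪ {x, y})),
      u ∈ f (σ l) → (u : V) = y → l = 1 := by
    intro l u hu huy
    obtain rfl : u = ⟨y, hyS⟩ := Subtype.ext huy
    by_contra h
    exact Set.disjoint_left.1 (hf.disjoint (fun h' => h (σ.injective h'))) hu hy1
  refine ⟨fun l => Subtype.val '' f (σ l), fun l => ?_, fun l m hlm => ?_, fun l m hlm hm => ?_,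
    fun l => ?_, ⟨_, hx0, rfl⟩, ⟨_, hy1, rfl⟩⟩
  · let φ : (augComp G {x, y} C).induce (f (σ l)) →g G.induce (Subtype.val '' f (σ l)) :=
      { toFun := fun u => ⟨u.1.1, u.1, u.2, rfl⟩
        map_rel' := by
          intro u v huv
          have huv : (augComp G {x, y} C).Adj u.1 v.1 := huv
          obtain ⟨hne, h | ⟨hu, hv⟩⟩ := augComp_adj.1 huv
          · exact h
          · exfalso
            rcases hu with hu | hu <;> rcases hv with hv | hv
            · exact hne (Subtype.ext (hu.trans hv.symm))
            · have h0 := hxonly l _ u.2 hu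
              rw [hyonly l _ v.2 hv] at h0
              exact absurd h0 (by decide)
            · have h0 := hxonly l _ v.2 hv
              rw [hyonly l _ u.2 hu] at h0
              exact absurd h0 (by decide)
            · exact hne (Subtype.ext (hu.trans hv.symm)) }
    refine (hf.connected (σ l)).map φ ?_
    rintro ⟨_, u, hu, rfl⟩
    exact ⟨⟨u, hu⟩, rfl⟩
  · rw [Set.disjoint_image_iff Subtype.val_injective]
    exact hf.disjoint (fun h => hlm (σ.injective h))
  · obtain ⟨u, hu, v, hv, huv⟩ := hf.exists_adj (fun h => hlm (σ.injective h))
    refine ⟨u, ⟨u, hu, rfl⟩, v, ⟨v, hv, rfl⟩, ?_⟩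
    obtain ⟨-, h | ⟨-, h | h⟩⟩ := augComp_adj.1 huv
    · exact h
    · rw [hxonly m _ hv h] at hm; exact absurd hm (by decide)
    · rw [hyonly m _ hv h] at hm; exact absurd hm (by decide)
  · rintro _ ⟨u, -, rfl⟩
    exact u.2

/-- If `G` is biconnected and two distinct augmented connected components of `G - {x,y}`
each contain a subdivision of `K₄` as a subgraph, then the graph obtained from `K₂,₄`
by adding the edges `m₁m₂` and `m₃m₄` is a minor of `G`. -/
theorem two_K4_subdivisions_give_minor {V : Type} [Finite V] (G : SimpleGraph V)
    (hG : KConnected 2 G) (x y : V) (hxy : x ≠ y) (hsep : IsSeparator G {x, y})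
    (C₁ C₂ : (G.induce (({x, y} : Set V)ᶜ)).ConnectedComponent) (hne : C₁ ≠ C₂)
    (h1 : Nonempty (SubdivisionEmbedding (completeGraph (Fin 4)) (augComp G {x, y} C₁)))
    (h2 : Nonempty (SubdivisionEmbedding (completeGraph (Fin 4)) (augComp G {x, y} C₂))) :
    IsMinorOf
      (mkGraph 6 [(0,2),(0,3),(0,4),(0,5),(1,2),(1,3),(1,4),(1,5),(2,3),(4,5)]) G := by
  obtain ⟨E₁⟩ := h1
  obtain ⟨E₂⟩ := h2
  obtain ⟨f, hfc, hfd, hfa, hfs, hfx, hfy⟩ := exists_rooted_model hG hxy C₁ E₁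
  obtain ⟨g, hgc, hgd, hga, hgs, hgx, hgy⟩ := exists_rooted_model hG hxy C₂ E₂
  have hcross : ∀ v, v ∈ Subtype.val '' C₁.supp ∪ {x, y} → v ∈ Subtype.val '' C₂.supp ∪ {x, y} →
      v = x ∨ v = y := by
    rintro v (⟨a, ha, rfl⟩ | hv) h₂
    · rcases h₂ with ⟨b, hb, hba⟩ | hv
      · obtain rfl := Subtype.ext hba
        exact (hne (ha.symm.trans hb)).elim
      · exact hv
    · exact hv
  have hfg : ∀ i j, (i ≠ 0 ∨ j ≠ 0) → (i ≠ 1 ∨ j ≠ 1) → Disjoint (f i) (g j) := by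
    intro i j h₀ h₁
    refine Set.disjoint_left.2 fun v hvf hvg => ?_
    rcases hcross v (hfs i hvf) (hgs j hvg) with rfl | rfl
    · rcases h₀ with h | h
      · exact Set.disjoint_left.1 (hfd h) hvf hfx
      · exact Set.disjoint_left.1 (hgd h) hvg hgx
    · rcases h₁ with h | h
      · exact Set.disjoint_left.1 (hfd h) hvf hfy
      · exact Set.disjoint_left.1 (hgd h) hvg hgy
  have hgf : ∀ i j, (i ≠ 0 ∨ j ≠ 0) → (i ≠ 1 ∨ j ≠ 1) → Disjoint (g j) (f i) :=
    fun i j h h' => (hfg i j h h').symm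
  let F : Fin 6 → Set V := ![f 0 ∪ g 0, f 1 ∪ g 1, f 2, f 3, g 2, g 3]
  have hF : ∀ i j : Fin 6, (mkGraph 6 [(0,2),(0,3),(0,4),(0,5),(1,2),(1,3),(1,4),(1,5),(2,3),
      (4,5)]).Adj i j → i < j → ∃ a ∈ F i, ∃ b ∈ F j, G.Adj a b := by
    have hfa' : ∀ ⦃i j⦄ (X : Set V), i ≠ j → 2 ≤ j → ∃ a ∈ f i ∪ X, ∃ b ∈ f j, G.Adj a b := by
      intro i j X hij hj
      obtain ⟨a, ha, h⟩ := hfa hij hj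
      exact ⟨a, Or.inl ha, h⟩
    have hga' : ∀ ⦃i j⦄ (X : Set V), i ≠ j → 2 ≤ j → ∃ a ∈ X ∪ g i, ∃ b ∈ g j, G.Adj a b := by
      intro i j X hij hj
      obtain ⟨a, ha, h⟩ := hga hij hj
      exact ⟨a, Or.inr ha, h⟩
    intro i j h hij
    fin_cases i <;> fin_cases j <;> first
      | exact absurd hij (by decide)
      | exact hfa' _ (by decide) (by decide)
      | exact hga' _ (by decide) (by decide)
      | exact hfa (by decide) (by decide)
      | exact hga (by decide) (by decide)
      | simp [mkGraph] at h
  refine ⟨F, fun i => ?_, fun i j hij => ?_, fun i j hij => ?_⟩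
  · fin_cases i
    · exact induce_union_connected (hfc 0).preconnected (hgc 0).preconnected ⟨x, hfx, hgx⟩
    · exact induce_union_connected (hfc 1).preconnected (hgc 1).preconnected ⟨y, hfy, hgy⟩
    · exact hfc 2
    · exact hfc 3
    · exact hgc 2
    · exact hgc 3
  · fin_cases i <;> fin_cases j <;> first
      | exact absurd rfl hij
      | simp [F, Set.disjoint_union_left, Set.disjoint_union_right, hfd, hgd, hfg, hgf]
  · rcases lt_or_gt_of_ne hij.ne with h | h
    · exact hF i j hij h
    · obtain ⟨a, ha, b, hb, hab⟩ := hF j i hij.symm h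
      exact ⟨b, hb, a, ha, hab.symm⟩
end
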